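/- Let n ≥ 2, let F_n be the free group on e₁,…,e_n, and let 0 ≤ d < 1/16. Let (Σ_{ij}(x̄,ā))_{i ≤ m, j ≤ m_i} be a finite family of finite sets of words in variables x̄ and constants ā from F_n, and let σ(x̄,ā) be a word such that in F_n, for every assignment of x̄, the disjunction over i of the conjunctions over j of Σ_{ij}(x̄,ā) = 1 is equivalent to σ(x̄,ā) = 1. Then, with probability tending to 1 as ℓ → ∞, the same equivalence holds in the random group Γ_ℓ of density d: for every assignment of x̄ in Γ_ℓ, the disjunction of conjunctions of equations Σ_{ij}(x̄,π_ℓ(ā)) = 1 holds in Γ_ℓ if and only if σ(x̄,π_ℓ(ā)) = 1 holds in Γ_ℓ. -/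

import Mathlib

open Filter

/-- A boolean combination of equations `w = 1`, where the words `w` range over `α`. -/
inductive BoolComb (α : Type*) : Type _
  | eq : α → BoolComb α
  | not : BoolComb α → BoolComb α
  | and : BoolComb α → BoolComb α → BoolComb α
  | or : BoolComb α → BoolComb α → BoolComb α

/-- Truth of a boolean combination of equations under an evaluation `ev` of the words
in a group `G`. -/
def BoolComb.Holds {α : Type*} {G : Type*} [Group G] (ev : α → G) : BoolComb α → Prop
  | .eq w => ev w = 1
  | .not φ => ¬ BoolComb.Holds ev φ
  | .and φ ψ => BoolComb.Holds ev φ ∧ BoolComb.Holds ev ψ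
  | .or φ ψ => BoolComb.Holds ev φ ∨ BoolComb.Holds ev ψ

/-- The number of relators `⌊(2n-1)^(dℓ)⌋` at density `d` and length `ℓ`. -/
noncomputable def numRel (n : ℕ) (d : ℝ) (ℓ : ℕ) : ℕ :=
  ⌊(2 * (n : ℝ) - 1) ^ (d * (ℓ : ℝ))⌋₊

/-- The tuples of `N` relators, each a reduced word of length `ℓ` in the free group
on `n` generators. -/
def relTuples (n ℓ N : ℕ) : Set (Fin N → FreeGroup (Fin n)) :=
  {r | ∀ i, ((r i).toWord).length = ℓ}

/-- The random group presented by a tuple `r` of relators: the quotient of the free group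
on `n` generators by the normal closure of the relators. -/
abbrev RandGroup {n N : ℕ} (r : Fin N → FreeGroup (Fin n)) : Type :=
  FreeGroup (Fin n) ⧸ Subgroup.normalClosure (Set.range r)

/-- The canonical quotient map `π : F_n → Γ` onto the random group. -/
def randProj {n N : ℕ} (r : Fin N → FreeGroup (Fin n)) :
    FreeGroup (Fin n) →* RandGroup r :=
  QuotientGroup.mk' _

/-- The probability, for a uniformly random `N`-tuple of reduced relators of length `ℓ`
(chosen uniformly and independently), that property `P` holds. -/
noncomputable def relProb (n ℓ N : ℕ) (P : (Fin N → FreeGroup (Fin n)) → Prop) : ℝ :=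
  (Set.ncard {r ∈ relTuples n ℓ N | P r} : ℝ) / (Set.ncard (relTuples n ℓ N) : ℝ)

/-- `P` holds with overwhelming probability in the random group of density `d`:
the probability tends to `1` as `ℓ → ∞`. -/
def wop (n : ℕ) (d : ℝ) (P : ∀ ℓ : ℕ, (Fin (numRel n d ℓ) → FreeGroup (Fin n)) → Prop) : Prop :=
  Tendsto (fun ℓ => relProb n ℓ (numRel n d ℓ) (P ℓ)) atTop (nhds 1)

section Letters

variable {α : Type*} {T : Type*}

/-- The formal inverse of a letter. -/
def linv (l : α × Bool) : α × Bool := (l.1, !l.2)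

/-- A letter, inverted unless the direction is positive. -/
def sgn (l : α × Bool) (d : Bool) : α × Bool := (l.1, l.2 == d)

/-- The free group element represented by a letter. -/
def gen (l : α × Bool) : FreeGroup α := FreeGroup.mk [l]

@[simp] theorem sgn_true (l : α × Bool) : sgn l true = l := by simp [sgn]

@[simp] theorem sgn_false (l : α × Bool) : sgn l false = linv l := by simp [sgn, linv]

@[simp] theorem linv_linv (l : α × Bool) : linv (linv l) = l := by simp [linv]

theorem linv_ne (l : α × Bool) : linv l ≠ l := by
  rcases l with ⟨a, _ | _⟩ <;> simp [linv]

theorem linv_injective : Function.Injective (linv (α := α)) :=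
  Function.LeftInverse.injective linv_linv

theorem sgn_sgn (l : α × Bool) (d e : Bool) : sgn (sgn l d) e = sgn l (d == e) := by
  rcases l with ⟨a, _ | _⟩ <;> cases d <;> cases e <;> rfl

theorem sgn_self_sgn (l : α × Bool) (d : Bool) : sgn (sgn l d) d = l := by
  rcases l with ⟨a, _ | _⟩ <;> cases d <;> rfl

theorem sgn_not (l : α × Bool) (d : Bool) : sgn l (!d) = linv (sgn l d) := by
  cases d <;> simp

theorem sgn_injective (d : Bool) : Function.Injective (fun l : α × Bool => sgn l d) :=
  fun a b h => by
    have := congrArg (fun l => sgn l d) h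
    simpa [sgn_self_sgn] using this

@[simp] theorem gen_linv (l : α × Bool) : gen (linv l) = (gen l)⁻¹ := by
  simp [gen, linv, FreeGroup.inv_mk, FreeGroup.invRev]

/-- Translation of an integer by `k` in direction `d`. -/
def mz (z : ℤ) (d : Bool) (k : ℤ) : ℤ := if d then z + k else z - k

theorem mz_mz (z : ℤ) (d : Bool) (j k : ℤ) : mz (mz z d j) d k = mz z d (j + k) := by
  cases d <;> simp only [mz] <;> grind

theorem mz_not (z : ℤ) (d : Bool) (k : ℤ) : mz z (!d) k = mz z d (-k) := by
  cases d <;> grind [mz]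

@[simp] theorem mz_zero (z : ℤ) (d : Bool) : mz z d 0 = z := by cases d <;> simp [mz]

theorem mz_comp (z : ℤ) (s : Bool) (p : ℤ) (d : Bool) (k : ℤ) :
    mz z s (mz p d k) = mz (mz z s p) (s == d) k := by
  cases s <;> cases d <;> simp [mz] <;> ring

/-- The `k`-th letter read off the bi-infinite word `f` from `z` in direction `d`. -/
def rd (f : ℤ → α × Bool) (z : ℤ) (d : Bool) (k : ℤ) : α × Bool := sgn (f (mz z d k)) d

theorem rd_shift (f : ℤ → α × Bool) (z : ℤ) (d : Bool) (j k : ℤ) :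
    rd f (mz z d j) d k = rd f z d (j + k) := by
  simp [rd, mz_mz]

theorem sgn_rd_mz (f : ℤ → α × Bool) (z : ℤ) (s : Bool) (p : ℤ) (d : Bool) (k : ℤ) :
    sgn (rd f z s (mz p d k)) d = rd f (mz z s p) (s == d) k := by
  simp [rd, mz_comp, sgn_sgn]

/-- Translation of a position on a track. -/
def mv (P : T × ℤ) (d : Bool) (k : ℤ) : T × ℤ := (P.1, mz P.2 d k)

theorem mv_mv (P : T × ℤ) (d : Bool) (j k : ℤ) : mv (mv P d j) d k = mv P d (j + k) := by
  simp [mv, mz_mz]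

theorem mv_not (P : T × ℤ) (d : Bool) (k : ℤ) : mv P (!d) k = mv P d (-k) := by
  simp [mv, mz_not]

@[simp] theorem mv_zero (P : T × ℤ) (d : Bool) : mv P d 0 = P := by simp [mv]

/-- A value at a position, inverted unless the direction is positive. -/
def sval {G : Type*} [Group G] (v : T × ℤ → G) (P : T × ℤ) (d : Bool) : G :=
  if d then v P else (v P)⁻¹

theorem sval_not {G : Type*} [Group G] (v : T × ℤ → G) (P : T × ℤ) (d : Bool) :
    sval v P (!d) = (sval v P d)⁻¹ := by
  cases d <;> simp [sval]

theorem sval_gen (lab : T × ℤ → α × Bool) (P : T × ℤ) (d : Bool) :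
    sval (fun P => gen (lab P)) P d = gen (sgn (lab P) d) := by
  cases d <;> simp [sval]

theorem map_range_reverse {β : Type*} (f g : ℕ → β) (n : ℕ)
    (h : ∀ k < n, g k = f (n - 1 - k)) :
    (List.range n).map g = ((List.range n).map f).reverse := by
  apply List.ext_getElem
  · simp
  · intro i h1 h2
    simp at h1
    simp [h i h1]

theorem isReduced_map_range (f : ℕ → α × Bool) (n : ℕ) :
    FreeGroup.IsReduced ((List.range n).map f) ↔
      ∀ k, k + 1 < n → f (k + 1) ≠ linv (f k) := by
  have key : ∀ a b : α × Bool, (a.1 = b.1 → a.2 = b.2) ↔ b ≠ linv a := by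
    rintro ⟨a, _ | _⟩ ⟨b, _ | _⟩ <;> simp [linv, eq_comm]
  unfold FreeGroup.IsReduced
  rw [List.isChain_iff_getElem]
  simp only [List.length_map, List.length_range, List.getElem_map, List.getElem_range, key]

theorem isReduced_iff_getElem (L : List (α × Bool)) :
    FreeGroup.IsReduced L ↔ ∀ k (h : k + 1 < L.length), L[k + 1] ≠ linv L[k] := by
  have key : ∀ a b : α × Bool, (a.1 = b.1 → a.2 = b.2) ↔ b ≠ linv a := by
    rintro ⟨a, _ | _⟩ ⟨b, _ | _⟩ <;> simp [linv, eq_comm]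
  unfold FreeGroup.IsReduced
  rw [List.isChain_iff_getElem]
  simp only [key]

theorem mk_eq_prod_gen (L : List (α × Bool)) : FreeGroup.mk L = (L.map gen).prod := by
  induction L with
  | nil => rfl
  | cons a L ih =>
    rw [List.map_cons, List.prod_cons, ← ih, gen, FreeGroup.mul_mk]; rfl

end Letters

section Area

variable {G : Type*} [Group G]

/-- `g` is a product of at most `k` elements of `S`. -/
def Ar (S : Set G) (k : ℕ) (g : G) : Prop :=
  ∃ l : List G, l.length ≤ k ∧ (∀ x ∈ l, x ∈ S) ∧ l.prod = g

theorem Ar.one (S : Set G) (k : ℕ) : Ar S k (1 : G) := ⟨[], by simp⟩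

theorem Ar.mem {S : Set G} {g : G} (h : g ∈ S) : Ar S 1 g := ⟨[g], by simpa using h⟩

theorem Ar.mul {S : Set G} {j k : ℕ} {g g' : G} (h : Ar S j g) (h' : Ar S k g') :
    Ar S (j + k) (g * g') := by
  obtain ⟨l, h1, h2, rfl⟩ := h
  obtain ⟨l', h1', h2', rfl⟩ := h'
  refine ⟨l ++ l', by simp; omega, ?_, by simp⟩
  intro x hx
  rcases List.mem_append.1 hx with hx | hx
  exacts [h2 x hx, h2' x hx]

theorem Ar.conj {S : Set G} (hS : ∀ x ∈ S, ∀ g : G, g * x * g⁻¹ ∈ S) {k : ℕ} {x : G}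
    (h : Ar S k x) (g : G) : Ar S k (g * x * g⁻¹) := by
  obtain ⟨l, h1, h2, rfl⟩ := h
  refine ⟨l.map (fun x => g * x * g⁻¹), by simpa using h1, ?_, ?_⟩
  · intro y hy
    obtain ⟨x, hx, rfl⟩ := List.mem_map.1 hy
    exact hS x (h2 x hx) g
  · clear h1 h2
    induction l with
    | nil => simp
    | cons a l ih => rw [List.map_cons, List.prod_cons, ih, List.prod_cons]; group

theorem Ar.inv {S : Set G} (hS : ∀ x ∈ S, x⁻¹ ∈ S) {k : ℕ} {x : G}
    (h : Ar S k x) : Ar S k x⁻¹ := by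
  obtain ⟨l, h1, h2, rfl⟩ := h
  refine ⟨(l.map (fun x => x⁻¹)).reverse, by simpa using h1, ?_, ?_⟩
  · intro y hy
    simp only [List.mem_reverse, List.mem_map] at hy
    obtain ⟨x, hx, rfl⟩ := hy
    exact hS x (h2 x hx)
  · rw [List.prod_inv_reverse]

end Area

section Stack

variable {α : Type*} {T : Type*}

/-- A segment of a track, with a direction of reading. -/
structure Piece (T : Type*) where
  pt : T × ℤ
  dir : Bool
  len : ℕ

namespace Piece

/-- The `k`-th position of a piece. -/
def cell (u : Piece T) (k : ℕ) : T × ℤ := mv u.pt u.dir k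

/-- The `k`-th letter of a piece. -/
def letter (lab : T × ℤ → α × Bool) (u : Piece T) (k : ℕ) : α × Bool :=
  sgn (lab (u.cell k)) u.dir

/-- The word read along a piece. -/
def word (lab : T × ℤ → α × Bool) (u : Piece T) : List (α × Bool) :=
  (List.range u.len).map (u.letter lab)

/-- The product of the values along a piece. -/
def val {G : Type*} [Group G] (v : T × ℤ → G) (u : Piece T) : G :=
  ((List.range u.len).map fun k => sval v (u.cell k) u.dir).prod

/-- The same segment read backwards. -/
def rev (u : Piece T) : Piece T := ⟨mv u.pt u.dir ((u.len : ℤ) - 1), !u.dir, u.len⟩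

/-- A piece without its first `c` positions. -/
def drop (u : Piece T) (c : ℕ) : Piece T := ⟨mv u.pt u.dir c, u.dir, u.len - c⟩

@[simp] theorem rev_len (u : Piece T) : u.rev.len = u.len := rfl
@[simp] theorem rev_dir (u : Piece T) : u.rev.dir = !u.dir := rfl
@[simp] theorem drop_len (u : Piece T) (c : ℕ) : (u.drop c).len = u.len - c := rfl
@[simp] theorem drop_dir (u : Piece T) (c : ℕ) : (u.drop c).dir = u.dir := rfl

theorem cell_rev (u : Piece T) (k : ℕ) (hk : k < u.len) :
    u.rev.cell k = u.cell (u.len - 1 - k) := by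
  simp only [cell, rev, mv_not, mv_mv]
  congr 1
  omega

theorem cell_drop (u : Piece T) (c k : ℕ) : (u.drop c).cell k = u.cell (c + k) := by
  simp only [cell, drop, mv_mv]
  congr 1

theorem letter_rev (lab : T × ℤ → α × Bool) (u : Piece T) (k : ℕ) (hk : k < u.len) :
    u.rev.letter lab k = linv (u.letter lab (u.len - 1 - k)) := by
  simp only [letter, cell_rev u k hk, rev_dir, sgn_not]

theorem letter_drop (lab : T × ℤ → α × Bool) (u : Piece T) (c k : ℕ) :
    (u.drop c).letter lab k = u.letter lab (c + k) := by
  simp only [letter, cell_drop, drop_dir]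

theorem word_rev (lab : T × ℤ → α × Bool) (u : Piece T) :
    u.rev.word lab = ((u.word lab).map linv).reverse := by
  rw [word, word, List.map_map]
  exact map_range_reverse _ _ _ fun k hk => letter_rev lab u k hk

theorem val_rev {G : Type*} [Group G] (v : T × ℤ → G) (u : Piece T) :
    u.rev.val v = (u.val v)⁻¹ := by
  rw [val, val, List.prod_inv_reverse, List.map_map]
  congr 1
  refine map_range_reverse _ _ _ fun k hk => ?_
  simp only [rev_len] at hk
  simp only [cell_rev u k hk, rev_dir, sval_not, Function.comp, rev_len]

theorem drop_word (lab : T × ℤ → α × Bool) (u : Piece T) (c : ℕ) (hc : c ≤ u.len) :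
    (List.range c).map (u.letter lab) ++ (u.drop c).word lab = u.word lab := by
  rw [word, word, drop_len]
  conv_rhs => rw [← Nat.add_sub_cancel' hc, List.range_add, List.map_append, List.map_map]
  congr 1
  exact List.map_congr_left fun k _ => letter_drop lab u c k

theorem val_drop {G : Type*} [Group G] (v : T × ℤ → G) (u : Piece T) (c : ℕ)
    (hc : c ≤ u.len) :
    ((List.range c).map fun k => sval v (u.cell k) u.dir).prod * (u.drop c).val v
      = u.val v := by
  rw [val, val, drop_len]
  conv_rhs => rw [← Nat.add_sub_cancel' hc, List.range_add, List.map_append, List.map_map,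
    List.prod_append]
  congr 2
  exact List.map_congr_left fun k _ => by simp [cell_drop]

theorem val_gen (lab : T × ℤ → α × Bool) (u : Piece T) :
    u.val (fun P => gen (lab P)) = FreeGroup.mk (u.word lab) := by
  rw [mk_eq_prod_gen, word, val, List.map_map]
  congr 1
  exact List.map_congr_left fun k _ => by simp [sval_gen, letter]

end Piece

theorem isReduced_rev {L : List (α × Bool)} (h : FreeGroup.IsReduced L) :
    FreeGroup.IsReduced ((L.map linv).reverse) := by
  rw [isReduced_iff_getElem] at h ⊢
  intro k hk
  have hk' : k + 1 < L.length := by simpa using hk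
  simp only [List.getElem_reverse, List.length_map, List.getElem_map, linv_linv]
  have := h (L.length - 1 - (k + 1)) (by omega)
  intro e
  apply this
  have e1 : L.length - 1 - (k + 1) + 1 = L.length - 1 - k := by omega
  simp only [e1, e]

/-- Two segments of equal length to be identified, position by position. -/
structure Band (T : Type*) where
  P : T × ℤ
  D : Bool
  Q : T × ℤ
  E : Bool
  L : ℕ

namespace Band

/-- The `k`-th position of the first side. -/
def cp (b : Band T) (k : ℕ) : T × ℤ := mv b.P b.D k

/-- The `k`-th position of the second side. -/
def cq (b : Band T) (k : ℕ) : T × ℤ := mv b.Q b.E k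

/-- Both sides of the band lie in the tracks and carry the same word. -/
def Valid (lab : T × ℤ → α × Bool) (InTr : T × ℤ → Prop) (b : Band T) : Prop :=
  ∀ k < b.L, InTr (b.cp k) ∧ InTr (b.cq k) ∧ sgn (lab (b.cp k)) b.D = sgn (lab (b.cq k)) b.E

/-- The first `h` positions on both sides satisfy `Unl`. -/
def Clean (Unl : T × ℤ → Prop) (h : ℕ) (b : Band T) : Prop :=
  ∀ k < b.L, k < h → Unl (b.cp k) ∧ Unl (b.cq k)

/-- The total weight of the identified pairs of positions. -/
def area (mm : T × ℤ → T × ℤ → ℕ) (b : Band T) : ℕ :=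
  ∑ k ∈ Finset.range b.L, mm (b.cp k) (b.cq k)

end Band

/-- The flag `f` of a corner is an upper bound for the weight of a band starting there. -/
def FlagOK (lab : T × ℤ → α × Bool) (Unl : T × ℤ → Prop) (h f : ℕ) (s u : Piece T) : Prop :=
  2 ≤ f ∨ (f = 1 ∧ ∀ k < h, (k < s.len → Unl (s.cell k)) ∧ (k < u.len → Unl (u.cell k))) ∨
    (0 < s.len → 0 < u.len → s.letter lab 0 ≠ u.letter lab 0)

/-- All corners of a list of pieces carry correct flags. -/
def FlagsOK (lab : T × ℤ → α × Bool) (Unl : T × ℤ → Prop) (h : ℕ) :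
    Option (Piece T) → List (Piece T × ℕ) → Prop
  | _, [] => True
  | o, p :: B => (∀ s ∈ o, FlagOK lab Unl h p.2 s p.1) ∧ FlagsOK lab Unl h (some p.1.rev) B

/-- Raise the flag of the first corner to `2`. -/
def raiseFlag : List (Piece T × ℕ) → List (Piece T × ℕ)
  | [] => []
  | p :: B => (p.1, 2) :: B

theorem FlagsOK.raise {lab : T × ℤ → α × Bool} {Unl : T × ℤ → Prop} {h : ℕ}
    {o o' : Option (Piece T)} {B : List (Piece T × ℕ)} (hB : FlagsOK lab Unl h o B) :
    FlagsOK lab Unl h o' (raiseFlag B) := by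
  cases B with
  | nil => trivial
  | cons p B => exact ⟨fun _ _ => Or.inl le_rfl, hB.2⟩

theorem map_fst_raiseFlag (B : List (Piece T × ℕ)) :
    (raiseFlag B).map Prod.fst = B.map Prod.fst := by
  cases B <;> rfl

theorem flagSum_raiseFlag (B : List (Piece T × ℕ)) :
    ((raiseFlag B).map fun p => 2 + p.2).sum ≤ (B.map fun p => 2 + p.2).sum + 2 := by
  cases B
  · simp [raiseFlag]
  · simp [raiseFlag]; omega

theorem FlagOK.rev_drop {lab : T × ℤ → α × Bool} {Unl : T × ℤ → Prop} {h f c : ℕ}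
    {s u : Piece T} (H : FlagOK lab Unl h f s.rev u) : FlagOK lab Unl h f (s.drop c).rev u := by
  have hc : ∀ k, k < s.len - c → (s.drop c).rev.cell k = s.rev.cell k := by
    intro k hk
    rw [Piece.cell_rev _ _ (by simpa using hk), Piece.cell_rev _ _ (by omega), Piece.cell_drop]
    congr 1
    simp
    omega
  rcases H with H | ⟨hf, H⟩ | H
  · exact Or.inl H
  · refine Or.inr (Or.inl ⟨hf, fun k hk => ⟨fun hl => ?_, (H k hk).2⟩⟩)
    simp only [Piece.rev_len, Piece.drop_len] at hl
    rw [hc k hl]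
    exact (H k hk).1 (by simp; omega)
  · refine Or.inr (Or.inr fun h1 h2 => ?_)
    simp only [Piece.rev_len, Piece.drop_len] at h1
    have := H (by simp; omega) h2
    rw [Piece.letter, hc 0 h1]
    exact this

theorem FlagsOK.rev_drop {lab : T × ℤ → α × Bool} {Unl : T × ℤ → Prop} {h c : ℕ}
    {s : Piece T} {B : List (Piece T × ℕ)} (H : FlagsOK lab Unl h (some s.rev) B) :
    FlagsOK lab Unl h (some (s.drop c).rev) B := by
  cases B with
  | nil => trivial
  | cons p B =>
    refine ⟨fun t ht => ?_, H.2⟩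
    obtain rfl : (s.drop c).rev = t := by simpa using ht
    exact (H.1 _ rfl).rev_drop

theorem exists_max_common_start (lab : T × ℤ → α × Bool) (s u : Piece T) :
    ∃ c, c ≤ s.len ∧ c ≤ u.len ∧ (∀ k < c, s.letter lab k = u.letter lab k) ∧
      (c < s.len → c < u.len → s.letter lab c ≠ u.letter lab c) := by
  classical
  have hex : ∃ c, ¬ (c < s.len ∧ c < u.len ∧ s.letter lab c = u.letter lab c) :=
    ⟨s.len, fun h => absurd h.1 (lt_irrefl _)⟩
  have hmin : ∀ k < Nat.find hex, k < s.len ∧ k < u.len ∧ s.letter lab k = u.letter lab k :=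
    fun k hk => not_not.1 (Nat.find_min hex hk)
  refine ⟨Nat.find hex, ?_, ?_, fun k hk => (hmin k hk).2.2, fun h1 h2 h3 =>
    Nat.find_spec hex ⟨h1, h2, h3⟩⟩
  · by_contra hlt
    exact absurd (hmin s.len (not_le.1 hlt)).1 (lt_irrefl _)
  · by_contra hlt
    exact absurd (hmin u.len (not_le.1 hlt)).2.1 (lt_irrefl _)

/-- The product of the values along a list of pieces. -/
def valProd {G : Type*} [Group G] (v : T × ℤ → G) (A : List (Piece T)) : G :=
  (A.map fun u => u.val v).prod

theorem valProd_gen (lab : T × ℤ → α × Bool) (A : List (Piece T)) :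
    valProd (fun P => gen (lab P)) A = FreeGroup.mk (A.flatMap fun u => u.word lab) := by
  induction A with
  | nil => rfl
  | cons u A ih =>
    rw [List.flatMap_cons, ← FreeGroup.mul_mk, ← ih, ← Piece.val_gen]
    simp [valProd]

/-- The weights of pairs of positions bound the areas of the corresponding quotients. -/
def Compat {G : Type*} [Group G] (lab : T × ℤ → α × Bool) (S : Set G) (v : T × ℤ → G)
    (mm : T × ℤ → T × ℤ → ℕ) : Prop :=
  ∀ P d Q e, sgn (lab P) d = sgn (lab Q) e → Ar S (mm P Q) ((sval v P d)⁻¹ * sval v Q e)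

theorem ar_common_start {G : Type*} [Group G] {lab : T × ℤ → α × Bool} {S : Set G}
    (hS : ∀ x ∈ S, ∀ g : G, g * x * g⁻¹ ∈ S) {v : T × ℤ → G} {mm : T × ℤ → T × ℤ → ℕ}
    (hv : Compat lab S v mm) (s u : Piece T) (c : ℕ)
    (h : ∀ k < c, s.letter lab k = u.letter lab k) :
    Ar S (∑ k ∈ Finset.range c, mm (s.cell k) (u.cell k))
      ((((List.range c).map fun k => sval v (s.cell k) s.dir).prod)⁻¹ *
        ((List.range c).map fun k => sval v (u.cell k) u.dir).prod) := by
  induction c with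
  | zero => simpa using Ar.one S 0
  | succ c ih =>
    rw [Finset.sum_range_succ, List.range_succ]
    simp only [List.map_append, List.prod_append, List.map_cons, List.map_nil, List.prod_cons,
      List.prod_nil, mul_one]
    have h1 := (ih fun k hk => h k (by omega)).conj hS (sval v (s.cell c) s.dir)⁻¹
    have h2 := hv _ _ _ _ (h c (by omega))
    convert h1.mul h2 using 1
    group

theorem stack_bands (lab : T × ℤ → α × Bool) (InTr Unl : T × ℤ → Prop) (h : ℕ) (N : ℕ) :
    ∀ (A : List (Piece T)) (B : List (Piece T × ℕ)),
      (A.map fun u => u.len + 1).sum + (B.map fun p => p.1.len + 2).sum ≤ N →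
      FreeGroup.IsReduced (A.flatMap fun u => u.word lab) →
      (∀ u ∈ A, ∀ k < u.len, InTr (u.cell k)) →
      (∀ p ∈ B, FreeGroup.IsReduced (p.1.word lab) ∧ ∀ k < p.1.len, InTr (p.1.cell k)) →
      FlagsOK lab Unl h A.head? B →
      valProd (fun P => gen (lab P)) A = valProd (fun P => gen (lab P)) (B.map Prod.fst) →
      ∃ bs : List (Band T × ℕ),
        (∀ b ∈ bs, b.1.Valid lab InTr ∧ (2 ≤ b.2 ∨ (b.2 = 1 ∧ b.1.Clean Unl h))) ∧
        (bs.map Prod.snd).sum ≤ 2 * A.length + (B.map fun p => 2 + p.2).sum ∧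
        ∀ (S : Set (FreeGroup α)), (∀ x ∈ S, ∀ g, g * x * g⁻¹ ∈ S) →
          ∀ (v : T × ℤ → FreeGroup α) (mm : T × ℤ → T × ℤ → ℕ), Compat lab S v mm →
            Ar S ((bs.map fun b => b.1.area mm).sum)
              ((valProd v A)⁻¹ * valProd v (B.map Prod.fst)) := by
  classical
  induction N with
  | zero =>
    intro A B hN _ _ _ _ _
    have hA : A = [] := by
      cases A with
      | nil => rfl
      | cons u A => simp at hN
    have hB : B = [] := by
      cases B with
      | nil => rfl
      | cons u A => simp at hN
    subst hA hB
    exact ⟨[], by simp, by simp, fun S _ v mm _ => by simpa [valProd] using Ar.one S 0⟩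
  | succ N ih =>
    intro A B hN hA hAt hB hF hprod
    cases B with
    | nil =>
      have hnil : (A.flatMap fun u => u.word lab) = [] := by
        rw [valProd_gen] at hprod
        rw [← hA.reduce_eq, ← FreeGroup.toWord_mk, hprod]
        simp [valProd]
      refine ⟨[], by simp, by simp, fun S _ v mm _ => ?_⟩
      have : valProd v A = 1 := by
        have hl : ∀ u ∈ A, u.len = 0 := by
          intro u hu
          have := List.flatMap_eq_nil_iff.1 hnil u hu
          simpa [Piece.word] using this
        apply List.prod_eq_one
        intro x hx
        obtain ⟨u, hu, rfl⟩ := List.mem_map.1 hx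
        simp [Piece.val, hl u hu]
      rw [this]
      simpa [valProd] using Ar.one S 0
    | cons p B =>
      obtain ⟨u, f⟩ := p
      have hBt : ∀ p ∈ B, FreeGroup.IsReduced (p.1.word lab) ∧ ∀ k < p.1.len, InTr (p.1.cell k) :=
        fun p hp => hB p (List.mem_cons_of_mem _ hp)
      have hBr : ∀ p ∈ raiseFlag B,
          FreeGroup.IsReduced (p.1.word lab) ∧ ∀ k < p.1.len, InTr (p.1.cell k) := by
        intro p hp
        have : p.1 ∈ (raiseFlag B).map Prod.fst := List.mem_map_of_mem hp
        rw [map_fst_raiseFlag] at this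
        obtain ⟨q, hq, hqe⟩ := List.mem_map.1 this
        rw [← hqe]
        exact hBt q hq
      have hu := hB (u, f) List.mem_cons_self
      have hlen : ((raiseFlag B).map fun p => p.1.len + 2).sum
          = (B.map fun p => p.1.len + 2).sum := by
        have := congrArg (fun l => (l.map fun u : Piece T => u.len + 2).sum) (map_fst_raiseFlag B)
        simpa [List.map_map, Function.comp_def] using this
      simp only [List.map_cons, List.sum_cons] at hN
      rcases Nat.eq_zero_or_pos u.len with hu0 | hu0
      · have hval : ∀ {G : Type _} [Group G] (v : T × ℤ → G),
            valProd v (((u, f) :: B).map Prod.fst) = valProd v ((raiseFlag B).map Prod.fst) := by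
          intro G _ v
          rw [map_fst_raiseFlag]
          simp [valProd, Piece.val, hu0]
        obtain ⟨bs, h1, h2, h3⟩ := ih A (raiseFlag B) (by omega) hA hAt hBr hF.2.raise
          (by rw [hprod, hval])
        refine ⟨bs, h1, ?_, fun S hS v mm hv => ?_⟩
        · have := flagSum_raiseFlag B
          simp only [List.map_cons, List.sum_cons]
          omega
        · rw [hval]
          exact h3 S hS v mm hv
      -- pushing the first input piece on the stack
      have push : (∀ s ∈ A.head?, 0 < s.len ∧ s.letter lab 0 ≠ u.letter lab 0) →
          ∃ bs : List (Band T × ℕ),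
        (∀ b ∈ bs, b.1.Valid lab InTr ∧ (2 ≤ b.2 ∨ (b.2 = 1 ∧ b.1.Clean Unl h))) ∧
        (bs.map Prod.snd).sum ≤ 2 * A.length + (((u, f) :: B).map fun p => 2 + p.2).sum ∧
        ∀ (S : Set (FreeGroup α)), (∀ x ∈ S, ∀ g, g * x * g⁻¹ ∈ S) →
          ∀ (v : T × ℤ → FreeGroup α) (mm : T × ℤ → T × ℤ → ℕ), Compat lab S v mm →
            Ar S ((bs.map fun b => b.1.area mm).sum)
              ((valProd v A)⁻¹ * valProd v (((u, f) :: B).map Prod.fst)) := by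
        intro hhead
        have hval : ∀ {G : Type _} [Group G] (v : T × ℤ → G),
            (valProd v (u.rev :: A))⁻¹ * valProd v (B.map Prod.fst)
              = (valProd v A)⁻¹ * valProd v (((u, f) :: B).map Prod.fst) := by
          intro G _ v
          simp [valProd, Piece.val_rev, mul_assoc]
        have hA2 : FreeGroup.IsReduced ((u.rev :: A).flatMap fun u => u.word lab) := by
          rw [List.flatMap_cons, FreeGroup.IsReduced, List.isChain_append]
          refine ⟨?_, hA, ?_⟩
          · rw [Piece.word_rev]
            exact isReduced_rev hu.1
          · intro x hx y hy
            cases A with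
            | nil => simp at hy
            | cons s A =>
              obtain ⟨hs0, hne⟩ := hhead s rfl
              have hy' : y = s.letter lab 0 := by
                obtain ⟨j, hj⟩ : ∃ j, s.len = j + 1 := ⟨s.len - 1, by omega⟩
                rw [List.flatMap_cons, Piece.word, hj, List.range_succ_eq_map] at hy
                simpa [eq_comm] using hy
              have hx' : x = linv (u.letter lab 0) := by
                rw [Piece.word_rev, List.getLast?_reverse, List.head?_map] at hx
                obtain ⟨j, hj⟩ : ∃ j, u.len = j + 1 := ⟨u.len - 1, by omega⟩
                rw [Piece.word, hj, List.range_succ_eq_map] at hx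
                simpa [eq_comm] using hx
              subst hy' hx'
              intro e1
              by_contra e2
              apply hne
              have e3 : (s.letter lab 0).2 = (u.letter lab 0).2 := by
                revert e2
                simp only [linv]
                cases (s.letter lab 0).2 <;> cases (u.letter lab 0).2 <;> simp
              exact Prod.ext e1.symm e3
        have hAt2 : ∀ t ∈ u.rev :: A, ∀ k < t.len, InTr (t.cell k) := by
          intro s hs k hk
          rcases List.mem_cons.1 hs with rfl | hs
          · rw [Piece.cell_rev u k hk]
            simp only [Piece.rev_len] at hk
            exact hu.2 _ (by simp only; omega)
          · exact hAt s hs k hk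
        have hprod2 : valProd (fun P => gen (lab P)) (u.rev :: A) =
            valProd (fun P => gen (lab P)) (B.map Prod.fst) := by
          have := hval (fun P => gen (lab P))
          rw [hprod, inv_mul_cancel] at this
          exact (inv_mul_eq_one.1 this)
        obtain ⟨bs, h1, h2, h3⟩ := ih (u.rev :: A) B
          (by simp only [List.map_cons, List.sum_cons, Piece.rev_len]; omega)
          hA2 hAt2 hBt hF.2 hprod2
        refine ⟨bs, h1, ?_, fun S hS v mm hv => ?_⟩
        · simp only [List.map_cons, List.sum_cons, List.length_cons] at h2 ⊢
          omega
        · rw [← hval]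
          exact h3 S hS v mm hv
      cases A with
      | nil => exact push (by simp)
      | cons s A =>
        simp only [List.map_cons, List.sum_cons] at hN
        have hs := hAt s List.mem_cons_self
        have hAt' : ∀ u ∈ A, ∀ k < u.len, InTr (u.cell k) :=
          fun u hu => hAt u (List.mem_cons_of_mem _ hu)
        have hA' := hA
        rw [List.flatMap_cons, FreeGroup.IsReduced, List.isChain_append] at hA'
        rcases Nat.eq_zero_or_pos s.len with hs0 | hs0
        · have hval : ∀ {G : Type _} [Group G] (v : T × ℤ → G),
              valProd v (s :: A) = valProd v A := by
            intro G _ v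
            simp [valProd, Piece.val, hs0]
          have e : raiseFlag ((u, f) :: B) = (u, 2) :: B := rfl
          obtain ⟨bs, h1, h2, h3⟩ := ih A ((u, 2) :: B)
            (by simp only [List.map_cons, List.sum_cons]; omega) hA'.2.1 hAt'
            (by
              intro p hp
              rcases List.mem_cons.1 hp with rfl | hp
              exacts [hu, hBt p hp]) (hF.raise (o' := A.head?))
            (by rw [← hval, hprod]; rfl)
          refine ⟨bs, h1, ?_, fun S hS v mm hv => ?_⟩
          · simp only [List.map_cons, List.sum_cons, List.length_cons] at h2 ⊢
            omega
          · rw [hval]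
            exact h3 S hS v mm hv
        by_cases hl : s.letter lab 0 = u.letter lab 0
        swap
        · refine push fun t ht => ?_
          obtain rfl : s = t := by simpa using ht
          exact ⟨hs0, hl⟩
        obtain ⟨c, hcs, hcu, hc, hcm⟩ := exists_max_common_start lab s u
        have hc0 : 0 < c := by
          rcases Nat.eq_zero_or_pos c with rfl | hc0
          · exact absurd hl (hcm hs0 hu0)
          · exact hc0
        have hvs : ∀ {G : Type _} [Group G] (v : T × ℤ → G), valProd v (s :: A)
            = ((List.range c).map fun k => sval v (s.cell k) s.dir).prod *
              valProd v (s.drop c :: A) := by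
          intro G _ v
          simp only [valProd, List.map_cons, List.prod_cons]
          rw [← Piece.val_drop v s c hcs, mul_assoc]
        have hvu : ∀ {G : Type _} [Group G] (v : T × ℤ → G),
            valProd v (((u, f) :: B).map Prod.fst)
            = ((List.range c).map fun k => sval v (u.cell k) u.dir).prod *
              valProd v (((u.drop c, 0) :: B).map Prod.fst) := by
          intro G _ v
          simp only [valProd, List.map_cons, List.prod_cons]
          rw [← Piece.val_drop v u c hcu, mul_assoc]
        have hflag := hF.1 s rfl
        have hA2 : FreeGroup.IsReduced ((s.drop c :: A).flatMap fun u => u.word lab) := by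
          rw [List.flatMap_cons]
          have : (s :: A).flatMap (fun u => u.word lab) = (List.range c).map (s.letter lab) ++
              ((s.drop c).word lab ++ A.flatMap fun u => u.word lab) := by
            rw [List.flatMap_cons, ← Piece.drop_word lab s c hcs, List.append_assoc]
          rw [this, FreeGroup.IsReduced, List.isChain_append] at hA
          exact hA.2.1
        have hAt2 : ∀ t ∈ s.drop c :: A, ∀ k < t.len, InTr (t.cell k) := by
          intro t ht k hk
          rcases List.mem_cons.1 ht with rfl | ht
          · rw [Piece.cell_drop]
            simp only [Piece.drop_len] at hk
            exact hs _ (by omega)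
          · exact hAt' t ht k hk
        have hB2 : ∀ p ∈ (u.drop c, 0) :: B,
            FreeGroup.IsReduced (p.1.word lab) ∧ ∀ k < p.1.len, InTr (p.1.cell k) := by
          intro p hp
          rcases List.mem_cons.1 hp with rfl | hp
          · refine ⟨?_, fun k hk => ?_⟩
            · have := hu.1
              rw [← Piece.drop_word lab u c hcu, FreeGroup.IsReduced, List.isChain_append] at this
              exact this.2.1
            · simp only [Piece.drop_len] at hk
              rw [Piece.cell_drop]
              exact hu.2 _ (by simp only; omega)
          · exact hBt p hp
        have hF2 : FlagsOK lab Unl h (s.drop c :: A).head? ((u.drop c, 0) :: B) := by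
          refine ⟨fun t ht => ?_, hF.2.rev_drop⟩
          obtain rfl : s.drop c = t := by simpa using ht
          refine Or.inr (Or.inr fun a1 a2 => ?_)
          simp only [Piece.drop_len] at a1 a2
          rw [Piece.letter_drop, Piece.letter_drop]
          exact hcm (by omega) (by omega)
        have hprod2 : valProd (fun P => gen (lab P)) (s.drop c :: A) =
            valProd (fun P => gen (lab P)) (((u.drop c, 0) :: B).map Prod.fst) := by
          have e1 := hvs (fun P => gen (lab P))
          have e2 := hvu (fun P => gen (lab P))
          rw [← hprod, e1] at e2
          have e3 : ((List.range c).map fun k => sval (fun P => gen (lab P)) (s.cell k) s.dir).prod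
              = ((List.range c).map fun k =>
                  sval (fun P => gen (lab P)) (u.cell k) u.dir).prod := by
            congr 1
            refine List.map_congr_left fun k hk => ?_
            rw [sval_gen, sval_gen]
            exact congrArg gen (hc k (List.mem_range.1 hk))
          rw [e3] at e2
          exact mul_left_cancel e2
        obtain ⟨bs, h1, h2, h3⟩ := ih (s.drop c :: A) ((u.drop c, 0) :: B)
          (by simp only [List.map_cons, List.sum_cons, Piece.drop_len]; omega)
          hA2 hAt2 hB2 hF2 hprod2
        refine ⟨(⟨s.pt, s.dir, u.pt, u.dir, c⟩, f) :: bs, ?_, ?_, fun S hS v mm hv => ?_⟩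
        · intro b hb
          rcases List.mem_cons.1 hb with rfl | hb
          · refine ⟨fun k hk => ⟨hs k (lt_of_lt_of_le hk hcs), hu.2 k (lt_of_lt_of_le hk hcu),
              hc k hk⟩, ?_⟩
            rcases hflag with hflag | ⟨hf, hflag⟩ | hflag
            · exact Or.inl hflag
            · exact Or.inr ⟨hf, fun k hk hkh => ⟨(hflag k hkh).1 (lt_of_lt_of_le hk hcs),
                (hflag k hkh).2 (lt_of_lt_of_le hk hcu)⟩⟩
            · exact absurd hl (hflag hs0 hu0)
          · exact h1 b hb
        · simp only [List.map_cons, List.sum_cons, List.length_cons] at h2 ⊢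
          omega
        · have e1 := ar_common_start hS hv s u c hc
          have e2 := h3 S hS v mm hv
          rw [hvs, hvu]
          have e3 := (e1.conj hS (valProd v (s.drop c :: A))⁻¹).mul e2
          rw [List.map_cons, List.sum_cons]
          convert e3 using 1
          · rfl
          · group

end Stack

section PeriodProd

variable {G : Type*} [Group G]

/-- The product of `L` consecutive values of a sequence, starting from `k`. -/
def pprod (y : ℤ → G) (L : ℕ) (k : ℤ) : G := ((List.range L).map fun t : ℕ => y (k + t)).prod

theorem pprod_succ_right (y : ℤ → G) (L : ℕ) (k : ℤ) :
    pprod y (L + 1) k = pprod y L k * y (k + L) := by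
  simp [pprod, List.range_succ]

theorem pprod_succ_left (y : ℤ → G) (L : ℕ) (k : ℤ) :
    pprod y (L + 1) k = y k * pprod y L (k + 1) := by
  simp only [pprod, List.range_succ_eq_map, List.map_cons, List.prod_cons, List.map_map]
  congr 1
  · simp
  · congr 1
    refine List.map_congr_left fun t _ => ?_
    simp only [Function.comp, Nat.cast_succ]
    congr 1
    ring

theorem pprod_shift {y : ℤ → G} {L : ℕ} (hy : ∀ k, y (k + L) = y k) (k : ℤ) :
    pprod y L (k + 1) = (y k)⁻¹ * pprod y L k * y k := by
  have h := pprod_succ_left y L k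
  rw [pprod_succ_right, hy] at h
  rw [mul_assoc, h, inv_mul_cancel_left]

theorem pprod_conj {y : ℤ → G} {L : ℕ} (hy : ∀ k, y (k + L) = y k) (j k : ℤ) :
    ∃ g, pprod y L k = g * pprod y L j * g⁻¹ := by
  have h1 : ∀ n : ℕ, ∀ j : ℤ, ∃ g, pprod y L (j + n) = g * pprod y L j * g⁻¹ := by
    intro n
    induction n with
    | zero => exact fun j => ⟨1, by simp⟩
    | succ n ih =>
      intro j
      obtain ⟨g, hg⟩ := ih j
      refine ⟨(y (j + n))⁻¹ * g, ?_⟩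
      rw [Nat.cast_succ, ← add_assoc, pprod_shift hy, hg]
      group
  rcases le_total j k with h | h
  · obtain ⟨n, hn⟩ := Int.le.dest h
    obtain ⟨g, hg⟩ := h1 n j
    exact ⟨g, by rw [← hn, hg]⟩
  · obtain ⟨n, hn⟩ := Int.le.dest h
    obtain ⟨g, hg⟩ := h1 n k
    refine ⟨g⁻¹, ?_⟩
    rw [← hn, hg]
    group

/-- A value of a sequence, read from `z` in direction `s`. -/
def dval (w : ℤ → G) (z : ℤ) (s : Bool) (t : ℤ) : G :=
  if s then w (mz z s t) else (w (mz z s t))⁻¹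

theorem dval_gen {α : Type*} (f : ℤ → α × Bool) (z : ℤ) (s : Bool) (t : ℤ) :
    dval (fun q => gen (f q)) z s t = gen (rd f z s t) := by
  cases s <;> simp [dval, rd]

theorem dval_periodic {w : ℤ → G} {L : ℕ} (hw : ∀ k, w (k + L) = w k) (z : ℤ) (s : Bool)
    (t : ℤ) : dval w z s (t + L) = dval w z s t := by
  cases s
  · have := hw (z - (t + L))
    simp only [dval, mz, Bool.false_eq_true, if_false]
    rw [← this]
    congr 2
    ring
  · have := hw (z + t)
    simp only [dval, mz, if_true]
    rw [← this]
    congr 1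
    ring

theorem pprod_dval_false (w : ℤ → G) (L : ℕ) (z : ℤ) :
    pprod (dval w (z + L - 1) false) L 0 = (pprod w L z)⁻¹ := by
  rw [pprod, pprod, List.prod_inv_reverse, List.map_map]
  congr 1
  refine map_range_reverse _ _ _ fun k hk => ?_
  simp only [dval, mz, Function.comp, Bool.false_eq_true, if_false]
  congr 2
  omega

theorem pprod_dval_conj {w : ℤ → G} {L : ℕ} (hw : ∀ k, w (k + L) = w k) (z : ℤ) (s : Bool)
    (q : ℤ) : ∃ g, pprod (dval w z s) L 0 = g * pprod w L q * g⁻¹ ∨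
      pprod (dval w z s) L 0 = g * (pprod w L q)⁻¹ * g⁻¹ := by
  cases s
  · obtain ⟨g, hg⟩ := pprod_conj hw q (z - L + 1)
    have h := pprod_dval_false w L (z - L + 1)
    have e : z - L + 1 + L - 1 = z := by ring
    rw [e, hg] at h
    refine ⟨g, Or.inr ?_⟩
    rw [h]
    group
  · obtain ⟨g, hg⟩ := pprod_conj hw q z
    refine ⟨g, Or.inl ?_⟩
    rw [← hg]
    simp [pprod, dval, mz]

end PeriodProd

section Cores

variable {α : Type*} [Inhabited α]

/-- The bi-infinite periodic word obtained from `R` by deleting the first and last `u`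
letters. -/
def cor (R : List (α × Bool)) (u : ℕ) (q : ℤ) : α × Bool :=
  R.getD (u + (q % ((R.length - 2 * u : ℕ) : ℤ)).toNat) default

/-- Deleting the first and last `u` letters of `R` is a cyclic reduction. -/
structure IsCore (R : List (α × Bool)) (u : ℕ) : Prop where
  lt : 2 * u < R.length
  strip : ∀ t < u, R.getD (R.length - 1 - t) default = linv (R.getD t default)
  red : ∀ z, cor R u (z + 1) ≠ linv (cor R u z)

theorem cor_congr (R : List (α × Bool)) (u : ℕ) {q q' : ℤ}
    (h : q % ((R.length - 2 * u : ℕ) : ℤ) = q' % ((R.length - 2 * u : ℕ) : ℤ)) :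
    cor R u q = cor R u q' := by
  rw [cor, cor, h]

theorem cor_periodic (R : List (α × Bool)) (u : ℕ) (q : ℤ) :
    cor R u (q + (R.length - 2 * u : ℕ)) = cor R u q :=
  cor_congr R u (by simp)

theorem exists_isCore {R : List (α × Bool)} (hR : FreeGroup.IsReduced R) (h0 : R ≠ []) :
    ∃ u, IsCore R u := by
  classical
  rw [isReduced_iff_getElem] at hR
  have hred : ∀ k, k + 1 < R.length → R.getD (k + 1) default ≠ linv (R.getD k default) := by
    intro k hk
    have := hR k hk
    rwa [List.getD_eq_getElem _ _ hk, List.getD_eq_getElem _ _ (by omega)]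
  have hpos : 0 < R.length := List.length_pos_iff.2 h0
  have hex : ∃ u, ¬ (2 * u < R.length ∧
      R.getD (R.length - 1 - u) default = linv (R.getD u default)) :=
    ⟨R.length, fun h => by omega⟩
  have hmin : ∀ t < Nat.find hex, 2 * t < R.length ∧
      R.getD (R.length - 1 - t) default = linv (R.getD t default) :=
    fun t ht => not_not.1 (Nat.find_min hex ht)
  have hspec := Nat.find_spec hex
  set u := Nat.find hex with hu
  have hlt : 2 * u < R.length := by
    by_contra hge
    have hu0 : 0 < u := by omega
    obtain ⟨h1, h2⟩ := hmin (u - 1) (by omega)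
    rcases Nat.lt_or_ge (2 * u) (R.length + 1) with h3 | h3
    · have : R.length - 1 - (u - 1) = (u - 1) + 1 := by omega
      rw [this] at h2
      exact hred (u - 1) (by omega) h2
    · have : R.length - 1 - (u - 1) = u - 1 := by omega
      rw [this] at h2
      exact linv_ne _ h2.symm
  refine ⟨u, hlt, fun t ht => (hmin t ht).2, fun z hz => ?_⟩
  have hne : R.getD (R.length - 1 - u) default ≠ linv (R.getD u default) :=
    fun h => hspec ⟨hlt, h⟩
  set L := R.length - 2 * u with hL
  have hLpos : (0 : ℤ) < L := by omega
  have hm0 := Int.emod_nonneg z hLpos.ne'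
  have hm1 := Int.emod_lt_of_pos z hLpos
  simp only [cor, ← hL] at hz
  rcases lt_or_ge (z % L + 1) L with h1 | h1
  · have e : (z + 1) % L = z % L + 1 := by
      rw [← Int.emod_add_emod, Int.emod_eq_of_lt (by omega) h1]
    rw [e] at hz
    have e2 : u + (z % L + 1).toNat = u + (z % L).toNat + 1 := by omega
    rw [e2] at hz
    exact hred _ (by omega) hz
  · have e0 : z % L = L - 1 := by omega
    have e : (z + 1) % L = 0 := by
      rw [← Int.emod_add_emod, e0]; simp
    rw [e, e0] at hz
    have e2 : u + ((L : ℤ) - 1).toNat = R.length - 1 - u := by omega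
    rw [e2] at hz
    apply hne
    rw [show u + (0 : ℤ).toNat = u by simp] at hz
    rw [hz, linv_linv]

theorem IsCore.mk_eq {R : List (α × Bool)} {u : ℕ} (h : IsCore R u) :
    ∃ g : FreeGroup α, FreeGroup.mk R
      = g * pprod (fun q => gen (cor R u q)) (R.length - 2 * u) 0 * g⁻¹ := by
  have hlt := h.lt
  have e1 : R = (List.range R.length).map fun k => R.getD k default := by
    apply List.ext_getElem
    · simp
    · intro i h1 h2
      simp [h1]
  have e2 : R.length = u + ((R.length - 2 * u) + u) := by omega
  refine ⟨((List.range u).map fun k => gen (R.getD k default)).prod, ?_⟩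
  rw [mk_eq_prod_gen]
  conv_lhs => rw [e1]
  rw [List.map_map]
  conv_lhs => rw [e2]
  rw [List.range_add, List.range_add, List.map_append, List.map_map, List.map_append,
    List.map_map, List.prod_append, List.prod_append, ← mul_assoc]
  congr 1
  · congr 1
    rw [pprod]
    congr 1
    refine List.map_congr_left fun k hk => ?_
    have hk' := List.mem_range.1 hk
    simp only [Function.comp, cor, zero_add]
    rw [Int.emod_eq_of_lt (by omega) (by omega)]
    simp
  · rw [List.prod_inv_reverse, List.map_map]
    congr 1
    refine map_range_reverse _ _ _ fun k hk => ?_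
    simp only [Function.comp]
    have := h.strip (u - 1 - k) (by omega)
    rw [← gen_linv, ← this]
    congr 2
    omega

/-- The conjugates of the relators and their inverses. -/
def relSet {ι : Type*} (r : ι → FreeGroup α) : Set (FreeGroup α) :=
  {x | ∃ g i, x = g * r i * g⁻¹ ∨ x = g * (r i)⁻¹ * g⁻¹}

theorem relSet_conj {ι : Type*} (r : ι → FreeGroup α) :
    ∀ x ∈ relSet r, ∀ g, g * x * g⁻¹ ∈ relSet r := by
  rintro x ⟨a, i, h | h⟩ g
  · exact ⟨g * a, i, Or.inl (by rw [h]; group)⟩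
  · exact ⟨g * a, i, Or.inr (by rw [h]; group)⟩

theorem relSet_inv {ι : Type*} (r : ι → FreeGroup α) :
    ∀ x ∈ relSet r, x⁻¹ ∈ relSet r := by
  rintro x ⟨a, i, h | h⟩
  · exact ⟨a, i, Or.inr (by rw [h]; group)⟩
  · exact ⟨a, i, Or.inl (by rw [h]; group)⟩

theorem relSet_subset {ι : Type*} (r : ι → FreeGroup α) {x : FreeGroup α}
    (hx : x ∈ relSet r) : x ∈ Subgroup.normalClosure (Set.range r) := by
  have hr : ∀ i, r i ∈ Subgroup.normalClosure (Set.range r) := fun i =>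
    Subgroup.subset_normalClosure ⟨i, rfl⟩
  obtain ⟨a, i, rfl | rfl⟩ := hx
  · exact Subgroup.normalClosure_normal.conj_mem _ (hr i) a
  · exact Subgroup.normalClosure_normal.conj_mem _ (Subgroup.inv_mem _ (hr i)) a

theorem exists_ar {ι : Type*} {r : ι → FreeGroup α} {x : FreeGroup α}
    (h : x ∈ Subgroup.normalClosure (Set.range r)) : ∃ k, Ar (relSet r) k x := by
  induction h using Subgroup.closure_induction with
  | mem x hx =>
    obtain ⟨_, ⟨i, rfl⟩, hx⟩ := Group.mem_conjugatesOfSet_iff.1 hx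
    obtain ⟨c, rfl⟩ := isConj_iff.1 hx
    exact ⟨1, Ar.mem ⟨c, i, Or.inl rfl⟩⟩
  | one => exact ⟨0, Ar.one _ _⟩
  | mul x y _ _ hx hy =>
    obtain ⟨j, hj⟩ := hx
    obtain ⟨k, hk⟩ := hy
    exact ⟨j + k, hj.mul hk⟩
  | inv x _ hx =>
    obtain ⟨j, hj⟩ := hx
    exact ⟨j, hj.inv (relSet_inv r)⟩

variable [DecidableEq α]

/-- The periodic words of the cyclic reductions of the relators. -/
def corOf {ι : Type*} (r : ι → FreeGroup α) (u : ι → ℕ) (i : ι) : ℤ → α × Bool :=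
  cor (r i).toWord (u i)

/-- The lengths of the cyclic reductions of the relators. -/
def lenOf {ι : Type*} (r : ι → FreeGroup α) (u : ι → ℕ) (i : ι) : ℕ :=
  (r i).toWord.length - 2 * u i

theorem corOf_periodic {ι : Type*} (r : ι → FreeGroup α) (u : ι → ℕ) (i : ι) (k : ℤ) :
    corOf r u i (k + lenOf r u i) = corOf r u i k :=
  cor_periodic _ _ _

theorem corOf_congr {ι : Type*} (r : ι → FreeGroup α) (u : ι → ℕ) (i : ι) {k k' : ℤ}
    (h : k % lenOf r u i = k' % lenOf r u i) : corOf r u i k = corOf r u i k' :=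
  cor_congr _ _ h

theorem pprod_rd_mem {ι : Type*} {r : ι → FreeGroup α} {u : ι → ℕ}
    (hu : ∀ i, IsCore (r i).toWord (u i)) (i : ι) (z : ℤ) (s : Bool) :
    pprod (fun t => gen (rd (corOf r u i) z s t)) (lenOf r u i) 0 ∈ relSet r := by
  obtain ⟨g, hg⟩ := (hu i).mk_eq
  rw [FreeGroup.mk_toWord] at hg
  have hg' : pprod (fun q => gen (corOf r u i q)) (lenOf r u i) 0 = g⁻¹ * r i * g := by
    rw [hg, corOf, lenOf]; group
  have hw : ∀ k, (fun q => gen (corOf r u i q)) (k + lenOf r u i)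
      = (fun q => gen (corOf r u i q)) k := fun k => congrArg gen (corOf_periodic r u i k)
  simp only [← dval_gen]
  obtain ⟨a, ha | ha⟩ := pprod_dval_conj (w := fun q => gen (corOf r u i q)) hw z s 0
  · exact ⟨a * g⁻¹, i, Or.inl (by rw [ha, hg']; group)⟩
  · exact ⟨a * g⁻¹, i, Or.inr (by rw [ha, hg']; group)⟩

theorem exists_face_rep {ι : Type*} {r : ι → FreeGroup α} {u : ι → ℕ}
    (hu : ∀ i, IsCore (r i).toWord (u i)) {x : FreeGroup α} (hx : x ∈ relSet r) :
    ∃ (g : FreeGroup α) (i : ι) (z : ℤ) (s : Bool),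
      x = g * pprod (fun t => gen (rd (corOf r u i) z s t)) (lenOf r u i) 0 * g⁻¹ ∧
      ∀ l ∈ g.toWord.getLast?, rd (corOf r u i) z s 0 ≠ linv l ∧
        rd (corOf r u i) z s ((lenOf r u i : ℤ) - 1) ≠ l := by
  classical
  have hex : ∃ (k : ℕ) (g : FreeGroup α) (i : ι) (z : ℤ) (s : Bool), g.toWord.length = k ∧
      x = g * pprod (fun t => gen (rd (corOf r u i) z s t)) (lenOf r u i) 0 * g⁻¹ := by
    obtain ⟨a, i, h⟩ := hx
    obtain ⟨g, hg⟩ := (hu i).mk_eq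
    rw [FreeGroup.mk_toWord] at hg
    rcases h with h | h
    · refine ⟨_, a * g, i, 0, true, rfl, ?_⟩
      rw [h, hg]
      simp only [rd, mz, corOf, lenOf, if_true, zero_add, sgn_true]
      group
    · refine ⟨_, a * g, i, 0 + lenOf r u i - 1, false, rfl, ?_⟩
      simp only [← dval_gen]
      rw [pprod_dval_false, h, hg]
      simp only [corOf, lenOf]
      group
  obtain ⟨g, i, z, s, hk, hxe⟩ := Nat.find_spec hex
  have hmin : ∀ (g' : FreeGroup α) (z' : ℤ),
      x = g' * pprod (fun t => gen (rd (corOf r u i) z' s t)) (lenOf r u i) 0 * g'⁻¹ →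
      g.toWord.length ≤ g'.toWord.length := by
    intro g' z' h'
    by_contra hlt
    rw [hk] at hlt
    exact Nat.find_min hex (not_le.1 hlt) ⟨g', i, z', s, rfl, h'⟩
  refine ⟨g, i, z, s, hxe, fun l hl => ?_⟩
  obtain ⟨pre, hpre⟩ := List.getLast?_eq_some_iff.1 hl
  have hg : g = FreeGroup.mk pre * gen l := by
    rw [gen, FreeGroup.mul_mk, ← hpre, FreeGroup.mk_toWord]
  have hlt : (FreeGroup.mk pre).toWord.length < g.toWord.length := by
    rw [hpre, FreeGroup.toWord_mk]
    have := (FreeGroup.reduce.red (L := pre)).length_le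
    simp
    omega
  have hper : ∀ k : ℤ, (fun t => gen (rd (corOf r u i) z s t)) (k + lenOf r u i)
      = (fun t => gen (rd (corOf r u i) z s t)) k := by
    intro k
    have := dval_periodic (w := fun q => gen (corOf r u i q))
      (fun k => congrArg gen (corOf_periodic r u i k)) z s k
    simpa only [dval_gen] using this
  have hsh : ∀ j : ℤ, pprod (fun t => gen (rd (corOf r u i) (mz z s j) s t)) (lenOf r u i) 0
      = pprod (fun t => gen (rd (corOf r u i) z s t)) (lenOf r u i) j := by
    intro j
    simp only [pprod, rd_shift, zero_add]
  constructor
  · intro h0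
    refine absurd (hmin (FreeGroup.mk pre) (mz z s 1) ?_) (not_le.2 hlt)
    have := pprod_shift (y := fun t => gen (rd (corOf r u i) z s t)) hper 0
    simp only [zero_add, h0, gen_linv, inv_inv] at this
    rw [hsh, this, hxe, hg]
    group
  · intro h0
    refine absurd (hmin (FreeGroup.mk pre) (mz z s (-1)) ?_) (not_le.2 hlt)
    have h1 := pprod_shift (y := fun t => gen (rd (corOf r u i) z s t)) hper (-1)
    have h2 := hper (-1)
    simp only at h2
    rw [show (-1 : ℤ) + lenOf r u i = lenOf r u i - 1 by ring, h0] at h2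
    simp only [neg_add_cancel, ← h2] at h1
    rw [hsh, hxe, h1, hg]
    group

end Cores

section Configurations

/-- The tracks of a configuration: variables, constants, conjugators and faces. -/
inductive Trk (X A Φ : Type*)
  | var (v : X)
  | const (s : A)
  | cnj (f : Φ)
  | face (f : Φ)

/-- Values of the variables and constants, together with conjugators and boundary readings for
the faces. -/
structure Cfg (α ι X A Φ : Type*) where
  xs : X → FreeGroup α
  as : A → FreeGroup α
  gs : Φ → FreeGroup α
  ri : Φ → ι
  rz : Φ → ℤ
  rs : Φ → Bool

variable {α ι X A Φ : Type*} [Inhabited α] [DecidableEq α]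

namespace Cfg

/-- The length of a track. -/
def tlen (c : Cfg α ι X A Φ) (r : ι → FreeGroup α) (u : ι → ℕ) : Trk X A Φ → ℕ
  | .var v => (c.xs v).toWord.length
  | .const s => (c.as s).toWord.length
  | .cnj f => (c.gs f).toWord.length
  | .face f => lenOf r u (c.ri f)

/-- The letter at a position. -/
def lab (c : Cfg α ι X A Φ) (r : ι → FreeGroup α) (u : ι → ℕ) : Trk X A Φ × ℤ → α × Bool
  | (.var v, p) => (c.xs v).toWord.getD p.toNat default
  | (.const s, p) => (c.as s).toWord.getD p.toNat default
  | (.cnj f, p) => (c.gs f).toWord.getD p.toNat default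
  | (.face f, p) => rd (corOf r u (c.ri f)) (c.rz f) (c.rs f) p

/-- A position lies in its track. -/
def InTr (c : Cfg α ι X A Φ) (r : ι → FreeGroup α) (u : ι → ℕ) (P : Trk X A Φ × ℤ) : Prop :=
  0 ≤ P.2 ∧ P.2 < c.tlen r u P.1

/-- The piece consisting of a whole track. -/
def full (c : Cfg α ι X A Φ) (r : ι → FreeGroup α) (u : ι → ℕ) (τ : Trk X A Φ) :
    Piece (Trk X A Φ) := ⟨(τ, 0), true, c.tlen r u τ⟩

/-- The relator and the position in it to which a position of a face belongs. -/
def key (c : Cfg α ι X A Φ) (r : ι → FreeGroup α) (u : ι → ℕ) (f : Φ) (t : ℤ) : ι × ℤ :=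
  (c.ri f, mz (c.rz f) (c.rs f) t % lenOf r u (c.ri f))

variable (c : Cfg α ι X A Φ) (r : ι → FreeGroup α) (u : ι → ℕ)

theorem full_cell (τ : Trk X A Φ) (k : ℕ) : (c.full r u τ).cell k = (τ, (k : ℤ)) := by
  simp [full, Piece.cell, mv, mz]

theorem full_letter (τ : Trk X A Φ) (k : ℕ) :
    (c.full r u τ).letter (c.lab r u) k = c.lab r u (τ, (k : ℤ)) := by
  rw [Piece.letter, full_cell]
  exact sgn_true _

theorem full_val {G : Type*} [Group G] (v : Trk X A Φ × ℤ → G) (τ : Trk X A Φ) :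
    (c.full r u τ).val v = ((List.range (c.tlen r u τ)).map fun k : ℕ => v (τ, k)).prod := by
  simp only [Piece.val, full_cell]
  simp [full, sval]

theorem full_inTr (τ : Trk X A Φ) :
    ∀ k < (c.full r u τ).len, c.InTr r u ((c.full r u τ).cell k) := by
  intro k hk
  rw [full_cell]
  exact ⟨by simp, by simpa [full] using hk⟩

theorem full_rev_inTr (τ : Trk X A Φ) :
    ∀ k < (c.full r u τ).rev.len, c.InTr r u ((c.full r u τ).rev.cell k) := by
  intro k hk
  simp only [Piece.rev_len] at hk
  rw [Piece.cell_rev (c.full r u τ) k hk]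
  exact full_inTr c r u τ _ (by omega)

theorem map_range_getD {β : Type*} (L : List β) (d : β) :
    (List.range L.length).map (fun k : ℕ => L.getD (k : ℤ).toNat d) = L := by
  apply List.ext_getElem
  · simp
  · intro i h1 h2
    simp [h2]

theorem full_word_var (v : X) : (c.full r u (.var v)).word (c.lab r u) = (c.xs v).toWord := by
  conv_rhs => rw [← map_range_getD (c.xs v).toWord default]
  exact List.map_congr_left fun k _ => full_letter c r u _ k

theorem full_word_const (s : A) :
    (c.full r u (.const s)).word (c.lab r u) = (c.as s).toWord := by
  conv_rhs => rw [← map_range_getD (c.as s).toWord default]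
  exact List.map_congr_left fun k _ => full_letter c r u _ k

theorem full_word_cnj (f : Φ) : (c.full r u (.cnj f)).word (c.lab r u) = (c.gs f).toWord := by
  conv_rhs => rw [← map_range_getD (c.gs f).toWord default]
  exact List.map_congr_left fun k _ => full_letter c r u _ k

theorem lab_succ_ne (hu : ∀ i, IsCore (r i).toWord (u i)) (P : Trk X A Φ × ℤ)
    (h1 : c.InTr r u P) (h2 : c.InTr r u (mv P true 1)) :
    c.lab r u (mv P true 1) ≠ linv (c.lab r u P) := by
  obtain ⟨τ, p⟩ := P
  simp only [InTr, mv, mz, if_true] at h1 h2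
  have key : ∀ g : FreeGroup α, p + 1 < g.toWord.length →
      g.toWord.getD (p + 1).toNat default ≠ linv (g.toWord.getD p.toNat default) := by
    intro g hg
    have := (isReduced_iff_getElem _).1 (FreeGroup.isReduced_toWord (x := g)) p.toNat (by omega)
    have e : (p + 1).toNat = p.toNat + 1 := by omega
    rwa [e, List.getD_eq_getElem _ _ (by omega), List.getD_eq_getElem _ _ (by omega)]
  cases τ with
  | var v => exact key _ h2.2
  | const s => exact key _ h2.2
  | cnj f => exact key _ h2.2
  | face f =>
    simp only [lab, mv, mz, if_true]
    have hred := fun z => (hu (c.ri f)).red z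
    cases hs : c.rs f
    · intro h
      simp only [rd, mz, Bool.false_eq_true, if_false, sgn_false, linv_linv] at h
      refine hred (c.rz f - (p + 1)) ?_
      rw [show c.rz f - (p + 1) + 1 = c.rz f - p by ring]
      exact h.symm
    · intro h
      simp only [rd, mz, if_true, sgn_true] at h
      refine hred (c.rz f + p) ?_
      rw [show c.rz f + p + 1 = c.rz f + (p + 1) by ring]
      exact h

theorem full_isReduced (hu : ∀ i, IsCore (r i).toWord (u i)) (τ : Trk X A Φ) :
    FreeGroup.IsReduced ((c.full r u τ).word (c.lab r u)) := by
  rw [Piece.word, isReduced_map_range]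
  intro k hk
  have h1 := full_inTr c r u τ k (by omega)
  have h2 := full_inTr c r u τ (k + 1) (by omega)
  have e : (c.full r u τ).cell (k + 1) = mv ((c.full r u τ).cell k) true 1 := by
    rw [full_cell, full_cell]; simp [mv, mz]
  rw [e] at h2
  have := lab_succ_ne c r u hu _ h1 h2
  rwa [← e, full_cell, full_cell, ← full_letter, ← full_letter] at this

/-- The pieces around a face, with flags. -/
def facePieces (f : Φ) : List (Piece (Trk X A Φ) × ℕ) :=
  [(c.full r u (.cnj f), 1), (c.full r u (.face f), 0), ((c.full r u (.cnj f)).rev, 0)]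

/-- The track of a variable or a constant. -/
def symTrk : X ⊕ A → Trk X A Φ
  | .inl v => .var v
  | .inr s => .const s

/-- The pieces along a word in the variables and constants, with flags. -/
def wordPieces (w : List ((X ⊕ A) × Bool)) : List (Piece (Trk X A Φ) × ℕ) :=
  w.map fun p => (if p.2 then c.full r u (symTrk p.1) else (c.full r u (symTrk p.1)).rev, 1)

theorem valProd_wordPieces {G : Type*} [Group G] (v : Trk X A Φ × ℤ → G)
    (w : FreeGroup (X ⊕ A)) [DecidableEq (X ⊕ A)] :
    valProd v ((c.wordPieces r u w.toWord).map Prod.fst)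
      = FreeGroup.lift (fun t => (c.full r u (symTrk t)).val v) w := by
  conv_rhs => rw [← FreeGroup.mk_toWord (x := w), FreeGroup.lift_mk]
  simp only [valProd, wordPieces, List.map_map]
  congr 1
  refine List.map_congr_left fun p _ => ?_
  rcases p with ⟨t, _ | _⟩ <;> simp [Piece.val_rev]

theorem valProd_facePieces {G : Type*} [Group G] (v : Trk X A Φ × ℤ → G) (fs : List Φ) :
    valProd v ((fs.flatMap (c.facePieces r u)).map Prod.fst)
      = (fs.map fun f => (c.full r u (.cnj f)).val v * (c.full r u (.face f)).val v *
        ((c.full r u (.cnj f)).val v)⁻¹).prod := by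
  induction fs with
  | nil => simp [valProd]
  | cons f fs ih =>
    rw [List.map_cons, List.prod_cons, ← ih]
    simp [valProd, facePieces, Piece.val_rev, mul_assoc]

/-- The conjugators are chosen so that no cancellation occurs at the corners of faces. -/
def Corners : Prop :=
  ∀ f, ∀ l ∈ (c.gs f).toWord.getLast?,
    rd (corOf r u (c.ri f)) (c.rz f) (c.rs f) 0 ≠ linv l ∧
      rd (corOf r u (c.ri f)) (c.rz f) (c.rs f) ((lenOf r u (c.ri f) : ℤ) - 1) ≠ l

theorem cnj_getLast (f : Φ) (h : 0 < (c.full r u (.cnj f)).len) :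
    (c.full r u (.cnj f)).letter (c.lab r u) ((c.full r u (.cnj f)).len - 1)
      ∈ (c.gs f).toWord.getLast? := by
  rw [← full_word_cnj c r u f, Piece.word]
  obtain ⟨n, hn⟩ : ∃ n, (c.full r u (.cnj f)).len = n + 1 := ⟨_, (Nat.sub_add_cancel h).symm⟩
  rw [hn, List.range_succ]
  simp

/-- The first `h` positions of a piece satisfy `Unl`. -/
def EndUnl (Unl : Trk X A Φ × ℤ → Prop) (h : ℕ) (s : Piece (Trk X A Φ)) : Prop :=
  ∀ k < h, k < s.len → Unl (s.cell k)

theorem EndUnl.rev_rev {Unl : Trk X A Φ × ℤ → Prop} {h : ℕ} {s : Piece (Trk X A Φ)}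
    (H : EndUnl Unl h s) : EndUnl Unl h s.rev.rev := by
  intro k hk hl
  simp only [Piece.rev_len] at hl
  rw [Piece.cell_rev s.rev k (by simpa using hl), Piece.rev_len,
    Piece.cell_rev s _ (by omega)]
  convert H k hk hl using 2
  omega

theorem flagOK_one {Unl : Trk X A Φ × ℤ → Prop} {h : ℕ} {lab : Trk X A Φ × ℤ → α × Bool}
    {s t : Piece (Trk X A Φ)} (hs : EndUnl Unl h s) (ht : EndUnl Unl h t) :
    FlagOK lab Unl h 1 s t :=
  Or.inr (Or.inl ⟨rfl, fun k hk => ⟨hs k hk, ht k hk⟩⟩)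

theorem flagsOK_facePieces (hc : c.Corners r u) {Unl : Trk X A Φ × ℤ → Prop} {h : ℕ}
    (hU : ∀ τ, (∀ f, τ ≠ .face f) → EndUnl Unl h (c.full r u τ) ∧ EndUnl Unl h (c.full r u τ).rev)
    (fs : List Φ) : ∀ o : Option (Piece (Trk X A Φ)), (∀ s ∈ o, EndUnl Unl h s) →
      FlagsOK (c.lab r u) Unl h o (fs.flatMap (c.facePieces r u)) := by
  induction fs with
  | nil => exact fun _ _ => trivial
  | cons f fs ih =>
    intro o ho
    have hg := hU (.cnj f) (by simp)
    refine ⟨fun s hs => flagOK_one (ho s hs) hg.1, fun s hs => ?_, fun s hs => ?_, ih _ ?_⟩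
    · obtain rfl := Option.some.inj hs
      refine Or.inr (Or.inr fun h1 h2 => ?_)
      simp only [Piece.rev_len] at h1
      have := (hc f _ (cnj_getLast c r u f h1)).1
      rw [Piece.letter_rev _ _ _ h1]
      intro e
      apply this
      rw [show (c.full r u (.cnj f)).len - 1 - 0 = (c.full r u (.cnj f)).len - 1 by omega] at e
      rw [e, full_letter]
      rfl
    · obtain rfl := Option.some.inj hs
      refine Or.inr (Or.inr fun h1 h2 => ?_)
      simp only [Piece.rev_len] at h1 h2
      have := (hc f _ (cnj_getLast c r u f h2)).2
      rw [Piece.letter_rev _ _ _ h1, Piece.letter_rev _ _ _ h2]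
      intro e
      apply this
      have e := linv_injective e
      simp only [Nat.sub_zero] at e
      rw [← e]
      have h1' : 0 < lenOf r u (c.ri f) := h1
      rw [full_letter]
      simp only [lab, full, tlen]
      congr 1
      omega
    · intro s hs
      obtain rfl := Option.some.inj hs
      exact hg.1.rev_rev

theorem flagsOK_polygon (hc : c.Corners r u) {Unl : Trk X A Φ × ℤ → Prop} {h : ℕ}
    (hU : ∀ τ, (∀ f, τ ≠ .face f) → EndUnl Unl h (c.full r u τ) ∧ EndUnl Unl h (c.full r u τ).rev)
    (w : List ((X ⊕ A) × Bool)) (fs : List Φ) :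
    ∀ o : Option (Piece (Trk X A Φ)), (∀ s ∈ o, EndUnl Unl h s) →
      FlagsOK (c.lab r u) Unl h o (c.wordPieces r u w ++ fs.flatMap (c.facePieces r u)) := by
  induction w with
  | nil => exact flagsOK_facePieces c r u hc hU fs
  | cons p w ih =>
    intro o ho
    have hg := hU (symTrk p.1) (by rcases p with ⟨_ | _, _⟩ <;> simp [symTrk])
    rcases p with ⟨t, _ | _⟩
    · exact ⟨fun s hs => flagOK_one (ho s hs) hg.2, ih _ (by rintro s ⟨rfl⟩; exact hg.1.rev_rev)⟩
    · exact ⟨fun s hs => flagOK_one (ho s hs) hg.1, ih _ (by rintro s ⟨rfl⟩; exact hg.2)⟩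

theorem polygon_bands (hu : ∀ i, IsCore (r i).toWord (u i)) (hc : c.Corners r u)
    {Unl : Trk X A Φ × ℤ → Prop} {h : ℕ}
    (hU : ∀ τ, (∀ f, τ ≠ .face f) → EndUnl Unl h (c.full r u τ) ∧ EndUnl Unl h (c.full r u τ).rev)
    (w : List ((X ⊕ A) × Bool)) (fs : List Φ)
    (hp : valProd (fun P => gen (c.lab r u P))
      ((c.wordPieces r u w ++ fs.flatMap (c.facePieces r u)).map Prod.fst) = 1) :
    ∃ bs : List (Band (Trk X A Φ) × ℕ),
      (∀ b ∈ bs, b.1.Valid (c.lab r u) (c.InTr r u) ∧ (2 ≤ b.2 ∨ (b.2 = 1 ∧ b.1.Clean Unl h))) ∧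
      (bs.map Prod.snd).sum ≤ 3 * w.length + 7 * fs.length ∧
      ∀ (S : Set (FreeGroup α)), (∀ x ∈ S, ∀ g, g * x * g⁻¹ ∈ S) →
        ∀ (v : Trk X A Φ × ℤ → FreeGroup α) (mm : Trk X A Φ × ℤ → Trk X A Φ × ℤ → ℕ),
          Compat (c.lab r u) S v mm →
          Ar S ((bs.map fun b => b.1.area mm).sum)
            (valProd v ((c.wordPieces r u w ++ fs.flatMap (c.facePieces r u)).map Prod.fst)) := by
  have hr : ∀ τ, FreeGroup.IsReduced ((c.full r u τ).rev.word (c.lab r u)) := by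
    intro τ
    rw [Piece.word_rev]
    exact isReduced_rev (full_isReduced c r u hu τ)
  have hB : ∀ p ∈ c.wordPieces r u w ++ fs.flatMap (c.facePieces r u),
      FreeGroup.IsReduced (p.1.word (c.lab r u)) ∧
        ∀ k < p.1.len, c.InTr r u (p.1.cell k) := by
    intro p hp
    rcases List.mem_append.1 hp with hp | hp
    · obtain ⟨⟨t, b⟩, -, rfl⟩ := List.mem_map.1 hp
      cases b
      · exact ⟨hr _, full_rev_inTr c r u _⟩
      · exact ⟨full_isReduced c r u hu _, full_inTr c r u _⟩
    · obtain ⟨f, -, hp⟩ := List.mem_flatMap.1 hp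
      simp only [facePieces, List.mem_cons, List.not_mem_nil, or_false] at hp
      rcases hp with rfl | rfl | rfl
      · exact ⟨full_isReduced c r u hu _, full_inTr c r u _⟩
      · exact ⟨full_isReduced c r u hu _, full_inTr c r u _⟩
      · exact ⟨hr _, full_rev_inTr c r u _⟩
  obtain ⟨bs, h1, h2, h3⟩ := stack_bands (c.lab r u) (c.InTr r u) Unl h _ []
    (c.wordPieces r u w ++ fs.flatMap (c.facePieces r u)) le_rfl (by simp) (by simp) hB
    (flagsOK_polygon c r u hc hU w fs none (by simp)) (by rw [hp]; simp [valProd])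
  refine ⟨bs, h1, h2.trans ?_, fun S hS v mm hv => by simpa [valProd] using h3 S hS v mm hv⟩
  rw [List.map_append, List.sum_append]
  have e1 : ((c.wordPieces r u w).map fun p => 2 + p.2).sum = 3 * w.length := by
    simp [wordPieces, Function.comp_def, mul_comm]
  have e2 : ((fs.flatMap (c.facePieces r u)).map fun p => 2 + p.2).sum = 7 * fs.length := by
    clear hp h2 h3 h1 hB
    induction fs with
    | nil => rfl
    | cons f fs ih =>
      rw [List.flatMap_cons, List.map_append, List.sum_append, ih]
      simp [facePieces]
      ring
  rw [e1, e2]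
  simp

end Cfg

end Configurations

section Minimality

variable {α ι X A Φ : Type*} [Inhabited α] [DecidableEq α]

theorem Ar.list_prod {G : Type*} [Group G] {S : Set G} {Φ : Type*} (g : Φ → G) (m : Φ → ℕ)
    (h : ∀ f, Ar S (m f) (g f)) (fs : List Φ) : Ar S (fs.map m).sum (fs.map g).prod := by
  induction fs with
  | nil => exact Ar.one S 0
  | cons f fs ih => simpa using (h f).mul ih

/-- An endomorphism of the free group that replaces one letter of a relator by the inverse of
the rest of the relator. -/
theorem exists_subst {r : ι → FreeGroup α} {u : ι → ℕ} (hu : ∀ i, IsCore (r i).toWord (u i))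
    (i : ι) (q : ℤ) :
    ∃ ψ : FreeGroup α →* FreeGroup α, (∀ l, Ar (relSet r) 1 ((gen l)⁻¹ * ψ (gen l))) ∧
      pprod (fun p => if p % lenOf r u i = q % lenOf r u i then ψ (gen (corOf r u i p))
        else gen (corOf r u i p)) (lenOf r u i) q = 1 := by
  obtain ⟨L, hL⟩ : ∃ L, lenOf r u i = L + 1 :=
    ⟨_, (Nat.sub_add_cancel (Nat.sub_pos_of_lt (hu i).lt)).symm⟩
  set C := corOf r u i with hC
  set rest := pprod (fun p => gen (C p)) L (q + 1) with hrest
  set e := C q with he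
  let ψ : FreeGroup α →* FreeGroup α :=
    FreeGroup.lift fun a => if a = e.1 then (if e.2 then rest⁻¹ else rest) else FreeGroup.of a
  have hψ : ∀ l : α × Bool, ψ (gen l) = if l.2 then ψ (FreeGroup.of l.1)
      else (ψ (FreeGroup.of l.1))⁻¹ := by
    rintro ⟨a, _ | _⟩
    · rw [← map_inv]; rfl
    · rfl
  have hψe : ψ (gen e) = rest⁻¹ := by
    rw [hψ]
    rcases hh : e.2 with _ | _ <;> simp [ψ, hh]
  have hψe' : ψ (gen (linv e)) = rest := by rw [gen_linv, map_inv, hψe, inv_inv]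
  have hψn : ∀ l : α × Bool, l.1 ≠ e.1 → ψ (gen l) = gen l := by
    intro l hl
    rw [hψ]
    rcases l with ⟨a, _ | _⟩
    · simp only [ψ, FreeGroup.lift_apply_of, if_neg hl, Bool.false_eq_true, if_false]; rfl
    · simp only [ψ, FreeGroup.lift_apply_of, if_neg hl, if_true]; rfl
  have hmem : gen e * rest ∈ relSet r := by
    have := pprod_rd_mem hu i q true
    rw [hL, pprod_succ_left] at this
    convert this using 1
    · simp only [rd, mz, sgn_true, if_true, add_zero]
      congr 1
      simp only [pprod, hrest]
      congr 1
      refine List.map_congr_left fun t _ => ?_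
      rw [show q + 1 + (t : ℤ) = q + (0 + 1 + t) by ring]
  have h1 : Ar (relSet r) 1 ((gen e)⁻¹ * rest⁻¹) := by
    convert Ar.mem (relSet_conj r _ (relSet_inv r _ hmem) (gen e)⁻¹) using 1
    group
  refine ⟨ψ, fun l => ?_, ?_⟩
  · by_cases hl : l.1 = e.1
    · by_cases hl2 : l.2 = e.2
      · have : l = e := Prod.ext hl hl2
        rw [this, hψe]
        exact h1
      · have : l = linv e := Prod.ext hl (by
          revert hl2; cases l.2 <;> cases hh : e.2 <;> simp [linv, hh])
        rw [this, hψe', gen_linv, inv_inv]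
        exact Ar.mem hmem
    · rw [hψn l hl, inv_mul_cancel]
      exact Ar.one _ _
  · rw [hL, pprod_succ_left, if_pos rfl, hψe]
    rw [inv_mul_eq_one, hrest]
    simp only [pprod]
    congr 1
    refine List.map_congr_left fun t ht => ?_
    rw [if_neg]
    intro h
    have : ((L + 1 : ℕ) : ℤ) ∣ (q + 1 + t) - q := Int.ModEq.dvd h.symm
    have h3 := Int.le_of_dvd (by omega) this
    have := List.mem_range.1 ht
    omega

namespace Cfg

variable (c : Cfg α ι X A Φ) (r : ι → FreeGroup α) (u : ι → ℕ)

/-- The weight of a pair of positions with respect to a set of positions. -/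
noncomputable def sepWt {T : Type*} (U : Set T) (P Q : T) : ℕ :=
  open Classical in if (P ∈ U ↔ Q ∈ U) then 0 else 1

/-- Values of positions obtained by applying an endomorphism at the positions in `U`. -/
noncomputable def substVal (U : Set (Trk X A Φ × ℤ)) (ψ : FreeGroup α →* FreeGroup α)
    (P : Trk X A Φ × ℤ) : FreeGroup α :=
  open Classical in if P ∈ U then ψ (gen (c.lab r u P)) else gen (c.lab r u P)

theorem compat_substVal (U : Set (Trk X A Φ × ℤ)) {ψ : FreeGroup α →* FreeGroup α}
    (hψ : ∀ l, Ar (relSet r) 1 ((gen l)⁻¹ * ψ (gen l))) :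
    Compat (c.lab r u) (relSet r) (c.substVal r u U ψ) (sepWt U) := by
  classical
  have key : ∀ P d, sval (c.substVal r u U ψ) P d =
      if P ∈ U then ψ (gen (sgn (c.lab r u P) d)) else gen (sgn (c.lab r u P) d) := by
    intro P d
    cases d <;> by_cases h : P ∈ U <;> simp [sval, substVal, h]
  intro P d Q e h
  rw [key, key, h]
  by_cases h1 : P ∈ U <;> by_cases h2 : Q ∈ U
  · simpa [h1, h2, sepWt] using Ar.one _ 0
  · have := (hψ (sgn (c.lab r u Q) e)).inv (relSet_inv r)
    simpa [h1, h2, sepWt] using this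
  · simpa [h1, h2, sepWt] using hψ (sgn (c.lab r u Q) e)
  · simpa [h1, h2, sepWt] using Ar.one _ 0

theorem full_val_lab (τ : Trk X A Φ) :
    (c.full r u τ).val (fun P => gen (c.lab r u P)) =
      FreeGroup.mk ((c.full r u τ).word (c.lab r u)) := by
  rw [Piece.val_gen]

theorem map_full_val_substVal {H : Type*} [Group H] {π : FreeGroup α →* H}
    (hπ : ∀ x ∈ relSet r, π x = 1) (U : Set (Trk X A Φ × ℤ)) {ψ : FreeGroup α →* FreeGroup α}
    (hψ : ∀ l, Ar (relSet r) 1 ((gen l)⁻¹ * ψ (gen l))) (τ : Trk X A Φ) :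
    π ((c.full r u τ).val (c.substVal r u U ψ)) =
      π ((c.full r u τ).val (fun P => gen (c.lab r u P))) := by
  have h : ∀ l, π (ψ (gen l)) = π (gen l) := by
    intro l
    obtain ⟨L, -, h2, h3⟩ := hψ l
    have : π ((gen l)⁻¹ * ψ (gen l)) = 1 := by
      rw [← h3, map_list_prod]
      refine List.prod_eq_one fun x hx => ?_
      obtain ⟨y, hy, rfl⟩ := List.mem_map.1 hx
      exact hπ y (h2 y hy)
    rw [map_mul, map_inv, inv_mul_eq_one] at this
    exact this.symm
  rw [full_val, full_val, map_list_prod, map_list_prod, List.map_map, List.map_map]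
  congr 1
  refine List.map_congr_left fun k _ => ?_
  simp only [Function.comp, substVal]
  split_ifs
  · exact h _
  · rfl

theorem full_val_face (U : Set (Trk X A Φ × ℤ)) (ψ : FreeGroup α →* FreeGroup α) (f : Φ) :
    (c.full r u (.face f)).val (c.substVal r u U ψ) =
      pprod (fun t => c.substVal r u U ψ (.face f, t)) (lenOf r u (c.ri f)) 0 := by
  rw [full_val, pprod]
  simp [tlen]

theorem ar_subst (hu : ∀ i, IsCore (r i).toWord (u i)) [DecidableEq ι] [DecidableEq (X ⊕ A)]
    (w : FreeGroup (X ⊕ A)) (fs : List Φ) (k : ℕ) (U : Set (Trk X A Φ × ℤ)) (i : ι) (q : ℤ)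
    (hq : 0 ≤ q) (hqL : q < lenOf r u i)
    (hUf : ∀ f (t : ℤ), 0 ≤ t → t < lenOf r u (c.ri f) →
      ((Trk.face f, t) ∈ U ↔ c.key r u f t = (i, q)))
    (hUc : ∀ s t, c.InTr r u (.const s, t) → (Trk.const s, t) ∉ U)
    {ψ : FreeGroup α →* FreeGroup α}
    (hψ1 : pprod (fun p => if p % lenOf r u i = q % lenOf r u i then ψ (gen (corOf r u i p))
        else gen (corOf r u i p)) (lenOf r u i) q = 1)
    (h : Ar (relSet r) k (valProd (c.substVal r u U ψ)
      ((c.wordPieces r u w.toWord ++ fs.flatMap (c.facePieces r u)).map Prod.fst))) :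
    Ar (relSet r) (k + (fs.map fun f => if c.ri f = i then 0 else 1).sum)
      (FreeGroup.lift
        (Sum.elim (fun v => (c.full r u (.var v)).val (c.substVal r u U ψ)) c.as) w) := by
  classical
  have hsplit : ∀ l l' : List (Piece (Trk X A Φ)), valProd (c.substVal r u U ψ) (l ++ l') =
      valProd (c.substVal r u U ψ) l * valProd (c.substVal r u U ψ) l' := by
    intro l l'; simp [valProd]
  rw [List.map_append, hsplit, valProd_wordPieces, valProd_facePieces] at h
  have hc : (fun t => (c.full r u (symTrk t)).val (c.substVal r u U ψ)) =
      Sum.elim (fun v => (c.full r u (.var v)).val (c.substVal r u U ψ)) c.as := by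
    funext t
    rcases t with v | s
    · rfl
    · show (c.full r u (.const s)).val (c.substVal r u U ψ) = c.as s
      conv_rhs => rw [← FreeGroup.mk_toWord (x := c.as s), ← full_word_const c r u s,
        ← full_val_lab]
      rw [full_val, full_val]
      congr 1
      refine List.map_congr_left fun k hk => ?_
      rw [substVal, if_neg (hUc s k ⟨by simp, by simpa using hk⟩)]
  rw [hc] at h
  have hF := Ar.list_prod (S := relSet r) (fun f => (c.full r u (.cnj f)).val (c.substVal r u U ψ) *
    (c.full r u (.face f)).val (c.substVal r u U ψ) *
        ((c.full r u (.cnj f)).val (c.substVal r u U ψ))⁻¹)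
      (fun f => if c.ri f = i then 0 else 1) ?_ fs
  · simpa using h.mul (hF.inv (relSet_inv r))
  · intro f
    refine Ar.conj (relSet_conj r) ?_ _
    rw [full_val_face]
    split_ifs with hf
    · set w' : ℤ → FreeGroup α := fun p => if p % lenOf r u i = q % lenOf r u i then
        ψ (gen (corOf r u i p)) else gen (corOf r u i p) with hw'
      have hper : ∀ k, w' (k + lenOf r u i) = w' k := by
        intro k
        simp only [hw', corOf_periodic, Int.add_emod_right]
      obtain ⟨g, hg⟩ := pprod_dval_conj (w := w') hper (c.rz f) (c.rs f) q
      have e : pprod (fun t => c.substVal r u U ψ (.face f, t)) (lenOf r u (c.ri f)) 0 =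
          pprod (dval w' (c.rz f) (c.rs f)) (lenOf r u i) 0 := by
        rw [hf]
        simp only [pprod]
        congr 1
        refine List.map_congr_left fun t ht => ?_
        have ht := List.mem_range.1 ht
        have := hUf f (0 + t) (by omega) (by rw [hf]; omega)
        simp only [substVal, this, key, hf, Prod.mk.injEq, true_and, dval, hw', lab, rd,
          Int.emod_eq_of_lt hq hqL]
        by_cases hm : mz (c.rz f) (c.rs f) (0 + t) % lenOf r u i = q
        · cases hs : c.rs f <;> rw [hs] at hm <;> simp only [hm] <;> simp
        · cases hs : c.rs f <;> rw [hs] at hm <;> simp only [hm] <;> simp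
      rw [e]
      rw [hψ1] at hg
      have : pprod (dval w' (c.rz f) (c.rs f)) (lenOf r u i) 0 = 1 := by simpa using hg
      rw [this]
      exact Ar.one _ _
    · refine Ar.mem ?_
      convert pprod_rd_mem hu (c.ri f) (c.rz f) (c.rs f) using 1
      simp only [pprod]
      congr 1
      refine List.map_congr_left fun t ht => ?_
      have ht := List.mem_range.1 ht
      rw [substVal, if_neg]
      · rfl
      · rw [hUf f _ (by omega) (by omega)]
        exact fun h => hf (congrArg Prod.fst h)

end Cfg

end Minimality

section Minimal

variable {α ι X A : Type*} [Inhabited α] [DecidableEq α]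

theorem sum_map_flatMap {β γ : Type*} (bs : β → List γ) (g : γ → ℕ) (l : List β) :
    ((l.flatMap bs).map g).sum = (l.map fun j => ((bs j).map g).sum).sum := by
  induction l with
  | nil => rfl
  | cons j l ih => simp [List.flatMap_cons, ih]

/-- A solution of a system in the quotient that does not lift gives a minimal configuration. -/
theorem exists_cfg [DecidableEq ι] [DecidableEq (X ⊕ A)] {r : ι → FreeGroup α} {u : ι → ℕ}
    (hu : ∀ i, IsCore (r i).toWord (u i)) {G : Type*} [Group G] (π : FreeGroup α →* G)
    (hsurj : Function.Surjective π) (hker : π.ker = Subgroup.normalClosure (Set.range r))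
    {J : Type} [Fintype J] (w : J → FreeGroup (X ⊕ A)) (a : A → FreeGroup α) (x : X → G)
    (hx : ∀ j, FreeGroup.lift (Sum.elim x (fun s => π (a s))) (w j) = 1)
    (hno : ¬ ∃ y : X → FreeGroup α, (∀ v, π (y v) = x v) ∧
      ∀ j, FreeGroup.lift (Sum.elim y a) (w j) = 1) :
    ∃ (Φ : Type) (_ : Fintype Φ) (c : Cfg α ι X A Φ), c.as = a ∧ Nonempty Φ ∧
      ∀ (Unl : Trk X A Φ × ℤ → Prop) (h : ℕ),
        (∀ τ, (∀ f, τ ≠ .face f) →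
          Cfg.EndUnl Unl h (c.full r u τ) ∧ Cfg.EndUnl Unl h (c.full r u τ).rev) →
        ∃ bs : List (Band (Trk X A Φ) × ℕ),
          (∀ b ∈ bs, b.1.Valid (c.lab r u) (c.InTr r u) ∧
            (2 ≤ b.2 ∨ (b.2 = 1 ∧ b.1.Clean Unl h))) ∧
          (bs.map Prod.snd).sum ≤ 3 * ∑ j, (w j).toWord.length + 7 * Fintype.card Φ ∧
          ∀ (U : Set (Trk X A Φ × ℤ)) (i : ι) (q : ℤ), 0 ≤ q → q < lenOf r u i →
            (∀ f (t : ℤ), 0 ≤ t → t < lenOf r u (c.ri f) →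
              ((Trk.face f, t) ∈ U ↔ c.key r u f t = (i, q))) →
            (∀ s t, c.InTr r u (.const s, t) → (Trk.const s, t) ∉ U) →
            (Finset.univ.filter fun f => c.ri f = i).card ≤
              (bs.map fun b => b.1.area (Cfg.sepWt U)).sum := by
  classical
  have hπ : ∀ g ∈ relSet r, π g = 1 := by
    intro g hg
    rw [← MonoidHom.mem_ker, hker]
    exact relSet_subset r hg
  let Q : ℕ → Prop := fun K => ∃ y : X → FreeGroup α, (∀ v, π (y v) = x v) ∧
    ∃ N : J → ℕ, (∀ j, Ar (relSet r) (N j) (FreeGroup.lift (Sum.elim y a) (w j))) ∧ ∑ j, N j = K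
  have hlift : ∀ (y : X → FreeGroup α), (∀ v, π (y v) = x v) → ∀ g,
      π (FreeGroup.lift (Sum.elim y a) g) = FreeGroup.lift (Sum.elim x (fun s => π (a s))) g := by
    intro y hy g
    have : π.comp (FreeGroup.lift (Sum.elim y a)) =
        FreeGroup.lift (Sum.elim x (fun s => π (a s))) := by
      ext t
      rcases t with v | s <;> simp [hy]
    exact DFunLike.congr_fun this g
  have hQ : ∃ K, Q K := by
    choose y hy using fun v => hsurj (x v)
    have : ∀ j, ∃ N, Ar (relSet r) N (FreeGroup.lift (Sum.elim y a) (w j)) := by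
      intro j
      apply exists_ar
      rw [← hker, MonoidHom.mem_ker, hlift y hy, hx]
    choose N hN using this
    exact ⟨_, y, hy, N, hN, rfl⟩
  obtain ⟨y, hy, N, hN, hK⟩ := Nat.find_spec hQ
  have hmin : ∀ K, Q K → Nat.find hQ ≤ K := fun K => Nat.find_min' hQ
  choose ls hls1 hls2 hls3 using fun j => (hN j).inv (relSet_inv r)
  let Φ := Σ j, Fin (ls j).length
  have hrep : ∀ f : Φ, _ := fun f => exists_face_rep hu (hls2 f.1 _ (List.getElem_mem f.2.2))
  choose g ri rz rs hval hcor using hrep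
  let c : Cfg α ι X A Φ := ⟨y, a, g, ri, rz, rs⟩
  have hcard : Fintype.card Φ ≤ Nat.find hQ := by
    rw [Fintype.card_sigma, ← hK]
    exact Finset.sum_le_sum fun j _ => by simpa using hls1 j
  let fs : J → List Φ := fun j => (List.finRange (ls j).length).map fun t => ⟨j, t⟩
  have hfs : ∀ (m : Φ → ℕ), ∑ j, ((fs j).map m).sum = ∑ f, m f := by
    intro m
    rw [Fintype.sum_sigma]
    refine Finset.sum_congr rfl fun j _ => ?_
    simp only [fs, List.map_map]
    rw [← List.ofFn_eq_map, List.sum_ofFn]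
    rfl
  have hfslen : ∑ j, (fs j).length = Fintype.card Φ := by
    rw [Fintype.card_sigma]
    simp [fs]
  have hval0 : ∀ τ, (c.full r u τ).val (fun P => gen (c.lab r u P)) =
      FreeGroup.mk ((c.full r u τ).word (c.lab r u)) := c.full_val_lab r u
  have hvar : ∀ v, (c.full r u (.var v)).val (fun P => gen (c.lab r u P)) = y v := by
    intro v
    rw [hval0, c.full_word_var r u v, FreeGroup.mk_toWord]
  have hconst : ∀ s, (c.full r u (.const s)).val (fun P => gen (c.lab r u P)) = a s := by
    intro s
    rw [hval0, c.full_word_const r u s, FreeGroup.mk_toWord]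
  have hcnj : ∀ f, (c.full r u (.cnj f)).val (fun P => gen (c.lab r u P)) = g f := by
    intro f
    rw [hval0, c.full_word_cnj r u f, FreeGroup.mk_toWord]
  refine ⟨Φ, inferInstance, c, rfl, ?_, ?_⟩
  · by_contra hem
    rw [not_nonempty_iff] at hem
    refine hno ⟨y, hy, fun j => ?_⟩
    have : ls j = [] := by
      rw [List.eq_nil_iff_length_eq_zero]
      by_contra h0
      exact hem.elim ⟨j, ⟨0, Nat.pos_of_ne_zero h0⟩⟩
    have h3 := hls3 j
    rw [this, List.prod_nil] at h3
    exact inv_eq_one.1 h3.symm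
  · intro Unl h hU
    have hpoly : ∀ j, valProd (fun P => gen (c.lab r u P))
        ((c.wordPieces r u (w j).toWord ++
          (fs j).flatMap (c.facePieces r u)).map Prod.fst) = 1 := by
      intro j
      rw [List.map_append, valProd, List.map_append, List.prod_append]
      change valProd _ _ * valProd _ _ = 1
      rw [c.valProd_wordPieces, c.valProd_facePieces]
      have e1 : (fun t => (c.full r u (Cfg.symTrk t)).val (fun P => gen (c.lab r u P))) =
          Sum.elim y a := by
        funext t
        rcases t with v | s
        · exact hvar v
        · exact hconst s
      rw [e1]
      have e2 : (fs j).map (fun f => (c.full r u (.cnj f)).val (fun P => gen (c.lab r u P)) *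
          (c.full r u (.face f)).val (fun P => gen (c.lab r u P)) *
          ((c.full r u (.cnj f)).val (fun P => gen (c.lab r u P)))⁻¹) = ls j := by
        apply List.ext_getElem
        · simp [fs]
        · intro t h1 h2
          simp only [fs, List.getElem_map, List.getElem_finRange, hcnj]
          have := hval ⟨j, ⟨t, h2⟩⟩
          simp only at this
          refine Eq.trans ?_ this.symm
          rw [Cfg.full_val]
          simp only [pprod, zero_add]
          rfl
      rw [e2, hls3, mul_inv_cancel]
    have hb := fun j => c.polygon_bands r u hu hcor hU (w j).toWord (fs j) (hpoly j)
    choose bs hb1 hb2 hb3 using hb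
    refine ⟨Finset.univ.toList.flatMap bs, ?_, ?_, ?_⟩
    · intro b hb
      obtain ⟨j, -, hb⟩ := List.mem_flatMap.1 hb
      exact hb1 j b hb
    · rw [sum_map_flatMap, Finset.sum_map_toList]
      calc _ ≤ ∑ j, (3 * (w j).toWord.length + 7 * (fs j).length) :=
            Finset.sum_le_sum fun j _ => hb2 j
        _ = _ := by rw [Finset.sum_add_distrib, ← Finset.mul_sum, ← Finset.mul_sum, hfslen]
    · intro U i q hq hqL hUf hUc
      obtain ⟨ψ, hψ, hψ1⟩ := exists_subst hu i q
      have key := hmin (∑ j, (((bs j).map fun b => b.1.area (Cfg.sepWt U)).sum +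
          ((fs j).map fun f => if c.ri f = i then 0 else 1).sum))
        ⟨fun v => (c.full r u (.var v)).val (c.substVal r u U ψ), fun v => by
          rw [c.map_full_val_substVal r u hπ U hψ, hvar, hy], _, fun j =>
          c.ar_subst r u hu (w j) (fs j) _ U i q hq hqL hUf hUc hψ1
            (hb3 j _ (relSet_conj r) _ _ (c.compat_substVal r u U hψ)), rfl⟩
      rw [Finset.sum_add_distrib, hfs] at key
      have h1 : ∑ f : Φ, (if c.ri f = i then 0 else 1) +
          (Finset.univ.filter fun f => c.ri f = i).card = Fintype.card Φ := by
        rw [Finset.card_filter, ← Finset.sum_add_distrib, ← Finset.card_univ,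
          Finset.card_eq_sum_ones]
        exact Finset.sum_congr rfl fun f _ => by split_ifs <;> rfl
      rw [sum_map_flatMap, Finset.sum_map_toList]
      omega

end Minimal

section Marks

variable {α ι X A Φ : Type*} [Inhabited α] [DecidableEq α]

/-- Two readings of length `h` of the cyclically reduced relators agree only trivially. -/
def SepAt (r : ι → FreeGroup α) (u : ι → ℕ) (h : ℕ) : Prop :=
  ∀ i z s i' z' s', (∀ t : ℕ, t < h → rd (corOf r u i) z s t = rd (corOf r u i') z' s' t) →
    i = i' ∧ s = s' ∧ z % lenOf r u i = z' % lenOf r u i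

/-- The number of disagreements between two marks. -/
def markCost {β : Type*} [DecidableEq β] (a b : Option β) : ℕ :=
  if a = b then 0 else if a = none ∨ b = none then 1 else 2

theorem markCost_le_two {β : Type*} [DecidableEq β] (a b : Option β) : markCost a b ≤ 2 := by
  unfold markCost; split_ifs <;> omega

namespace Cfg

variable (c : Cfg α ι X A Φ) (r : ι → FreeGroup α) (u : ι → ℕ) (h : ℕ)

/-- The word around a position agrees with the reading of a relator. -/
def Reads (P : Trk X A Φ × ℤ) (i : ι) (z : ℤ) (s : Bool) : Prop :=
  ∀ t : ℤ, |t| ≤ h → c.InTr r u (mv P true t) ∧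
    c.lab r u (mv P true t) = rd (corOf r u i) z s t

open Classical in
/-- The position in a relator that a position of a configuration is recognised to represent. -/
noncomputable def mark (P : Trk X A Φ × ℤ) : Option (ι × ℤ) :=
  match P.1 with
  | .face f => some (c.key r u f P.2)
  | _ => if H : ∃ x : ι × ℤ × Bool, c.Reads r u h P x.1 x.2.1 x.2.2 then
      some (H.choose.1, H.choose.2.1 % lenOf r u H.choose.1) else none

theorem mark_face (f : Φ) (t : ℤ) : c.mark r u h (.face f, t) = some (c.key r u f t) := rfl

open Classical in
theorem mark_of_ne_face {P : Trk X A Φ × ℤ} (hP : ∀ f, P.1 ≠ .face f) :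
    c.mark r u h P = if H : ∃ x : ι × ℤ × Bool, c.Reads r u h P x.1 x.2.1 x.2.2 then
      some (H.choose.1, H.choose.2.1 % lenOf r u H.choose.1) else none := by
  obtain ⟨τ, p⟩ := P
  cases τ with
  | face f => exact absurd rfl (hP f)
  | _ => rfl

variable {c r u h}

theorem mark_spec {P : Trk X A Φ × ℤ} {i : ι} {q : ℤ} (hm : c.mark r u h P = some (i, q)) :
    ∃ z s, z % lenOf r u i = q ∧ ∀ (D : Bool) (t : ℤ), |t| ≤ h → c.InTr r u (mv P D t) →
      sgn (c.lab r u (mv P D t)) D = rd (corOf r u i) z (s == D) t := by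
  suffices H : ∃ z s, z % lenOf r u i = q ∧ ∀ t : ℤ, |t| ≤ h → c.InTr r u (mv P true t) →
      c.lab r u (mv P true t) = rd (corOf r u i) z s t by
    obtain ⟨z, s, h1, h2⟩ := H
    refine ⟨z, s, h1, fun D t ht hI => ?_⟩
    have e : mv P D t = mv P true (mz 0 D t) := by
      cases D <;> simp [mv, mz] <;> ring
    rw [e] at hI ⊢
    rw [h2 _ (by cases D <;> simpa [mz] using ht) hI, sgn_rd_mz, mz_zero]
  by_cases hP : ∃ f, P.1 = .face f
  · obtain ⟨f, hf⟩ := hP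
    obtain ⟨τ, p⟩ := P
    obtain rfl : τ = .face f := hf
    rw [mark_face, Option.some.injEq, key, Prod.mk.injEq] at hm
    obtain ⟨rfl, rfl⟩ := hm
    refine ⟨mz (c.rz f) (c.rs f) p, c.rs f, rfl, fun t _ _ => ?_⟩
    rw [rd_shift]
    rfl
  · push Not at hP
    rw [mark_of_ne_face c r u h hP] at hm
    split_ifs at hm with H
    rw [Option.some.injEq, Prod.mk.injEq] at hm
    obtain ⟨h1, h2⟩ := hm
    refine ⟨H.choose.2.1, H.choose.2.2, ?_, fun t ht _ => ?_⟩
    · rw [← h2, h1]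
    · rw [← h1]
      exact (H.choose_spec t ht).2

theorem mark_ne_none {P : Trk X A Φ × ℤ} {D : Bool} {i : ι} {z : ℤ} {s : Bool}
    (H : ∀ t : ℤ, |t| ≤ h → c.InTr r u (mv P D t) ∧
      sgn (c.lab r u (mv P D t)) D = rd (corOf r u i) z s t) : c.mark r u h P ≠ none := by
  by_cases hP : ∃ f, P.1 = .face f
  · obtain ⟨f, hf⟩ := hP
    obtain ⟨τ, p⟩ := P
    obtain rfl : τ = .face f := hf
    rw [mark_face]
    simp
  · push Not at hP
    rw [mark_of_ne_face c r u h hP, dif_pos ?_]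
    · simp
    refine ⟨⟨i, z, s == D⟩, fun t ht => ?_⟩
    have e : mv P true t = mv P D (mz 0 D t) := by
      cases D <;> simp [mv, mz]
    obtain ⟨h1, h2⟩ := H (mz 0 D t) (by cases D <;> simpa [mz] using ht)
    rw [e]
    refine ⟨h1, ?_⟩
    have := congrArg (fun l => sgn l D) h2
    simp only [sgn_self_sgn] at this
    rw [this, sgn_rd_mz, mz_zero]

theorem mark_eq_none {P : Trk X A Φ × ℤ} (hP : ∀ f, P.1 ≠ .face f) {t : ℤ} (ht : |t| ≤ h)
    (hI : ¬ c.InTr r u (mv P true t)) : c.mark r u h P = none := by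
  rw [mark_of_ne_face c r u h hP, dif_neg]
  rintro ⟨x, hx⟩
  exact hI (hx t ht).1

theorem endUnl_mark (τ : Trk X A Φ) (hτ : ∀ f, τ ≠ .face f) :
    EndUnl (fun P => c.mark r u h P = none) h (c.full r u τ) ∧
      EndUnl (fun P => c.mark r u h P = none) h (c.full r u τ).rev := by
  constructor
  · intro k hk hl
    rw [full_cell]
    refine mark_eq_none hτ (t := -h) (by simp) ?_
    simp only [InTr, mv, mz, if_true]
    omega
  · intro k hk hl
    simp only [Piece.rev_len] at hl
    rw [Piece.cell_rev _ _ hl, full_cell]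
    refine mark_eq_none hτ (t := h) (by simp) ?_
    have : (c.full r u τ).len = c.tlen r u τ := rfl
    simp only [InTr, mv, mz, if_true]
    omega

theorem mark_const (s : A) (hs : (c.as s).toWord.length ≤ 2 * h) (t : ℤ) :
    c.mark r u h (.const s, t) = none := by
  by_cases ht : t < h
  · refine mark_eq_none (by simp) (t := -h) (by simp) ?_
    simp only [InTr, mv, mz, if_true]
    omega
  · refine mark_eq_none (by simp) (t := h) (by simp) ?_
    simp only [InTr, mv, mz, if_true, tlen]
    omega

theorem cp_add {T : Type*} (b : Band T) (k k' : ℕ) :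
    b.cp k' = mv (b.cp k) b.D ((k' : ℤ) - k) := by
  simp [Band.cp, mv_mv]

theorem cq_add {T : Type*} (b : Band T) (k k' : ℕ) :
    b.cq k' = mv (b.cq k) b.E ((k' : ℤ) - k) := by
  simp [Band.cq, mv_mv]

theorem mark_eq_of_valid (hS : SepAt r u h) {b : Band (Trk X A Φ)}
    (hb : b.Valid (c.lab r u) (c.InTr r u)) (hL : h ≤ b.L) {k : ℕ} (hk : k < b.L)
    (h1 : c.mark r u h (b.cp k) ≠ none) (h2 : c.mark r u h (b.cq k) ≠ none) :
    c.mark r u h (b.cp k) = c.mark r u h (b.cq k) := by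
  obtain ⟨⟨i, q⟩, e1⟩ := Option.ne_none_iff_exists'.1 h1
  obtain ⟨⟨i', q'⟩, e2⟩ := Option.ne_none_iff_exists'.1 h2
  obtain ⟨z, s, rfl, H1⟩ := mark_spec e1
  obtain ⟨z', s', rfl, H2⟩ := mark_spec e2
  rw [e1, e2]
  obtain ⟨k0, hk0, hk1, hk2⟩ : ∃ k0 : ℕ, k0 + h ≤ b.L ∧ k0 ≤ k ∧ k ≤ k0 + h := by
    by_cases hh : k + h ≤ b.L
    · exact ⟨k, hh, le_rfl, by omega⟩
    · exact ⟨b.L - h, by omega, by omega, by omega⟩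
  have key := hS i (mz z (s == b.D) ((k0 : ℤ) - k)) (s == b.D)
    i' (mz z' (s' == b.E) ((k0 : ℤ) - k)) (s' == b.E) (fun t ht => by
      rw [rd_shift, rd_shift]
      obtain ⟨hI, hI', hl⟩ := hb (k0 + t) (by omega)
      rw [cp_add b k] at hI hl
      rw [cq_add b k] at hI' hl
      have ha : |((k0 + t : ℕ) : ℤ) - k| ≤ h := by rw [abs_le]; omega
      rw [H1 b.D _ ha hI, H2 b.E _ ha hI'] at hl
      rw [show (k0 : ℤ) - k + t = ((k0 + t : ℕ) : ℤ) - k by push_cast; ring]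
      exact hl)
  obtain ⟨rfl, h3, h4⟩ := key
  rw [← h3] at h4
  have : z % lenOf r u i = z' % lenOf r u i := by
    cases hd : (s == b.D)
    · rw [hd] at h4
      simp only [mz, Bool.false_eq_true, if_false] at h4
      have := Int.ModEq.add_right ((k0 : ℤ) - k) h4
      simpa [Int.ModEq] using this
    · rw [hd] at h4
      simp only [mz, if_true] at h4
      exact Int.ModEq.add_right_cancel' _ h4
  rw [this]

theorem mark_ne_none_of_valid {b : Band (Trk X A Φ)}
    (hb : b.Valid (c.lab r u) (c.InTr r u)) {k : ℕ} (hk : h ≤ k) (hk' : k + h < b.L) :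
    c.mark r u h (b.cp k) ≠ none ↔ c.mark r u h (b.cq k) ≠ none := by
  have hr : ∀ t : ℤ, |t| ≤ h → c.InTr r u (mv (b.cp k) b.D t) ∧ c.InTr r u (mv (b.cq k) b.E t) ∧
      sgn (c.lab r u (mv (b.cp k) b.D t)) b.D = sgn (c.lab r u (mv (b.cq k) b.E t)) b.E := by
    intro t ht
    rw [abs_le] at ht
    have := hb (k + t).toNat (by omega)
    rwa [cp_add b k, cq_add b k, show (((k + t).toNat : ℕ) : ℤ) - k = t by omega] at this
  constructor <;> intro h1 <;> obtain ⟨⟨i, q⟩, e1⟩ := Option.ne_none_iff_exists'.1 h1 <;>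
    obtain ⟨z, s, rfl, H1⟩ := mark_spec e1
  · exact mark_ne_none fun t ht => ⟨(hr t ht).2.1, by
      rw [← (hr t ht).2.2]; exact H1 _ t ht (hr t ht).1⟩
  · exact mark_ne_none fun t ht => ⟨(hr t ht).1, by
      rw [(hr t ht).2.2]; exact H1 _ t ht (hr t ht).2.1⟩

theorem markCost_band_le [DecidableEq ι] (hS : SepAt r u h) {b : Band (Trk X A Φ)} {n : ℕ}
    (hb : b.Valid (c.lab r u) (c.InTr r u))
    (hn : 2 ≤ n ∨ (n = 1 ∧ b.Clean (fun P => c.mark r u h P = none) h)) :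
    b.area (fun P Q => markCost (c.mark r u h P) (c.mark r u h Q)) ≤ n * h := by
  set f : ℕ → ℕ := fun k => markCost (c.mark r u h (b.cp k)) (c.mark r u h (b.cq k)) with hf
  change ∑ k ∈ Finset.range b.L, f k ≤ n * h
  have hclean : b.Clean (fun P => c.mark r u h P = none) h → ∀ k < b.L, k < h → f k = 0 := by
    intro hc k hk hkh
    obtain ⟨e1, e2⟩ := hc k hk hkh
    simp [hf, e1, e2, markCost]
  by_cases hL : h ≤ b.L
  · have h1 : ∀ k < b.L, f k ≤ 1 := by
      intro k hk
      simp only [hf, markCost]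
      split_ifs with h1 h2
      · omega
      · exact le_rfl
      · push Not at h2
        exact absurd (mark_eq_of_valid hS hb hL hk h2.1 h2.2) h1
    have h0 : ∀ k, h ≤ k → k + h < b.L → f k = 0 := by
      intro k hk hk'
      have hiff := mark_ne_none_of_valid hb hk hk'
      simp only [hf, markCost]
      rw [if_pos]
      by_cases h2 : c.mark r u h (b.cp k) = none
      · rw [h2]
        by_contra h3
        exact hiff.2 (Ne.symm h3) h2
      · exact mark_eq_of_valid hS hb hL (by omega) h2 (hiff.1 h2)
    have hle : ∀ k ∈ Finset.range b.L, f k ≤ (if k < h ∧ 2 ≤ n then 1 else 0) +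
        (if b.L ≤ k + h then 1 else 0) := by
      intro k hk
      rw [Finset.mem_range] at hk
      have := h1 k hk
      by_cases h3 : b.L ≤ k + h
      · rw [if_pos h3]; omega
      · by_cases h4 : k < h
        · rcases hn with hn | ⟨hn, hc⟩
          · rw [if_pos ⟨h4, hn⟩]; omega
          · rw [hclean hc k hk h4]; omega
        · rw [h0 k (by omega) (by omega)]; omega
    refine (Finset.sum_le_sum hle).trans ?_
    rw [Finset.sum_add_distrib, ← Finset.card_filter, ← Finset.card_filter]
    have c1 : ((Finset.range b.L).filter fun k => k < h ∧ 2 ≤ n).card ≤ if 2 ≤ n then h else 0 := by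
      split_ifs with h2
      · refine (Finset.card_le_card (t := Finset.range h) fun k hk => ?_).trans (by simp)
        simp only [Finset.mem_filter] at hk
        exact Finset.mem_range.2 hk.2.1
      · rw [Finset.filter_false_of_mem]
        · simp
        · exact fun k _ hk => h2 hk.2
    have c2 : ((Finset.range b.L).filter fun k => b.L ≤ k + h).card ≤ h := by
      refine (Finset.card_le_card (t := Finset.Ico (b.L - h) b.L) fun k hk => ?_).trans ?_
      · simp only [Finset.mem_filter, Finset.mem_range] at hk
        rw [Finset.mem_Ico]; omega
      · rw [Nat.card_Ico]; omega
    split_ifs at c1 with h2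
    · nlinarith
    · have : n = 1 := by rcases hn with hn | hn <;> omega
      subst this
      omega
  · rcases hn with hn | ⟨hn, hc⟩
    · calc ∑ k ∈ Finset.range b.L, f k ≤ ∑ k ∈ Finset.range b.L, 2 :=
          Finset.sum_le_sum fun k _ => markCost_le_two _ _
        _ ≤ n * h := by simp; nlinarith
    · rw [Finset.sum_eq_zero]
      · omega
      · intro k hk
        rw [Finset.mem_range] at hk
        exact hclean hc k hk (by omega)

theorem sum_sepWt_le [DecidableEq ι] {T : Type*} (m : T → Option (ι × ℤ)) (s : Finset (ι × ℤ))
    (P Q : T) : ∑ x ∈ s, sepWt {R | m R = some x} P Q ≤ markCost (m P) (m Q) := by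
  classical
  have h1 : ∀ o : Option (ι × ℤ), ∑ x ∈ s, (if o = some x then 1 else 0) ≤
      if o = none then 0 else 1 := by
    intro o
    cases o with
    | none => simp
    | some y => simp [Option.some.injEq]; split_ifs <;> simp
  by_cases h : m P = m Q
  · simp [sepWt, h]
  · calc _ ≤ ∑ x ∈ s, ((if m P = some x then 1 else 0) + (if m Q = some x then 1 else 0)) := by
          refine Finset.sum_le_sum fun x _ => ?_
          simp only [sepWt, Set.mem_ofPred_eq]
          split_ifs <;> simp_all
      _ ≤ (if m P = none then 0 else 1) + (if m Q = none then 0 else 1) := by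
          rw [Finset.sum_add_distrib]
          exact Nat.add_le_add (h1 _) (h1 _)
      _ ≤ _ := by
          simp only [markCost, if_neg h]
          split_ifs <;> simp_all

theorem sum_lenOf_le [Fintype Φ] [DecidableEq ι] (hS : SepAt r u h)
    (ha : ∀ s, (c.as s).toWord.length ≤ 2 * h) (bs : List (Band (Trk X A Φ) × ℕ))
    (hv : ∀ b ∈ bs, b.1.Valid (c.lab r u) (c.InTr r u) ∧
      (2 ≤ b.2 ∨ (b.2 = 1 ∧ b.1.Clean (fun P => c.mark r u h P = none) h)))
    (hflip : ∀ (U : Set (Trk X A Φ × ℤ)) (i : ι) (q : ℤ), 0 ≤ q → q < lenOf r u i →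
      (∀ f (t : ℤ), 0 ≤ t → t < lenOf r u (c.ri f) →
        ((Trk.face f, t) ∈ U ↔ c.key r u f t = (i, q))) →
      (∀ s t, c.InTr r u (.const s, t) → (Trk.const s, t) ∉ U) →
      (Finset.univ.filter fun f => c.ri f = i).card ≤
        (bs.map fun b => b.1.area (sepWt U)).sum) :
    ∑ f, lenOf r u (c.ri f) ≤ (bs.map Prod.snd).sum * h := by
  classical
  set I := Finset.univ.image c.ri with hI
  set s : Finset (ι × ℤ) := I.biUnion fun i =>
    (Finset.range (lenOf r u i)).image fun q : ℕ => (i, (q : ℤ)) with hs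
  have h1 : ∑ f, lenOf r u (c.ri f) =
      ∑ x ∈ s, (Finset.univ.filter fun f => c.ri f = x.1).card := by
    rw [hs, Finset.sum_biUnion]
    · have : ∀ i ∈ I, ∑ x ∈ (Finset.range (lenOf r u i)).image (fun q : ℕ => (i, (q : ℤ))),
          (Finset.univ.filter fun f => c.ri f = x.1).card =
          ∑ f ∈ Finset.univ.filter (fun f => c.ri f = i), lenOf r u (c.ri f) := by
        intro i _
        rw [Finset.sum_image (by intro a _ b _ hab; simpa using hab)]
        have e : ∑ f ∈ Finset.univ.filter (fun f => c.ri f = i), lenOf r u (c.ri f) =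
            ∑ f ∈ Finset.univ.filter (fun f => c.ri f = i), lenOf r u i := by
          refine Finset.sum_congr rfl fun f hf => ?_
          have := (Finset.mem_filter.1 hf).2
          rw [this]
        rw [e, Finset.sum_const, smul_eq_mul, mul_comm]
        refine (Finset.sum_const (Finset.univ.filter fun f => c.ri f = i).card).trans ?_
        rw [Finset.card_range, smul_eq_mul]
      rw [Finset.sum_congr rfl this, Finset.sum_fiberwise_of_maps_to]
      intro f _
      exact Finset.mem_image_of_mem _ (Finset.mem_univ f)
    · intro i _ j _ hij
      rw [Function.onFun, Finset.disjoint_left]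
      intro x hx hx'
      obtain ⟨_, _, rfl⟩ := Finset.mem_image.1 hx
      obtain ⟨_, _, e⟩ := Finset.mem_image.1 hx'
      exact hij (congrArg Prod.fst e).symm
  rw [h1]
  calc _ ≤ ∑ x ∈ s, (bs.map fun b => b.1.area (sepWt {P | c.mark r u h P = some x})).sum := by
        refine Finset.sum_le_sum fun x hx => ?_
        rw [hs, Finset.mem_biUnion] at hx
        obtain ⟨i, _, hx⟩ := hx
        obtain ⟨q, hq, rfl⟩ := Finset.mem_image.1 hx
        refine hflip _ i q (by omega) (by have := Finset.mem_range.1 hq; omega) ?_ ?_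
        · intro f t _ _
          simp [mark_face]
        · intro a t _
          simp [mark_const a (ha a)]
    _ = (bs.map fun b => ∑ x ∈ s, b.1.area (sepWt {P | c.mark r u h P = some x})).sum := by
        clear hv hflip
        induction bs with
        | nil => simp
        | cons b bs ih => simp [Finset.sum_add_distrib, ih]
    _ ≤ (bs.map fun b => b.2 * h).sum := by
        refine List.sum_le_sum fun b hb => ?_
        refine le_trans ?_ (markCost_band_le hS (hv b hb).1 (hv b hb).2)
        simp only [Band.area]
        rw [Finset.sum_comm]
        exact Finset.sum_le_sum fun k _ => sum_sepWt_le _ s _ _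
    _ = _ := by rw [List.sum_map_mul_right]

end Cfg

end Marks

section Elimination

variable {α T : Type*}

/-- Two positions identified by a band. -/
def Adj (bs : List (Band T)) (P Q : T × ℤ) : Prop :=
  ∃ b ∈ bs, ∃ k < b.L, P = b.cp k ∧ Q = b.cq k

/-- The equivalence relation generated by the bands. -/
def Conn (bs : List (Band T)) : T × ℤ → T × ℤ → Prop := Relation.EqvGen (Adj bs)

theorem Conn.refl {bs : List (Band T)} (P : T × ℤ) : Conn bs P P := Relation.EqvGen.refl P

theorem Conn.symm {bs : List (Band T)} {P Q : T × ℤ} (h : Conn bs P Q) : Conn bs Q P :=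
  Relation.EqvGen.symm _ _ h

theorem Conn.trans {bs : List (Band T)} {P Q R : T × ℤ} (h : Conn bs P Q) (h' : Conn bs Q R) :
    Conn bs P R := Relation.EqvGen.trans _ _ _ h h'

theorem Conn.of_mem {bs : List (Band T)} {b : Band T} (hb : b ∈ bs) {k : ℕ} (hk : k < b.L) :
    Conn bs (b.cp k) (b.cq k) := Relation.EqvGen.rel _ _ ⟨b, hb, k, hk, rfl, rfl⟩

theorem Conn.map {bs bs' : List (Band T)} (ρ : T × ℤ → T × ℤ)
    (H : ∀ b ∈ bs, ∀ k < b.L, Conn bs' (ρ (b.cp k)) (ρ (b.cq k))) {P Q : T × ℤ}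
    (h : Conn bs P Q) : Conn bs' (ρ P) (ρ Q) := by
  induction h with
  | rel P Q h =>
    obtain ⟨b, hb, k, hk, rfl, rfl⟩ := h
    exact H b hb k hk
  | refl P => exact .refl _
  | symm P Q _ ih => exact ih.symm
  | trans P Q R _ _ ih ih' => exact ih.trans ih'

theorem Conn.mono {bs bs' : List (Band T)} (H : ∀ b ∈ bs, ∀ k < b.L, Conn bs' (b.cp k) (b.cq k))
    {P Q : T × ℤ} (h : Conn bs P Q) : Conn bs' P Q := Conn.map id H h

namespace Band

/-- The band with its two sides exchanged. -/
def swap (b : Band T) : Band T := ⟨b.Q, b.E, b.P, b.D, b.L⟩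

/-- The band read from its other end. -/
def flip (b : Band T) : Band T :=
  ⟨mv b.P b.D ((b.L : ℤ) - 1), !b.D, mv b.Q b.E ((b.L : ℤ) - 1), !b.E, b.L⟩

theorem cp_flip (b : Band T) {k : ℕ} (hk : k < b.L) : b.flip.cp k = b.cp (b.L - 1 - k) := by
  simp only [cp, flip, mv_not, mv_mv]
  congr 1
  omega

theorem cq_flip (b : Band T) {k : ℕ} (hk : k < b.L) : b.flip.cq k = b.cq (b.L - 1 - k) := by
  simp only [cq, flip, mv_not, mv_mv]
  congr 1
  omega

theorem Valid.swap {lab : T × ℤ → α × Bool} {V : T × ℤ → Prop} {b : Band T}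
    (h : b.Valid lab V) : b.swap.Valid lab V :=
  fun k hk => ⟨(h k hk).2.1, (h k hk).1, (h k hk).2.2.symm⟩

theorem Valid.flip {lab : T × ℤ → α × Bool} {V : T × ℤ → Prop} {b : Band T}
    (h : b.Valid lab V) : b.flip.Valid lab V := by
  intro k hk
  have hk : k < b.L := hk
  rw [cp_flip b hk, cq_flip b hk]
  obtain ⟨h1, h2, h3⟩ := h (b.L - 1 - k) (by omega)
  exact ⟨h1, h2, by simp only [Band.flip, sgn_not, h3]⟩

/-- The band starts at `p`, reads upwards, and its second side avoids `p`. -/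
def StartsAt (p : T × ℤ) (b : Band T) : Prop :=
  b.P = p ∧ b.D = true ∧ 0 < b.L ∧ ∀ k < b.L, b.cq k ≠ p

/-- The band does not meet `p`. -/
def Avoids (p : T × ℤ) (b : Band T) : Prop := ∀ k < b.L, b.cp k ≠ p ∧ b.cq k ≠ p

theorem cp_eq_bot {V : T × ℤ → Prop} {p : T × ℤ} (hp : ¬ V (mv p true (-1))) {b : Band T}
    (hV : ∀ k < b.L, V (b.cp k)) {k : ℕ} (hk : k < b.L) (h : b.cp k = p) :
    (b.D = true ∧ k = 0) ∨ (b.D = false ∧ k = b.L - 1) := by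
  have e : ∀ k' : ℕ, b.cp k' = mv p b.D ((k' : ℤ) - k) := by
    intro k'; rw [← h, ← Cfg.cp_add]
  cases hD : b.D
  · right
    refine ⟨rfl, ?_⟩
    by_contra hne
    have := hV (k + 1) (by omega)
    rw [e, hD, ← Bool.not_true, mv_not] at this
    apply hp
    convert this using 2
    push_cast
    ring
  · left
    refine ⟨rfl, ?_⟩
    by_contra hne
    have := hV (k - 1) (by omega)
    rw [e, hD] at this
    apply hp
    convert this using 2
    omega

theorem normalize_of_start {lab : T × ℤ → α × Bool} {V : T × ℤ → Prop} {p : T × ℤ}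
    (hp : ¬ V (mv p true (-1)))
    (hl : ∀ P, V P → V (mv P true 1) → lab (mv P true 1) ≠ linv (lab P))
    {b : Band T} (hb : b.Valid lab V) (h1 : b.P = p) (h2 : b.D = true) (h3 : 0 < b.L) :
    b.StartsAt p ∨ ∀ k < b.L, b.cp k = b.cq k := by
  by_cases hA : ∀ k < b.L, b.cq k ≠ p
  · exact Or.inl ⟨h1, h2, h3, hA⟩
  · push Not at hA
    obtain ⟨k, hk, hkp⟩ := hA
    right
    rcases cp_eq_bot hp (b := b.swap) (fun k hk => (hb k hk).2.1) hk hkp with ⟨hE, hk0⟩ | ⟨hE, hkL⟩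
    · have hE : b.E = true := hE
      subst hk0
      have : b.Q = p := by simpa [cq] using hkp
      intro k _
      rw [cp, cq, h1, h2, hE, this]
    · exfalso
      have hE : b.E = false := hE
      have hkL : k = b.L - 1 := hkL
      have ecp : ∀ j : ℕ, b.cp j = mv p true j := fun j => by rw [cp, h1, h2]
      have ecq : ∀ j < b.L, b.cq j = mv p true ((b.L - 1 - j : ℕ) : ℤ) := by
        intro j hj
        rw [Cfg.cq_add b k j, hkp, hE, ← Bool.not_true, mv_not]
        congr 1
        omega
      have hlet : ∀ j < b.L,
          lab (mv p true j) = linv (lab (mv p true ((b.L - 1 - j : ℕ) : ℤ))) := by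
        intro j hj
        have := (hb j hj).2.2
        rwa [ecp, ecq j hj, h2, hE, sgn_true, sgn_false] at this
      rcases Nat.even_or_odd' b.L with ⟨m, hm | hm⟩
      · have hj := hlet (m - 1) (by omega)
        rw [show b.L - 1 - (m - 1) = m by omega] at hj
        refine hl (mv p true ((m - 1 : ℕ) : ℤ)) ?_ ?_ ?_
        · rw [← ecp]; exact (hb _ (by omega)).1
        · rw [mv_mv, show ((m - 1 : ℕ) : ℤ) + 1 = (m : ℕ) by omega, ← ecp]
          exact (hb _ (by omega)).1
        · rw [mv_mv, show ((m - 1 : ℕ) : ℤ) + 1 = (m : ℕ) by omega, hj, linv_linv]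
      · have hj := hlet m (by omega)
        rw [show b.L - 1 - m = m by omega] at hj
        exact linv_ne _ hj.symm

/-- A band meeting `p` can be made to start at `p`. -/
theorem exists_normalize {lab : T × ℤ → α × Bool} {V : T × ℤ → Prop} {p : T × ℤ}
    (hp : ¬ V (mv p true (-1)))
    (hl : ∀ P, V P → V (mv P true 1) → lab (mv P true 1) ≠ linv (lab P))
    {b : Band T} (hb : b.Valid lab V) (hA : ¬ b.Avoids p) :
    (∀ k < b.L, b.cp k = b.cq k) ∨ ∃ b' : Band T, b'.StartsAt p ∧ b'.Valid lab V ∧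
      ∀ k < b.L, Conn [b'] (b.cp k) (b.cq k) := by
  have key : ∀ b : Band T, b.Valid lab V → (∃ k < b.L, b.cp k = p) →
      (∀ k < b.L, b.cp k = b.cq k) ∨ ∃ b' : Band T, b'.StartsAt p ∧ b'.Valid lab V ∧
        ∀ k < b.L, Conn [b'] (b.cp k) (b.cq k) := by
    rintro b hb ⟨k, hk, hkp⟩
    rcases cp_eq_bot hp (fun k hk => (hb k hk).1) hk hkp with ⟨hD, hk0⟩ | ⟨hD, hkL⟩
    · subst hk0
      have hP : b.P = p := by simpa [cp] using hkp
      rcases normalize_of_start hp hl hb hP hD (by omega) with h | h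
      · exact Or.inr ⟨b, h, hb, fun k hk => .of_mem (by simp) hk⟩
      · exact Or.inl h
    · have hP : b.flip.P = p := by
        have := cp_flip b (k := 0) (by omega)
        rw [Nat.sub_zero, ← hkL, hkp] at this
        simpa [cp] using this
      have hcell : ∀ k < b.L, b.cp k = b.flip.cp (b.L - 1 - k) ∧
          b.cq k = b.flip.cq (b.L - 1 - k) := by
        intro k hk
        rw [cp_flip b (by omega), cq_flip b (by omega)]
        rw [show b.L - 1 - (b.L - 1 - k) = k by omega]
        exact ⟨rfl, rfl⟩
      have hL : b.flip.L = b.L := rfl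
      rcases normalize_of_start hp hl hb.flip hP (by simp [Band.flip, hD])
        (by rw [hL]; omega) with h | h
      · refine Or.inr ⟨b.flip, h, hb.flip, fun k hk => ?_⟩
        rw [(hcell k hk).1, (hcell k hk).2]
        exact .of_mem (by simp) (by rw [hL]; omega)
      · refine Or.inl fun k hk => ?_
        rw [(hcell k hk).1, (hcell k hk).2]
        exact h _ (by rw [hL]; omega)
  by_cases h : ∃ k < b.L, b.cp k = p
  · exact key b hb h
  · have h' : ∃ k < b.swap.L, b.swap.cp k = p := by
      simp only [Avoids] at hA
      push Not at hA h
      obtain ⟨k, hk, hk'⟩ := hA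
      exact ⟨k, hk, hk' (h k hk)⟩
    rcases key b.swap hb.swap h' with h | ⟨b', h1, h2, h3⟩
    · exact Or.inl fun k hk => (h k hk).symm
    · exact Or.inr ⟨b', h1, h2, fun k hk => (h3 k hk).symm⟩

end Band

theorem Conn.subset {bs bs' : List (Band T)} (H : bs ⊆ bs') {P Q : T × ℤ} (h : Conn bs P Q) :
    Conn bs' P Q := h.mono fun _ hb _ hk => .of_mem (H hb) hk

theorem exists_normalized_list {lab : T × ℤ → α × Bool} {V : T × ℤ → Prop} {p : T × ℤ}
    (hp : ¬ V (mv p true (-1)))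
    (hl : ∀ P, V P → V (mv P true 1) → lab (mv P true 1) ≠ linv (lab P))
    (bs : List (Band T)) (hb : ∀ b ∈ bs, b.Valid lab V) :
    ∃ N S : List (Band T), N.length + S.length ≤ bs.length ∧
      (∀ b ∈ N, b.Valid lab V ∧ b.Avoids p) ∧ (∀ b ∈ S, b.Valid lab V ∧ b.StartsAt p) ∧
      ∀ b ∈ bs, ∀ k < b.L, Conn (N ++ S) (b.cp k) (b.cq k) := by
  induction bs with
  | nil => exact ⟨[], [], by simp⟩
  | cons b bs ih =>
    obtain ⟨N, S, h1, h2, h3, h4⟩ := ih fun b' h => hb b' (List.mem_cons_of_mem _ h)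
    have hb0 := hb b List.mem_cons_self
    by_cases hA : b.Avoids p
    · refine ⟨b :: N, S, by simp; omega, ?_, h3, ?_⟩
      · intro b' hb'
        rcases List.mem_cons.1 hb' with rfl | hb'
        exacts [⟨hb0, hA⟩, h2 b' hb']
      · intro b' hb' k hk
        rcases List.mem_cons.1 hb' with rfl | hb'
        · exact .of_mem (by simp) hk
        · exact (h4 b' hb' k hk).subset (by simp)
    · rcases Band.exists_normalize hp hl hb0 hA with h | ⟨b1, g1, g2, g3⟩
      · refine ⟨N, S, by simp; omega, h2, h3, ?_⟩
        intro b' hb' k hk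
        rcases List.mem_cons.1 hb' with rfl | hb'
        · rw [h k hk]; exact .refl _
        · exact h4 b' hb' k hk
      · refine ⟨N, b1 :: S, by simp; omega, h2, ?_, ?_⟩
        · intro b' hb'
          rcases List.mem_cons.1 hb' with rfl | hb'
          exacts [⟨g2, g1⟩, h3 b' hb']
        · intro b' hb' k hk
          rcases List.mem_cons.1 hb' with rfl | hb'
          · exact (g3 k hk).subset (by simp)
          · refine (h4 b' hb' k hk).subset ?_
            intro x hx
            simp only [List.mem_append, List.mem_cons] at hx ⊢
            tauto

/-- A single position at the bottom of its track can be eliminated. -/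
theorem exists_eliminate_one {lab : T × ℤ → α × Bool} {V : T × ℤ → Prop} {p : T × ℤ}
    (hp : ¬ V (mv p true (-1)))
    (hl : ∀ P, V P → V (mv P true 1) → lab (mv P true 1) ≠ linv (lab P))
    (bs : List (Band T)) (hb : ∀ b ∈ bs, b.Valid lab V) :
    ∃ bs' : List (Band T), bs'.length ≤ bs.length ∧
      (∀ b ∈ bs', b.Valid lab (fun P => V P ∧ P ≠ p)) ∧
      ∀ P Q, P ≠ p → Q ≠ p → Conn bs P Q → Conn bs' P Q := by
  classical
  obtain ⟨N, S, h1, h2, h3, h4⟩ := exists_normalized_list hp hl bs hb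
  have hN : ∀ b ∈ N, b.Valid lab (fun P => V P ∧ P ≠ p) := fun b hb k hk =>
    ⟨⟨((h2 b hb).1 k hk).1, ((h2 b hb).2 k hk).1⟩,
      ⟨((h2 b hb).1 k hk).2.1, ((h2 b hb).2 k hk).2⟩, ((h2 b hb).1 k hk).2.2⟩
  rcases S.eq_nil_or_concat' with rfl | ⟨_, _, hne⟩
  · exact ⟨N, by simpa using h1, hN, fun P Q _ _ h => h.mono (by simpa using h4)⟩
  have hne : S ≠ [] := by rw [hne]; simp
  obtain ⟨b0, hb0, hmax⟩ := Set.exists_max_image {b | b ∈ S} Band.L S.finite_toSet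
    ⟨_, List.head_mem hne⟩
  obtain ⟨l1, l2, rfl⟩ := List.append_of_mem hb0
  obtain ⟨v0, s0, d0, L0, q0⟩ := h3 b0 hb0
  set o := l1 ++ l2 with ho
  have hoS : ∀ b ∈ o, b ∈ l1 ++ b0 :: l2 := by
    intro b hb
    simp only [ho, List.mem_append, List.mem_cons] at hb ⊢
    tauto
  set c0 : Band T := ⟨mv p true 1, true, mv b0.Q b0.E 1, b0.E, b0.L - 1⟩ with hc0
  set g : Band T → Band T := fun b => ⟨b0.Q, b0.E, b.Q, b.E, b.L⟩ with hg
  have ec : ∀ k, c0.cp k = mv p true ((k + 1 : ℕ) : ℤ) ∧ c0.cq k = b0.cq (k + 1) := by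
    intro k
    simp only [hc0, Band.cp, Band.cq, mv_mv]
    constructor <;> congr 1 <;> push_cast <;> ring
  have es : ∀ b ∈ l1 ++ b0 :: l2, ∀ k, b.cp k = mv p true k := by
    intro b hb k
    obtain ⟨-, s, d, -⟩ := h3 b hb
    rw [Band.cp, s, d]
  have hpk : ∀ k : ℕ, mv p true ((k + 1 : ℕ) : ℤ) ≠ p := by
    intro k h
    have := congrArg Prod.snd h
    simp only [mv, mz, if_true] at this
    omega
  refine ⟨N ++ c0 :: o.map g, ?_, ?_, ?_⟩
  · have : o.length + 1 = (l1 ++ b0 :: l2).length := by simp [ho]; omega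
    simp only [List.length_append, List.length_cons, List.length_map] at h1 ⊢ this
    omega
  · intro b hb
    rcases List.mem_append.1 hb with hb | hb
    · exact hN b hb
    rcases List.mem_cons.1 hb with rfl | hb
    · intro k hk
      have hk : k + 1 < b0.L := by simp only [hc0] at hk; omega
      obtain ⟨x1, x2, x3⟩ := v0 (k + 1) hk
      rw [es b0 hb0, d0] at x3
      rw [es b0 hb0] at x1
      rw [(ec k).1, (ec k).2]
      exact ⟨⟨x1, hpk k⟩, ⟨x2, q0 _ hk⟩, x3⟩
    · obtain ⟨b', hb', rfl⟩ := List.mem_map.1 hb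
      intro k hk
      have hk : k < b'.L := hk
      have hk0 : k < b0.L := lt_of_lt_of_le hk (hmax b' (hoS b' hb'))
      obtain ⟨v1, s1, d1, L1, q1⟩ := h3 b' (hoS b' hb')
      obtain ⟨x1, x2, x3⟩ := v0 k hk0
      obtain ⟨y1, y2, y3⟩ := v1 k hk
      refine ⟨⟨x2, q0 k hk0⟩, ⟨y2, q1 k hk⟩, ?_⟩
      rw [es b0 hb0, d0] at x3
      rw [es b' (hoS b' hb'), d1] at y3
      exact x3.symm.trans y3
  · intro P Q hP hQ h
    have h := h.mono h4
    let ρ : T × ℤ → T × ℤ := fun R => if R = p then b0.Q else R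
    have hρ : ∀ R, R ≠ p → ρ R = R := fun R hR => if_neg hR
    have hρp : ρ p = b0.Q := if_pos rfl
    have hc0 : ∀ k, k + 1 < b0.L → Conn (N ++ c0 :: o.map g) (mv p true ((k + 1 : ℕ) : ℤ))
        (b0.cq (k + 1)) := by
      intro k hk
      rw [← (ec k).1, ← (ec k).2]
      exact .of_mem (by simp) (by simp only [hc0]; omega)
    have := Conn.map (bs' := N ++ c0 :: o.map g) ρ ?_ h
    · rwa [hρ P hP, hρ Q hQ] at this
    · intro b hb k hk
      rcases List.mem_append.1 hb with hb | hb
      · rw [hρ _ ((h2 b hb).2 k hk).1, hρ _ ((h2 b hb).2 k hk).2]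
        exact .of_mem (by simp [hb]) hk
      · rw [hρ _ ((h3 b hb).2.2.2.2 k hk), es b hb]
        have hk0 : k < b0.L := lt_of_lt_of_le hk (hmax b hb)
        have hbase : Conn (N ++ c0 :: o.map g) (ρ (mv p true k)) (b0.cq k) := by
          rcases k with _ | k
          · simp only [Nat.cast_zero, mv_zero, hρp, Band.cq]
            exact .refl _
          · rw [hρ _ (hpk k)]
            exact hc0 k hk0
        by_cases hbb : b = b0
        · subst hbb; exact hbase
        · refine hbase.trans ?_
          have hbo : b ∈ o := by
            simp only [List.mem_append, List.mem_cons, ho] at hb ⊢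
            tauto
          have hm : g b ∈ N ++ c0 :: o.map g :=
            List.mem_append_right _ (List.mem_cons_of_mem _ (List.mem_map_of_mem hbo))
          exact Conn.of_mem (b := g b) hm hk

/-- Finitely many positions, filling tracks of their own, can be eliminated. -/
theorem exists_eliminate {lab : T × ℤ → α × Bool} {V : T × ℤ → Prop}
    (hl : ∀ P, V P → V (mv P true 1) → lab (mv P true 1) ≠ linv (lab P))
    (E : Finset (T × ℤ)) (hE : ∀ P ∈ E, ∀ Q, V Q → Q.1 = P.1 → Q ∈ E)
    (bs : List (Band T)) (hb : ∀ b ∈ bs, b.Valid lab V) :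
    ∃ bs' : List (Band T), bs'.length ≤ bs.length ∧
      (∀ b ∈ bs', b.Valid lab (fun P => V P ∧ P ∉ E)) ∧
      ∀ P Q, P ∉ E → Q ∉ E → Conn bs P Q → Conn bs' P Q := by
  classical
  induction hn : E.card generalizing E V bs with
  | zero =>
    obtain rfl := Finset.card_eq_zero.1 hn
    exact ⟨bs, le_rfl, by simpa using hb, fun P Q _ _ h => h⟩
  | succ n ih =>
    obtain ⟨p, hpE, hpmin⟩ := Finset.exists_min_image E Prod.snd
      (Finset.card_pos.1 (by omega))
    have hp : ¬ V (mv p true (-1)) := by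
      intro h
      have := hpmin _ (hE p hpE _ h rfl)
      simp only [mv, mz, if_true] at this
      omega
    obtain ⟨bs1, h1, h2, h3⟩ := exists_eliminate_one hp hl bs hb
    obtain ⟨bs2, g1, g2, g3⟩ := ih (V := fun P => V P ∧ P ≠ p)
      (fun P hP hP' => hl P hP.1 hP'.1) (E.erase p)
      (fun P hP Q hQ hQP => Finset.mem_erase.2
        ⟨hQ.2, hE P (Finset.mem_of_mem_erase hP) Q hQ.1 hQP⟩) bs1 h2
      (by rw [Finset.card_erase_of_mem hpE, hn]; rfl)
    refine ⟨bs2, g1.trans h1, ?_, ?_⟩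
    · intro b hb k hk
      obtain ⟨⟨⟨x1, x2⟩, x3⟩, ⟨⟨y1, y2⟩, y3⟩, z⟩ := g2 b hb k hk
      rw [Finset.mem_erase, not_and] at x3 y3
      exact ⟨⟨x1, x3 x2⟩, ⟨y1, y3 y2⟩, z⟩
    · intro P Q hP hQ h
      refine g3 P Q (fun h => hP (Finset.mem_of_mem_erase h))
        (fun h => hQ (Finset.mem_of_mem_erase h)) (h3 P Q ?_ ?_ h)
      · rintro rfl; exact hP hpE
      · rintro rfl; exact hQ hpE

end Elimination

section Counting

/-- Counting sequences whose terms have few possibilities given the earlier ones. -/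
theorem card_le_prod_of_seq {β : Type*} [DecidableEq β] [Inhabited β] (W : Finset (ℕ → β)) (P : ℕ)
    (c : ℕ → ℕ) (hinj : ∀ f ∈ W, ∀ g ∈ W, (∀ s < P, f s = g s) → f = g)
    (hc : ∀ s < P, ∀ f ∈ W, ∃ A : Finset β, A.card ≤ c s ∧
      ∀ g ∈ W, (∀ t < s, g t = f t) → g s ∈ A) :
    W.card ≤ ∏ s ∈ Finset.range P, c s := by
  classical
  let res : ℕ → (ℕ → β) → ℕ → β := fun s f t => if t < s then f t else default
  have key : ∀ s ≤ P, (W.image (res s)).card ≤ ∏ t ∈ Finset.range s, c t := by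
    intro s
    induction s with
    | zero =>
      intro _
      simp only [Finset.range_zero, Finset.prod_empty]
      refine Finset.card_le_one.2 fun f hf g hg => ?_
      obtain ⟨f, -, rfl⟩ := Finset.mem_image.1 hf
      obtain ⟨g, -, rfl⟩ := Finset.mem_image.1 hg
      rfl
    | succ s ih =>
      intro hs
      rw [Finset.prod_range_succ, mul_comm]
      have e : (W.image (res (s + 1))).image (res s) = W.image (res s) := by
        rw [Finset.image_image]
        refine Finset.image_congr fun f _ => ?_
        funext t
        simp only [res, Function.comp]
        split_ifs <;> first | rfl | omega
      refine le_trans ?_ (Nat.mul_le_mul_left _ (ih (by omega)))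
      rw [← e]
      refine Finset.card_le_mul_card_image _ _ fun p hp => ?_
      rw [e] at hp
      obtain ⟨f, hf, rfl⟩ := Finset.mem_image.1 hp
      obtain ⟨A, hA, hfA⟩ := hc s (by omega) f hf
      refine le_trans (Finset.card_le_card_of_injOn (fun g => g s) (t := A) ?_ ?_) hA
      · intro g hg
        simp only [Finset.coe_filter, Finset.mem_image, Set.mem_ofPred_eq] at hg
        obtain ⟨⟨g, hg, rfl⟩, h⟩ := hg
        have : res (s + 1) g s = g s := by simp [res]
        simp only [this]
        refine hfA g hg fun t ht => ?_
        have := congrFun h t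
        simpa [res, ht, ht.le] using this
      · intro g hg g' hg' h
        simp only [Finset.coe_filter, Finset.mem_image, Set.mem_ofPred_eq] at hg hg'
        obtain ⟨⟨g, hg, rfl⟩, e1⟩ := hg
        obtain ⟨⟨g', hg', rfl⟩, e2⟩ := hg'
        funext t
        rcases lt_trichotomy t s with ht | rfl | ht
        · have := (congrFun e1 t).trans (congrFun e2 t).symm
          simpa only [res, if_pos ht, if_pos (Nat.lt_succ_of_lt ht)] using this
        · exact h
        · simp [res, show ¬ t < s + 1 by omega]
  rw [← Finset.card_image_of_injOn (s := W) (f := res P)]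
  · exact key P le_rfl
  · intro f hf g hg h
    refine hinj f hf g hg fun s hs => ?_
    simpa [res, hs] using congrFun h s

variable {n : ℕ}

/-- In all the sequences of `W`, the letter at `s` is constant, or it is the letter at some other
place, possibly inverted. -/
def Tied {α I : Type*} (W : Set (I → α × Bool)) (s : I) : Prop :=
  (∃ t ≠ s, (∀ f ∈ W, f s = f t) ∨ ∀ f ∈ W, f s = linv (f t)) ∨ ∃ c, ∀ f ∈ W, f s = c

theorem Tied.comp {α I I' : Type*} {W : Set (I → α × Bool)} (e : I ≃ I') {s : I} (h : Tied W s) :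
    Tied ((fun f => f ∘ e.symm) '' W) (e s) := by
  rcases h with ⟨t, ht, h | h⟩ | ⟨c, h⟩
  · refine Or.inl ⟨e t, e.injective.ne ht, Or.inl ?_⟩
    rintro _ ⟨f, hf, rfl⟩
    simpa using h f hf
  · refine Or.inl ⟨e t, e.injective.ne ht, Or.inr ?_⟩
    rintro _ ⟨f, hf, rfl⟩
    simpa using h f hf
  · refine Or.inr ⟨c, ?_⟩
    rintro _ ⟨f, hf, rfl⟩
    simpa using h f hf

/-- Among the tied places, at least half are determined by earlier places. -/
theorem exists_determined {α : Type*} {P : ℕ} (W : Set (Fin P → α × Bool)) (Z : Finset (Fin P))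
    (hZ : ∀ s ∈ Z, Tied W s) :
    ∃ D : Finset (Fin P), Z.card ≤ 2 * D.card ∧
      ∀ s ∈ D, ∀ f ∈ W, ∀ g ∈ W, (∀ t < s, f t = g t) → f s = g s := by
  classical
  let E : Fin P → Fin P → Prop := fun s t => (∀ f ∈ W, f s = f t) ∨ ∀ f ∈ W, f s = linv (f t)
  have Esymm : ∀ s t, E s t → E t s := by
    rintro s t (h | h)
    · exact Or.inl fun f hf => (h f hf).symm
    · exact Or.inr fun f hf => by rw [h f hf, linv_linv]
  have Etrans : ∀ s t v, E s t → E t v → E s v := by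
    rintro s t v (h | h) (h' | h')
    · exact Or.inl fun f hf => by rw [h f hf, h' f hf]
    · exact Or.inr fun f hf => by rw [h f hf, h' f hf]
    · exact Or.inr fun f hf => by rw [h f hf, h' f hf]
    · exact Or.inl fun f hf => by rw [h f hf, h' f hf, linv_linv]
  let D : Finset (Fin P) := Finset.univ.filter fun s =>
    (∃ t < s, E s t) ∨ ∃ c, ∀ f ∈ W, f s = c
  refine ⟨D, ?_, ?_⟩
  · have hy : ∀ s ∈ Z \ D, ∃ t, s < t ∧ E s t := by
      intro s hs
      rw [Finset.mem_sdiff] at hs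
      simp only [D, Finset.mem_filter, Finset.mem_univ, true_and, not_or] at hs
      rcases hZ s hs.1 with ⟨t, ht, h⟩ | h
      · refine ⟨t, lt_of_le_of_ne (not_lt.1 fun hl => hs.2.1 ⟨t, hl, h⟩) ht.symm, h⟩
      · exact absurd h hs.2.2
    choose! y hy1 hy2 using hy
    have h1 : (Z \ D).card ≤ D.card := by
      refine Finset.card_le_card_of_injOn y ?_ ?_
      · intro s hs
        simp only [D, Finset.coe_filter, Finset.mem_univ, true_and, Set.mem_ofPred_eq]
        exact Or.inl ⟨s, hy1 s hs, Esymm _ _ (hy2 s hs)⟩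
      · intro s hs s' hs' h
        have hE : E s s' := Etrans _ _ _ (hy2 s hs) (h ▸ Esymm _ _ (hy2 s' hs'))
        have a1 := (Finset.mem_sdiff.1 hs).2
        have a2 := (Finset.mem_sdiff.1 hs').2
        simp only [D, Finset.mem_filter, Finset.mem_univ, true_and, not_or] at a1 a2
        rcases lt_trichotomy s s' with hl | hl | hl
        · exact absurd ⟨s, hl, Esymm _ _ hE⟩ a2.1
        · exact hl
        · exact absurd ⟨s', hl, hE⟩ a1.1
    have h2 := Finset.card_sdiff_add_card_inter Z D
    have h3 := Finset.card_le_card (Finset.inter_subset_right (s₁ := Z) (s₂ := D))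
    omega
  · intro s hs f hf g hg h
    simp only [D, Finset.mem_filter, Finset.mem_univ, true_and] at hs
    rcases hs with ⟨t, ht, hE | hE⟩ | ⟨c, hc⟩
    · rw [hE f hf, hE g hg, h t ht]
    · rw [hE f hf, hE g hg, h t ht]
    · rw [hc f hf, hc g hg]

/-- Letter functions of reduced words, with many tied places, are few. -/
theorem card_mul_le_of_tied {N ℓ : ℕ} (hn : 1 ≤ n) (W : Finset (Fin N × Fin ℓ → Fin n × Bool))
    (hred : ∀ f ∈ W, ∀ i, ∀ t : ℕ, ∀ h : t + 1 < ℓ,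
      f (i, ⟨t + 1, h⟩) ≠ linv (f (i, ⟨t, by omega⟩)))
    (Z : Finset (Fin N × Fin ℓ)) (hZ : ∀ s ∈ Z, Tied (W : Set (Fin N × Fin ℓ → Fin n × Bool)) s) :
    ∃ D : ℕ, Z.card ≤ 2 * D ∧
      W.card * (2 * n - 1) ^ D ≤ (2 * n) ^ N * (2 * n - 1) ^ (N * ℓ) := by
  classical
  have : NeZero n := ⟨by omega⟩
  let e : Fin N × Fin ℓ ≃ Fin (N * ℓ) := finProdFinEquiv
  obtain ⟨D, hD1, hD2⟩ := exists_determined ((fun f => f ∘ e.symm) '' (W : Set _))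
    (Z.map e.toEmbedding) (by
      intro s hs
      obtain ⟨s, hs, rfl⟩ := Finset.mem_map.1 hs
      exact (hZ s (by simpa using hs)).comp e)
  rw [Finset.card_map] at hD1
  refine ⟨D.card, hD1, ?_⟩
  let ext : (Fin N × Fin ℓ → Fin n × Bool) → ℕ → Fin n × Bool := fun f s =>
    if h : s < N * ℓ then f (e.symm ⟨s, h⟩) else default
  have ext_lt : ∀ f (s : Fin (N * ℓ)), ext f s = f (e.symm s) := fun f s => by
    simp [ext]
  have ext_inj : Function.Injective ext := by
    intro f g h
    funext s
    have := congrFun h (e s)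
    simpa [ext_lt] using this
  let c : ℕ → ℕ := fun s => (if s % ℓ = 0 then 2 * n else 1) *
    (if ∃ s' ∈ D, (s' : ℕ) = s then 1 else 2 * n - 1)
  have div_lt : ∀ s < N * ℓ, 0 < ℓ := fun s hs => Nat.pos_of_ne_zero (by rintro rfl; omega)
  have he : ∀ (s : ℕ) (hs : s < N * ℓ),
      e.symm ⟨s, hs⟩ = (⟨s / ℓ, Nat.div_lt_of_lt_mul (by rwa [mul_comm])⟩,
        ⟨s % ℓ, Nat.mod_lt _ (div_lt s hs)⟩) := fun s hs => rfl
  have hcard := card_le_prod_of_seq (W.image ext) (N * ℓ) c ?_ ?_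
  · rw [Finset.card_image_of_injective _ ext_inj, Finset.prod_mul_distrib] at hcard
    have e1 : ∏ s ∈ Finset.range (N * ℓ), (if s % ℓ = 0 then 2 * n else 1) ≤ (2 * n) ^ N := by
      rw [Finset.prod_ite, Finset.prod_const_one, mul_one, Finset.prod_const]
      refine Nat.pow_le_pow_right (by omega) ?_
      rw [← Finset.card_range N]
      refine Finset.card_le_card_of_injOn (fun s => s / ℓ) ?_ ?_
      · intro s hs
        simp only [Finset.coe_filter, Finset.mem_range, Set.mem_ofPred_eq, Finset.coe_range,
          Set.mem_Iio] at hs ⊢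
        exact Nat.div_lt_of_lt_mul (by rw [mul_comm]; simpa using hs.1)
      · intro s hs t ht h
        simp only [Finset.coe_filter, Finset.mem_range, Set.mem_ofPred_eq] at hs ht
        have h : s / ℓ = t / ℓ := h
        rw [← Nat.div_add_mod s ℓ, ← Nat.div_add_mod t ℓ, h, hs.2, ht.2]
    have e2 : (∏ s ∈ Finset.range (N * ℓ), (if ∃ s' ∈ D, (s' : ℕ) = s then 1 else 2 * n - 1)) *
        (2 * n - 1) ^ D.card = (2 * n - 1) ^ (N * ℓ) := by
      rw [Finset.prod_ite, Finset.prod_const_one, one_mul, Finset.prod_const, ← pow_add]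
      congr 1
      have h := Finset.card_filter_add_card_filter_not (s := Finset.range (N * ℓ))
        (fun s => ∃ s' ∈ D, (s' : ℕ) = s)
      rw [Finset.card_range] at h
      have h' : ((Finset.range (N * ℓ)).filter fun s => ∃ s' ∈ D, (s' : ℕ) = s) =
          D.map Fin.valEmbedding := by
        ext s
        simp only [Finset.mem_filter, Finset.mem_range, Finset.mem_map, Fin.valEmbedding_apply]
        exact ⟨fun h => h.2, fun ⟨t, ht, h⟩ => ⟨h ▸ t.2, t, ht, h⟩⟩
      rw [h', Finset.card_map] at h
      omega
    calc W.card * (2 * n - 1) ^ D.card ≤ _ := Nat.mul_le_mul_right _ hcard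
      _ ≤ (2 * n) ^ N * ((∏ s ∈ Finset.range (N * ℓ),
          (if ∃ s' ∈ D, (s' : ℕ) = s then 1 else 2 * n - 1)) * (2 * n - 1) ^ D.card) := by
        rw [mul_assoc]
        exact Nat.mul_le_mul_right _ e1
      _ = _ := by rw [e2]
  · intro f hf g hg h
    obtain ⟨f, -, rfl⟩ := Finset.mem_image.1 hf
    obtain ⟨g, -, rfl⟩ := Finset.mem_image.1 hg
    funext s
    by_cases hs : s < N * ℓ
    · exact h s hs
    · simp [ext, hs]
  · intro s hs f hf
    obtain ⟨f, hf', rfl⟩ := Finset.mem_image.1 hf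
    have exts : ∀ g, ext g s = g (e.symm ⟨s, hs⟩) := fun g => ext_lt g ⟨s, hs⟩
    by_cases hsD : ∃ s' ∈ D, (s' : ℕ) = s
    · refine ⟨{ext f s}, ?_, ?_⟩
      · simp only [c, if_pos hsD, Finset.card_singleton, mul_one]
        split_ifs <;> omega
      · intro g hg h
        obtain ⟨g, hg', rfl⟩ := Finset.mem_image.1 hg
        obtain ⟨s', hs', rfl⟩ := hsD
        rw [Finset.mem_singleton, ext_lt, ext_lt]
        refine hD2 s' hs' _ ⟨g, hg', rfl⟩ _ ⟨f, hf', rfl⟩ fun t ht => ?_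
        have := h t ht
        rwa [ext_lt, ext_lt] at this
    · by_cases h0 : s % ℓ = 0
      · refine ⟨Finset.univ, ?_, fun _ _ _ => Finset.mem_univ _⟩
        simp only [c, if_pos h0, if_neg hsD, Finset.card_univ, Fintype.card_prod, Fintype.card_fin,
          Fintype.card_bool]
        nlinarith [Nat.sub_add_cancel (show 1 ≤ 2 * n by omega)]
      · refine ⟨Finset.univ.erase (linv (ext f (s - 1))), ?_, ?_⟩
        · rw [Finset.card_erase_of_mem (Finset.mem_univ _)]
          simp only [c, if_neg h0, if_neg hsD, Finset.card_univ, Fintype.card_prod,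
            Fintype.card_fin, Fintype.card_bool, one_mul]
          omega
        · intro g hg h
          obtain ⟨g, hg', rfl⟩ := Finset.mem_image.1 hg
          have hs0 : s ≠ 0 := by rintro rfl; simp at h0
          have hl := div_lt s hs
          rw [Finset.mem_erase, ← h (s - 1) (by omega), exts, ext_lt g ⟨s - 1, by omega⟩, he, he]
          refine ⟨?_, Finset.mem_univ _⟩
          have h1 : s = (s - 1) + 1 := by omega
          have hd : s / ℓ = (s - 1) / ℓ := by
            conv_lhs => rw [h1]
            exact Nat.succ_div_of_mod_ne_zero (by rwa [← h1])
          have hm : s % ℓ = (s - 1) % ℓ + 1 := by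
            have e1 := Nat.div_add_mod s ℓ
            have e2 := Nat.div_add_mod (s - 1) ℓ
            rw [hd] at e1
            omega
          have := hred g hg' ⟨(s - 1) / ℓ, Nat.div_lt_of_lt_mul (by rw [mul_comm]; omega)⟩
            ((s - 1) % ℓ) (by rw [← hm]; exact Nat.mod_lt _ hl)
          simp only [hd, hm]
          exact this

end Counting

section Probability

variable {n ℓ : ℕ}

theorem finite_length_toWord (n ℓ : ℕ) :
    {g : FreeGroup (Fin n) | g.toWord.length = ℓ}.Finite :=
  Set.Finite.preimage FreeGroup.toWord_injective.injOn (List.finite_length_eq _ ℓ)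

/-- The elements of length `ℓ` of the free group. -/
noncomputable def wordsOf (n ℓ : ℕ) : Finset (FreeGroup (Fin n)) :=
  (finite_length_toWord n ℓ).toFinset

@[simp] theorem mem_wordsOf {g : FreeGroup (Fin n)} : g ∈ wordsOf n ℓ ↔ g.toWord.length = ℓ := by
  simp [wordsOf]

theorem pow_le_card_wordsOf (hn : 1 ≤ n) (ℓ : ℕ) : (2 * n - 1) ^ ℓ ≤ (wordsOf n ℓ).card := by
  classical
  have : NeZero n := ⟨by omega⟩
  induction ℓ with
  | zero =>
    rw [pow_zero, Nat.one_le_iff_ne_zero, Finset.card_ne_zero]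
    exact ⟨1, by simp⟩
  | succ ℓ ih =>
    refine le_trans ?_ (Finset.mul_card_image_le_card_of_maps_to (s := wordsOf n (ℓ + 1))
      (t := wordsOf n ℓ) (f := fun g => FreeGroup.mk g.toWord.tail) ?_ (2 * n - 1) ?_)
    · rw [pow_succ, mul_comm]
      exact Nat.mul_le_mul_left _ ih
    · intro g hg
      rw [mem_wordsOf] at hg ⊢
      have h : FreeGroup.IsReduced g.toWord.tail :=
        List.IsChain.tail FreeGroup.isReduced_toWord
      rw [FreeGroup.toWord_mk, h.reduce_eq, List.length_tail, hg]
      rfl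
    · intro g hg
      rw [mem_wordsOf] at hg
      let A : Finset (Fin n × Bool) := Finset.univ.erase (linv (g.toWord.getD 0 default))
      have hA : A.card = 2 * n - 1 := by
        rw [Finset.card_erase_of_mem (Finset.mem_univ _)]
        simp [mul_comm]
      have hred : ∀ l ∈ A, FreeGroup.IsReduced (l :: g.toWord) := by
        intro l hl
        rw [isReduced_iff_getElem]
        intro k hk
        rcases k with _ | k
        · simp only [List.length_cons] at hk
          rw [Finset.mem_erase, List.getD_eq_getElem _ _ (by omega)] at hl
          simp only [List.getElem_cons_succ, List.getElem_cons_zero]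
          exact fun h => hl.1 (by rw [h, linv_linv])
        · simp only [List.length_cons] at hk
          exact (isReduced_iff_getElem _).1 (FreeGroup.isReduced_toWord (x := g)) k (by omega)
      rw [← hA]
      refine Finset.card_le_card_of_injOn (fun l => FreeGroup.mk (l :: g.toWord)) ?_ ?_
      · intro l hl
        have h := (hred l hl).reduce_eq
        simp [FreeGroup.toWord_mk, h, hg, FreeGroup.mk_toWord]
      · intro l hl l' hl' h
        have h := congrArg FreeGroup.toWord h
        simp only [FreeGroup.toWord_mk] at h
        rw [(hred l hl).reduce_eq, (hred l' hl').reduce_eq] at h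
        exact (List.cons.inj h).1

theorem relTuples_eq (n ℓ N : ℕ) :
    relTuples n ℓ N = ↑(Fintype.piFinset fun _ : Fin N => wordsOf n ℓ) := by
  ext r
  simp [relTuples]

theorem ncard_relTuples (n ℓ N : ℕ) : (relTuples n ℓ N).ncard = (wordsOf n ℓ).card ^ N := by
  rw [relTuples_eq, Set.ncard_coe_finset, Fintype.card_piFinset]
  simp

theorem finite_relTuples (n ℓ N : ℕ) : (relTuples n ℓ N).Finite := by
  rw [relTuples_eq]
  exact Finset.finite_toSet _

theorem ncard_relTuples_pos (hn : 1 ≤ n) (ℓ N : ℕ) : 0 < (relTuples n ℓ N).ncard := by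
  rw [ncard_relTuples]
  refine Nat.pow_pos (lt_of_lt_of_le ?_ (pow_le_card_wordsOf hn ℓ))
  exact Nat.pow_pos (by omega)

theorem ncard_comp_mem_le {N N' : ℕ} (e : Fin N' → Fin N) (he : Function.Injective e)
    (W : Set (Fin N' → FreeGroup (Fin n))) (hW : W ⊆ relTuples n ℓ N') :
    {r ∈ relTuples n ℓ N | r ∘ e ∈ W}.ncard ≤ W.ncard * (wordsOf n ℓ).card ^ (N - N') := by
  classical
  have hWf : W.Finite := (finite_relTuples n ℓ N').subset hW
  let C : Finset (({j : Fin N // j ∉ Set.range e}) → FreeGroup (Fin n)) :=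
    Fintype.piFinset fun _ => wordsOf n ℓ
  have hC : C.card = (wordsOf n ℓ).card ^ (N - N') := by
    rw [Fintype.card_piFinset, Finset.prod_const, Finset.card_univ, Fintype.card_subtype_compl]
    congr 2
    · simp
    · exact (Fintype.card_congr (Equiv.ofInjective e he).symm).trans (Fintype.card_fin _)
  rw [← hC, Set.ncard_eq_toFinset_card W hWf, ← Finset.card_product, ← Set.ncard_coe_finset]
  refine Set.ncard_le_ncard_of_injOn (fun r => (r ∘ e, fun j => r j.1)) ?_ ?_
    (Finset.finite_toSet _)
  · intro r hr
    simp only [Finset.coe_product, Set.mem_prod, Finset.mem_coe, Set.Finite.mem_toFinset, C,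
      Fintype.mem_piFinset, mem_wordsOf]
    exact ⟨hr.2, fun j => hr.1 j.1⟩
  · intro r _ r' _ h
    simp only [Prod.mk.injEq] at h
    funext j
    by_cases hj : j ∈ Set.range e
    · obtain ⟨i, rfl⟩ := hj
      exact congrFun h.1 i
    · exact congrFun h.2 ⟨j, hj⟩

theorem relProb_exists_le {N N' : ℕ} (hn : 1 ≤ n) {𝒟 : Type*} [Fintype 𝒟]
    (W : 𝒟 → Set (Fin N' → FreeGroup (Fin n))) (hW : ∀ D, W D ⊆ relTuples n ℓ N') (B : ℝ)
    (hB0 : 0 ≤ B) (hB : ∀ D, ((W D).ncard : ℝ) ≤ B * (2 * n - 1 : ℝ) ^ (N' * ℓ)) :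
    relProb n ℓ N (fun r => ∃ e : Fin N' → Fin N, Function.Injective e ∧ ∃ D, r ∘ e ∈ W D) ≤
      (N : ℝ) ^ N' * Fintype.card 𝒟 * B := by
  classical
  set s := (wordsOf n ℓ).card with hs
  have hs0 : (2 * n - 1 : ℝ) ^ ℓ ≤ s := by
    have := pow_le_card_wordsOf hn ℓ
    have h2 : ((2 * n - 1 : ℕ) : ℝ) = 2 * n - 1 := by
      rw [Nat.cast_sub (by omega)]; push_cast; ring
    rw [← h2]
    exact_mod_cast this
  have hn1 : (1 : ℝ) ≤ 2 * n - 1 := by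
    have : (1 : ℝ) ≤ n := by exact_mod_cast hn
    linarith
  have hpos : (0 : ℝ) < (2 * n - 1 : ℝ) ^ ℓ := pow_pos (by linarith) _
  have hspos : (0 : ℝ) < s := lt_of_lt_of_le hpos hs0
  rw [relProb, ncard_relTuples, ← hs, Nat.cast_pow, div_le_iff₀ (by positivity)]
  let I : Finset ((Fin N' → Fin N) × 𝒟) := Finset.univ.filter fun p => Function.Injective p.1
  have hsub : {r ∈ relTuples n ℓ N | ∃ e : Fin N' → Fin N, Function.Injective e ∧
      ∃ D, r ∘ e ∈ W D} ⊆ ⋃ p ∈ I, {r ∈ relTuples n ℓ N | r ∘ p.1 ∈ W p.2} := by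
    rintro r ⟨hr, e, he, D, h⟩
    simp only [Set.mem_iUnion]
    exact ⟨(e, D), by simp [I, he], hr, h⟩
  have hfin : (⋃ p ∈ I, {r ∈ relTuples n ℓ N | r ∘ p.1 ∈ W p.2}).Finite :=
    I.finite_toSet.biUnion fun p _ => (finite_relTuples n ℓ N).subset fun r hr => hr.1
  have h1 := (Set.ncard_le_ncard hsub hfin).trans (Finset.set_ncard_biUnion_le I _)
  have hterm : ∀ p ∈ I, (({r ∈ relTuples n ℓ N | r ∘ p.1 ∈ W p.2}.ncard : ℕ) : ℝ) ≤
      B * (s : ℝ) ^ N := by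
    intro p hp
    have hp : Function.Injective p.1 := (Finset.mem_filter.1 hp).2
    have hNN : N' ≤ N := by simpa using Fintype.card_le_of_injective _ hp
    calc (({r ∈ relTuples n ℓ N | r ∘ p.1 ∈ W p.2}.ncard : ℕ) : ℝ) ≤
        ((W p.2).ncard * s ^ (N - N') : ℕ) := by
          exact_mod_cast ncard_comp_mem_le p.1 hp (W p.2) (hW p.2)
      _ ≤ (B * (2 * n - 1 : ℝ) ^ (N' * ℓ)) * s ^ (N - N') := by
          push_cast
          exact mul_le_mul_of_nonneg_right (hB p.2) (by positivity)
      _ ≤ (B * (s : ℝ) ^ N') * s ^ (N - N') := by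
          rw [mul_comm N', pow_mul]
          gcongr
      _ = B * (s : ℝ) ^ N := by rw [mul_assoc, ← pow_add, Nat.add_sub_cancel' hNN]
  have hI : (I.card : ℝ) ≤ (N : ℝ) ^ N' * Fintype.card 𝒟 := by
    have : I.card ≤ N ^ N' * Fintype.card 𝒟 := by
      refine (Finset.card_filter_le _ _).trans ?_
      simp
    exact_mod_cast this
  calc _ ≤ ((∑ p ∈ I, {r ∈ relTuples n ℓ N | r ∘ p.1 ∈ W p.2}.ncard : ℕ) : ℝ) := by
        exact_mod_cast h1
    _ ≤ ∑ p ∈ I, B * (s : ℝ) ^ N := by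
        push_cast
        exact Finset.sum_le_sum hterm
    _ ≤ _ := by
        rw [Finset.sum_const, nsmul_eq_mul]
        rw [mul_assoc _ B]
        exact mul_le_mul_of_nonneg_right hI (mul_nonneg hB0 (by positivity))

end Probability

section Patterns

/-- The letters of constants and of the cyclic cores of relators. -/
def trackLet {α A ι : Type*} [Inhabited α] [DecidableEq α] (a : A → FreeGroup α)
    (ρ : ι → FreeGroup α) (u : ι → ℕ) : A ⊕ ι → ℤ → α × Bool
  | .inl s, q => (a s).toWord.getD q.toNat default
  | .inr i, q => corOf ρ u i q

/-- Combinatorial data for coincidences between `N` relators of length `ℓ` and `m` constants: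
conjugator lengths and `B` pairs of segments. -/
abbrev Pattern (m N B ℓ : ℕ) : Type :=
  (Fin N → Fin (ℓ + 1)) × (Fin B → (((Fin m ⊕ Fin N) × Fin (ℓ + 1) × Bool) ×
    ((Fin m ⊕ Fin N) × Fin (ℓ + 1) × Bool)) × Fin (ℓ + 1))

variable {n m N B ℓ : ℕ} [NeZero n]

/-- The tuples of relators realizing a pattern. -/
def Pattern.sol (a : Fin m → FreeGroup (Fin n)) (D : Pattern m N B ℓ) :
    Set (Fin N → FreeGroup (Fin n)) :=
  {ρ ∈ relTuples n ℓ N |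
    (∀ i, ∀ t < (D.1 i : ℕ), (ρ i).toWord.getD (ℓ - 1 - t) default =
      linv ((ρ i).toWord.getD t default)) ∧
    ∀ b, ∀ k < ((D.2 b).2 : ℕ),
      rd (trackLet a ρ (fun i => D.1 i) (D.2 b).1.1.1) (D.2 b).1.1.2.1 (D.2 b).1.1.2.2 k =
      rd (trackLet a ρ (fun i => D.1 i) (D.2 b).1.2.1) (D.2 b).1.2.2.1 (D.2 b).1.2.2.2 k}

/-- The letters of a tuple of relators. -/
def letters (ℓ : ℕ) (ρ : Fin N → FreeGroup (Fin n)) : Fin N × Fin ℓ → Fin n × Bool :=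
  fun x => (ρ x.1).toWord.getD x.2 default

/-- A pattern forcing coincidences at a proportion `2δ` of the places. -/
def Pattern.IsDense (a : Fin m → FreeGroup (Fin n)) (δ : ℝ) (D : Pattern m N B ℓ) : Prop :=
  ∃ Z : Finset (Fin N × Fin ℓ), 2 * (δ * ℓ * N) ≤ Z.card ∧
    ∀ x ∈ Z, Tied (letters ℓ '' D.sol a) x

/-- Some of the relators realize a dense pattern. -/
def Coincident (a : Fin m → FreeGroup (Fin n)) (δ : ℝ) (ℓ N B : ℕ) {M : ℕ}
    (r : Fin M → FreeGroup (Fin n)) : Prop :=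
  ∃ e : Fin N → Fin M, Function.Injective e ∧
    ∃ D : {D : Pattern m N B ℓ // D.IsDense a δ}, r ∘ e ∈ D.1.sol a

theorem letters_injOn : Set.InjOn (letters (n := n) (N := N) ℓ) (relTuples n ℓ N) := by
  intro ρ hρ ρ' hρ' h
  funext i
  apply FreeGroup.toWord_injective
  apply List.ext_getElem
  · rw [hρ i, hρ' i]
  · intro t h1 h2
    have := congrFun h (i, ⟨t, by rw [← hρ i]; exact h1⟩)
    simpa [letters, h1, h2] using this

theorem Pattern.IsDense.ncard_le {a : Fin m → FreeGroup (Fin n)} {δ : ℝ} {D : Pattern m N B ℓ}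
    (h : D.IsDense a δ) :
    ((D.sol a).ncard : ℝ) ≤
      ((2 * n) ^ N * (2 * n - 1 : ℝ) ^ (-(δ * ℓ * N))) * (2 * n - 1 : ℝ) ^ (N * ℓ) := by
  classical
  have hn : 1 ≤ n := Nat.one_le_iff_ne_zero.2 (NeZero.ne n)
  obtain ⟨Z, hZ, hT⟩ := h
  have hsub : D.sol a ⊆ relTuples n ℓ N := fun ρ hρ => hρ.1
  have hf : (letters ℓ '' D.sol a).Finite := ((finite_relTuples n ℓ N).subset hsub).image _
  obtain ⟨E, hE1, hE2⟩ := card_mul_le_of_tied hn hf.toFinset (by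
    intro f hf' i t ht
    obtain ⟨ρ, hρ, rfl⟩ := (Set.Finite.mem_toFinset hf).1 hf'
    have hl := hsub hρ i
    have := (isReduced_iff_getElem _).1 (FreeGroup.isReduced_toWord (x := ρ i)) t (by omega)
    simpa [letters, show t < (ρ i).toWord.length by omega,
      show t + 1 < (ρ i).toWord.length by omega] using this) Z (by simpa using hT)
  rw [← Set.ncard_eq_toFinset_card _ hf, (letters_injOn.mono hsub).ncard_image] at hE2
  have h2 : ((2 * n - 1 : ℕ) : ℝ) = 2 * n - 1 := by
    rw [Nat.cast_sub (by omega)]; push_cast; ring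
  have hn1 : (1 : ℝ) ≤ 2 * n - 1 := by
    have : (1 : ℝ) ≤ n := by exact_mod_cast hn
    linarith
  have hq : (0 : ℝ) < 2 * n - 1 := by linarith
  have hE3 : ((D.sol a).ncard : ℝ) * (2 * n - 1 : ℝ) ^ E ≤
      (2 * n) ^ N * (2 * n - 1 : ℝ) ^ (N * ℓ) := by
    rw [← h2]; exact_mod_cast hE2
  have hE4 : δ * ℓ * N ≤ E := by
    have : (Z.card : ℝ) ≤ 2 * E := by exact_mod_cast hE1
    linarith
  have hp : (0 : ℝ) < (2 * n - 1 : ℝ) ^ (δ * ℓ * N) := Real.rpow_pos_of_pos hq _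
  have hE5 : (2 * n - 1 : ℝ) ^ (δ * ℓ * N) ≤ (2 * n - 1 : ℝ) ^ E := by
    rw [← Real.rpow_natCast]
    exact Real.rpow_le_rpow_of_exponent_le hn1 hE4
  rw [Real.rpow_neg hq.le, mul_right_comm, ← div_eq_mul_inv, le_div_iff₀ hp]
  exact (mul_le_mul_of_nonneg_left hE5 (Nat.cast_nonneg _)).trans hE3

theorem tendsto_relProb_coincident (hn : 2 ≤ n) {d δ : ℝ} (hd : d < δ)
    (a : Fin m → FreeGroup (Fin n)) (N B : ℕ) (hN : 1 ≤ N) :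
    Tendsto (fun ℓ => relProb n ℓ (numRel n d ℓ) (Coincident a δ ℓ N B)) atTop (nhds 0) := by
  classical
  have hn2 : (2 : ℝ) ≤ n := by exact_mod_cast hn
  have hq : (1 : ℝ) < 2 * n - 1 := by linarith
  set q : ℝ := 2 * n - 1 with hqdef
  have hq0 : 0 < q := by linarith
  set x : ℝ := q ^ (-((δ - d) * N)) with hx
  have hN' : (0 : ℝ) < N := by exact_mod_cast hN
  have hx0 : 0 < x := Real.rpow_pos_of_pos hq0 _
  have hx1 : x < 1 := Real.rpow_lt_one_of_one_lt_of_neg hq (by nlinarith)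
  set C : ℝ := ((m + N) * 2) ^ (2 * B) * (2 * n) ^ N with hC
  have hlim : Tendsto (fun ℓ : ℕ => C / x * (((ℓ + 1 : ℕ) : ℝ) ^ (N + 3 * B) * x ^ (ℓ + 1)))
      atTop (nhds 0) := by
    have := tendsto_pow_const_mul_const_pow_of_abs_lt_one (N + 3 * B)
      (show |x| < 1 by rwa [abs_of_pos hx0])
    simpa using (this.comp (tendsto_add_atTop_nat 1)).const_mul (C / x)
  refine squeeze_zero (fun ℓ => by unfold relProb; positivity) (fun ℓ => ?_) hlim
  refine (relProb_exists_le (by omega) (fun D : {D : Pattern m N B ℓ // D.IsDense a δ} => D.1.sol a)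
    (fun D ρ hρ => hρ.1) ((2 * n) ^ N * q ^ (-(δ * ℓ * N))) (by positivity)
    (fun D => D.2.ncard_le)).trans ?_
  have hcard : (Fintype.card {D : Pattern m N B ℓ // D.IsDense a δ} : ℝ) ≤
      ((m + N) * 2) ^ (2 * B) * ((ℓ + 1 : ℕ) : ℝ) ^ (N + 3 * B) := by
    have h : Fintype.card {D : Pattern m N B ℓ // D.IsDense a δ} ≤
        ((m + N) * 2) ^ (2 * B) * (ℓ + 1) ^ (N + 3 * B) := by
      refine (Fintype.card_subtype_le _).trans ?_
      simp only [Fintype.card_prod, Fintype.card_fun, Fintype.card_fin, Fintype.card_sum,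
        Fintype.card_bool]
      refine le_of_eq ?_
      rw [pow_add, pow_mul, pow_mul (ℓ + 1),
        mul_left_comm ((((m + N) * 2) ^ 2) ^ B), ← mul_pow (((m + N) * 2) ^ 2)]
      refine congrArg (fun y => (ℓ + 1) ^ N * y ^ B) ?_
      ring
    exact_mod_cast h
  have hnum : (numRel n d ℓ : ℝ) ^ N ≤ q ^ (d * ℓ * N) := by
    rw [Real.rpow_mul hq0.le, Real.rpow_natCast]
    exact pow_le_pow_left₀ (Nat.cast_nonneg _) (Nat.floor_le (by positivity)) _
  calc _ ≤ q ^ (d * ℓ * N) * (((m + N) * 2) ^ (2 * B) * ((ℓ + 1 : ℕ) : ℝ) ^ (N + 3 * B)) *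
        ((2 * n) ^ N * q ^ (-(δ * ℓ * N))) := by
        gcongr
    _ = (q ^ (d * ℓ * N) * q ^ (-(δ * ℓ * N))) * (C * ((ℓ + 1 : ℕ) : ℝ) ^ (N + 3 * B)) := by
        rw [hC]; ring
    _ = x ^ ℓ * (C * ((ℓ + 1 : ℕ) : ℝ) ^ (N + 3 * B)) := by
        rw [hx, ← Real.rpow_add hq0, ← Real.rpow_mul_natCast hq0.le]
        congr 2
        ring
    _ = _ := by
        rw [pow_succ x]
        field_simp

theorem wop_of_not_coincident (hn : 2 ≤ n) {d δ : ℝ} (hd : d < δ)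
    (a : Fin m → FreeGroup (Fin n)) (I : Finset (ℕ × ℕ)) (hI : ∀ p ∈ I, 1 ≤ p.1)
    (P : ∀ ℓ : ℕ, (Fin (numRel n d ℓ) → FreeGroup (Fin n)) → Prop)
    (hP : ∀ᶠ ℓ in atTop, ∀ r ∈ relTuples n ℓ (numRel n d ℓ),
      (∀ p ∈ I, ¬ Coincident a δ ℓ p.1 p.2 r) → P ℓ r) : wop n d P := by
  classical
  have hlim : Tendsto (fun ℓ => 1 - ∑ p ∈ I,
      relProb n ℓ (numRel n d ℓ) (Coincident a δ ℓ p.1 p.2)) atTop (nhds 1) := by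
    have := tendsto_finsetSum I fun p hp =>
      tendsto_relProb_coincident hn hd a p.1 p.2 (hI p hp)
    simpa using this.const_sub 1
  refine tendsto_of_tendsto_of_tendsto_of_le_of_le' hlim tendsto_const_nhds ?_ ?_
  · filter_upwards [hP] with ℓ hℓ
    set R := relTuples n ℓ (numRel n d ℓ) with hR
    have hfin : R.Finite := finite_relTuples _ _ _
    have hpos : (0 : ℝ) < R.ncard := by exact_mod_cast ncard_relTuples_pos (by omega) ℓ _
    have hsub : R ⊆ {r ∈ R | P ℓ r} ∪ ⋃ p ∈ I, {r ∈ R | Coincident a δ ℓ p.1 p.2 r} := by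
      intro r hr
      by_cases h : ∀ p ∈ I, ¬ Coincident a δ ℓ p.1 p.2 r
      · exact Or.inl ⟨hr, hℓ r hr h⟩
      · push Not at h
        obtain ⟨p, hp, h⟩ := h
        exact Or.inr (Set.mem_biUnion hp ⟨hr, h⟩)
    have hfin' : ({r ∈ R | P ℓ r} ∪ ⋃ p ∈ I, {r ∈ R | Coincident a δ ℓ p.1 p.2 r}).Finite :=
      (hfin.subset fun r hr => hr.1).union
        (I.finite_toSet.biUnion fun p _ => hfin.subset fun r hr => hr.1)
    have h1 : R.ncard ≤ {r ∈ R | P ℓ r}.ncard +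
        ∑ p ∈ I, {r ∈ R | Coincident a δ ℓ p.1 p.2 r}.ncard :=
      (Set.ncard_le_ncard hsub hfin').trans ((Set.ncard_union_le _ _).trans
        (Nat.add_le_add_left (Finset.set_ncard_biUnion_le I _) _))
    have h2 : (R.ncard : ℝ) ≤ ({r ∈ R | P ℓ r}.ncard : ℝ) +
        ∑ p ∈ I, ({r ∈ R | Coincident a δ ℓ p.1 p.2 r}.ncard : ℝ) := by exact_mod_cast h1
    simp only [relProb, ← hR]
    rw [← Finset.sum_div, sub_le_iff_le_add, ← add_div, le_div_iff₀ hpos, one_mul]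
    exact h2
  · filter_upwards with ℓ
    unfold relProb
    refine div_le_one_of_le₀ ?_ (Nat.cast_nonneg _)
    exact_mod_cast Set.ncard_le_ncard (Set.sep_subset _ _) (finite_relTuples _ _ _)

end Patterns

section Ties

theorem tied_of_sgn {α I : Type*} [Inhabited α] {W : Set (I → α × Bool)} {x y : I} {s s' : Bool}
    (h : ∀ f ∈ W, sgn (f x) s = sgn (f y) s') (hxy : x = y → s ≠ s') : Tied W x := by
  by_cases e : x = y
  · subst e
    refine Or.inr ⟨default, fun f hf => ?_⟩
    have h1 := h f hf
    have h2 : s' = !s := by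
      have h3 := hxy rfl
      clear h1 h hxy
      revert s s'
      decide
    rw [h2, sgn_not] at h1
    exact absurd h1.symm (linv_ne _)
  · refine Or.inl ⟨y, fun h => e h.symm, ?_⟩
    by_cases hs : s = s'
    · subst hs
      exact Or.inl fun f hf => sgn_injective s (h f hf)
    · right
      have h2 : s' = !s := by
        clear h hxy
        revert s s'
        decide
      intro f hf
      have h1 := h f hf
      rw [h2, sgn_not] at h1
      refine sgn_injective s (h1.trans ?_)
      cases s <;> simp

theorem tied_of_sgn_eq {α I : Type*} {W : Set (I → α × Bool)} {x : I} {s : Bool} {c : α × Bool}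
    (h : ∀ f ∈ W, sgn (f x) s = c) : Tied W x :=
  Or.inr ⟨sgn c s, fun f hf => by rw [← h f hf, sgn_self_sgn]⟩

variable {n m N B ℓ : ℕ} [NeZero n]

/-- The place of a letter of the cyclic core. -/
def corePlace (u : Fin N → ℕ) (hu : ∀ i, 2 * u i < ℓ) (i : Fin N) (q : ℤ) : Fin N × Fin ℓ :=
  (i, ⟨u i + (q % ((ℓ - 2 * u i : ℕ) : ℤ)).toNat, by
    have h := hu i
    have h1 := Int.emod_lt_of_pos q (show (0 : ℤ) < ((ℓ - 2 * u i : ℕ) : ℤ) by omega)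
    omega⟩)

theorem corePlace_inj {u : Fin N → ℕ} {hu : ∀ i, 2 * u i < ℓ} {i i' : Fin N} {q q' : ℤ}
    (h : corePlace u hu i q = corePlace u hu i' q') :
    i = i' ∧ q % ((ℓ - 2 * u i : ℕ) : ℤ) = q' % ((ℓ - 2 * u i : ℕ) : ℤ) := by
  simp only [corePlace, Prod.mk.injEq, Fin.mk.injEq] at h
  obtain ⟨rfl, h⟩ := h
  have h0 := hu i
  have h1 := Int.emod_nonneg q (show ((ℓ - 2 * u i : ℕ) : ℤ) ≠ 0 by omega)
  have h2 := Int.emod_nonneg q' (show ((ℓ - 2 * u i : ℕ) : ℤ) ≠ 0 by omega)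
  exact ⟨rfl, by omega⟩

theorem rd_trackLet (a : Fin m → FreeGroup (Fin n)) {ρ : Fin N → FreeGroup (Fin n)}
    (hρ : ρ ∈ relTuples n ℓ N) {u : Fin N → ℕ} (hu : ∀ i, 2 * u i < ℓ) (i : Fin N) (z : ℤ)
    (s : Bool) (k : ℤ) :
    rd (trackLet a ρ u (.inr i)) z s k = sgn (letters ℓ ρ (corePlace u hu i (mz z s k))) s := by
  simp only [rd, trackLet, corOf, cor, letters, corePlace, hρ i]

theorem Pattern.tied_strip {a : Fin m → FreeGroup (Fin n)} (D : Pattern m N B ℓ)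
    (hu : ∀ i, 2 * (D.1 i : ℕ) < ℓ) (x : Fin N × Fin ℓ)
    (hx : (x.2 : ℕ) < D.1 x.1 ∨ ℓ ≤ x.2 + D.1 x.1) : Tied (letters ℓ '' D.sol a) x := by
  obtain ⟨i, t, ht⟩ := x
  have h := hu i
  simp only at hx
  refine Or.inl ⟨(i, ⟨ℓ - 1 - t, by omega⟩), ?_, Or.inr ?_⟩
  · simp only [ne_eq, Prod.mk.injEq, Fin.mk.injEq, not_and]
    omega
  · rintro _ ⟨ρ, hρ, rfl⟩
    simp only [letters]
    rcases hx with hx | hx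
    · rw [hρ.2.1 i t hx, linv_linv]
    · rw [← hρ.2.1 i (ℓ - 1 - t) (by omega)]
      congr 2
      omega

theorem comp_mem_sol {M : ℕ} {a : Fin m → FreeGroup (Fin n)} {r : Fin M → FreeGroup (Fin n)}
    (hr : r ∈ relTuples n ℓ M) {u : Fin M → ℕ} (hu : ∀ i, IsCore (r i).toWord (u i))
    (e : Fin N → Fin M) (D : Pattern m N B ℓ) (hD : ∀ i, (D.1 i : ℕ) = u (e i))
    (h : ∀ b, ∀ k < ((D.2 b).2 : ℕ),
      rd (trackLet a (r ∘ e) (u ∘ e) (D.2 b).1.1.1) (D.2 b).1.1.2.1 (D.2 b).1.1.2.2 k =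
      rd (trackLet a (r ∘ e) (u ∘ e) (D.2 b).1.2.1) (D.2 b).1.2.2.1 (D.2 b).1.2.2.2 k) :
    r ∘ e ∈ D.sol a := by
  refine ⟨fun i => hr (e i), fun i t ht => ?_, ?_⟩
  · have := (hu (e i)).strip t (by rw [← hD i]; exact ht)
    rwa [hr (e i)] at this
  · have : (fun i => (D.1 i : ℕ)) = u ∘ e := funext hD
    rw [this]
    exact h

theorem core_le_of_not_coincident {M : ℕ} {a : Fin m → FreeGroup (Fin n)} {δ : ℝ}
    {r : Fin M → FreeGroup (Fin n)} (hr : r ∈ relTuples n ℓ M) {u : Fin M → ℕ}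
    (hu : ∀ i, IsCore (r i).toWord (u i)) (h : ¬ Coincident a δ ℓ 1 0 r) (i : Fin M) :
    (u i : ℝ) ≤ δ * ℓ := by
  classical
  by_contra! hlt
  apply h
  have h2 : 2 * u i < ℓ := by have := (hu i).lt; rwa [hr i] at this
  let D : Pattern m 1 0 ℓ := (fun _ => ⟨u i, by omega⟩, Fin.elim0)
  have hDu : ∀ j, 2 * (D.1 j : ℕ) < ℓ := fun _ => h2
  refine ⟨fun _ => i, Function.injective_of_subsingleton _, ⟨D, ?_⟩,
    comp_mem_sol hr hu _ D (fun _ => rfl) (fun b => b.elim0)⟩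
  let g : Bool × Fin (u i) → Fin 1 × Fin ℓ := fun x =>
    (0, if x.1 then ⟨x.2, by omega⟩ else ⟨ℓ - 1 - x.2, by omega⟩)
  have hg : Function.Injective g := by
    rintro ⟨_ | _, x⟩ ⟨_ | _, y⟩ h <;>
      simp only [g, Prod.mk.injEq, true_and, if_true, Bool.false_eq_true, if_false,
        Fin.ext_iff, reduceCtorEq, false_and] at h ⊢ <;> omega
  refine ⟨Finset.univ.image g, ?_, ?_⟩
  · rw [Finset.card_image_of_injective _ hg]
    simp
    linarith
  · intro x hx
    obtain ⟨⟨b, y⟩, -, rfl⟩ := Finset.mem_image.1 hx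
    refine D.tied_strip hDu _ ?_
    cases b
    · right
      simp only [g, D, Bool.false_eq_true, if_false]
      omega
    · left
      simp only [g, D, if_true]
      omega

end Ties

section Separation

theorem mz_emod (z : ℤ) (s : Bool) (k : ℤ) (L : ℤ) : mz (z % L) s k % L = mz z s k % L := by
  cases s <;> simp [mz]

theorem emod_eq_of_mz {z z' : ℤ} {s : Bool} {k L : ℤ} (h : mz z s k % L = mz z' s k % L) :
    z % L = z' % L := by
  have h1 := mz_emod (mz z s k) (!s) k L
  have h2 := mz_emod (mz z' s k) (!s) k L
  have h3 : ∀ z, mz (mz z s k) (!s) k = z := fun z => by cases s <;> simp [mz]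
  rw [h, h2, h3, h3] at h1
  exact h1.symm

theorem eq_of_mz_emod {z : ℤ} {s : Bool} {j k L : ℕ} (hj : j < L) (hk : k < L)
    (h : mz z s j % L = mz z s k % L) : j = k := by
  have h1 : (L : ℤ) ∣ mz z s j - mz z s k := Int.ModEq.dvd (n := L) (Eq.symm h)
  obtain ⟨c, hc⟩ := h1
  have hc0 : c = 0 := by
    rcases lt_trichotomy c 0 with h0 | h0 | h0
    · cases s <;> simp only [mz, Bool.false_eq_true, if_false, if_true] at hc <;> nlinarith
    · exact h0
    · cases s <;> simp only [mz, Bool.false_eq_true, if_false, if_true] at hc <;> nlinarith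
  subst hc0
  cases s <;> simp only [mz, Bool.false_eq_true, if_false, if_true] at hc <;> omega

theorem rd_corOf_emod {α ι : Type*} [Inhabited α] [DecidableEq α] (r : ι → FreeGroup α)
    (u : ι → ℕ) (i : ι) (z : ℤ) (s : Bool) (k : ℤ) :
    rd (corOf r u i) (z % lenOf r u i) s k = rd (corOf r u i) z s k := by
  rw [rd, rd, corOf_congr r u i (mz_emod z s k _)]

variable {n m N B ℓ : ℕ} [NeZero n]

theorem Pattern.sgn_letters_eq {a : Fin m → FreeGroup (Fin n)} (D : Pattern m N B ℓ)
    (hu : ∀ i, 2 * (D.1 i : ℕ) < ℓ) {b : Fin B} {i i' : Fin N} {z z' : Fin (ℓ + 1)} {s s' : Bool}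
    (hb : (D.2 b).1 = ((.inr i, z, s), (.inr i', z', s'))) {k : ℕ} (hk : k < (D.2 b).2) :
    ∀ f ∈ letters ℓ '' D.sol a,
      sgn (f (corePlace (fun i => (D.1 i : ℕ)) hu i (mz z s k))) s =
      sgn (f (corePlace (fun i => (D.1 i : ℕ)) hu i' (mz z' s' k))) s' := by
  rintro _ ⟨ρ, hρ, rfl⟩
  have := hρ.2.2 b k hk
  rw [hb] at this
  simpa only [rd_trackLet a hρ.1 hu] using this

theorem coincident_of_rd {M : ℕ} {a : Fin m → FreeGroup (Fin n)} {δ : ℝ}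
    {r : Fin M → FreeGroup (Fin n)} (hr : r ∈ relTuples n ℓ M) {u : Fin M → ℕ}
    (hu : ∀ i, IsCore (r i).toWord (u i)) {h : ℕ} (hh : 2 * (δ * ℓ) ≤ h)
    (hL : ∀ i, h ≤ lenOf r u i) {e : Fin N → Fin M} (he : Function.Injective e) {j j' : Fin N}
    (hj : ∀ i, i = j ∨ i = j') {z z' : ℤ} {s s' : Bool}
    (hne : ¬ (j = j' ∧ s = s' ∧ z % lenOf r u (e j) = z' % lenOf r u (e j')))
    (heq : ∀ t : ℕ, t < h → rd (corOf r u (e j)) z s t = rd (corOf r u (e j')) z' s' t) :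
    Coincident a δ ℓ N 1 r := by
  classical
  have hlt : ∀ i, 2 * u i < ℓ := fun i => by have := (hu i).lt; rwa [hr i] at this
  have hlen : ∀ i, lenOf r u i = ℓ - 2 * u i := fun i => by rw [lenOf, hr i]
  have hmod : ∀ i (z : ℤ), 0 ≤ z % lenOf r u i ∧ z % lenOf r u i < ℓ + 1 := fun i z => by
    have h1 := hlt i
    have h2 := hlen i
    have h3 := Int.emod_nonneg z (show (lenOf r u i : ℤ) ≠ 0 by omega)
    have h4 := Int.emod_lt_of_pos z (show (0 : ℤ) < lenOf r u i by omega)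
    omega
  have hhl : h ≤ ℓ := by have := hL (e j); have := hlen (e j); omega
  let D : Pattern m N 1 ℓ := (fun i => ⟨u (e i), by have := hlt (e i); omega⟩, fun _ =>
    (((.inr j, ⟨(z % lenOf r u (e j)).toNat, by have := hmod (e j) z; omega⟩, s),
      (.inr j', ⟨(z' % lenOf r u (e j')).toNat, by have := hmod (e j') z'; omega⟩, s')),
      ⟨h, by omega⟩))
  have hDu : ∀ i, 2 * (D.1 i : ℕ) < ℓ := fun i => hlt (e i)
  have hz : (((z % lenOf r u (e j)).toNat : ℕ) : ℤ) = z % lenOf r u (e j) :=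
    Int.toNat_of_nonneg (hmod _ _).1
  have hz' : (((z' % lenOf r u (e j')).toNat : ℕ) : ℤ) = z' % lenOf r u (e j') :=
    Int.toNat_of_nonneg (hmod _ _).1
  refine ⟨e, he, ⟨D, ?_⟩, comp_mem_sol hr hu e D (fun _ => rfl) (fun b k hk => ?_)⟩
  · let p : Fin N × Fin h → Fin N × Fin ℓ := fun x => if x.1 = j
      then corePlace (fun i => (D.1 i : ℕ)) hDu x.1 (mz (z % lenOf r u (e j)) s (x.2 : ℕ))
      else corePlace (fun i => (D.1 i : ℕ)) hDu x.1 (mz (z' % lenOf r u (e j')) s' (x.2 : ℕ))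
    have hp : Function.Injective p := by
      rintro ⟨i, t⟩ ⟨i', t'⟩ hpp
      have hi : i = i' := by
        have := congrArg Prod.fst hpp
        simp only [p] at this
        split_ifs at this <;> exact this
      subst hi
      have ht := t.2.trans_le (hL (e i))
      have ht' := t'.2.trans_le (hL (e i))
      rw [hlen] at ht ht'
      simp only [p] at hpp
      refine Prod.ext rfl (Fin.ext ?_)
      split_ifs at hpp
      · exact eq_of_mz_emod ht ht' (corePlace_inj hpp).2
      · exact eq_of_mz_emod ht ht' (corePlace_inj hpp).2
    have hT := fun k (hk : k < h) => D.sgn_letters_eq (a := a) hDu (b := 0) rfl (k := k) hk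
    simp only [hz, hz'] at hT
    have hne' : ∀ k : ℕ, corePlace (fun i => (D.1 i : ℕ)) hDu j (mz (z % lenOf r u (e j)) s k) =
        corePlace (fun i => (D.1 i : ℕ)) hDu j' (mz (z' % lenOf r u (e j')) s' k) → s ≠ s' := by
      rintro k hk rfl
      obtain ⟨rfl, hk⟩ := corePlace_inj hk
      refine hne ⟨rfl, rfl, ?_⟩
      rw [hlen] at hk ⊢
      exact (Int.emod_emod z _).symm.trans ((emod_eq_of_mz hk).trans (Int.emod_emod z' _))
    refine ⟨Finset.univ.image p, ?_, ?_⟩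
    · rw [Finset.card_image_of_injective _ hp]
      simp only [Finset.card_univ, Fintype.card_prod, Fintype.card_fin, Nat.cast_mul]
      nlinarith [Nat.cast_nonneg (α := ℝ) N]
    · intro x hx
      obtain ⟨⟨i, t⟩, -, rfl⟩ := Finset.mem_image.1 hx
      simp only [p]
      split_ifs with hi
      · subst hi
        exact tied_of_sgn (hT t t.2) (hne' t)
      · obtain rfl := (hj i).resolve_left hi
        exact tied_of_sgn (fun f hf => (hT t t.2 f hf).symm) fun h => (hne' t h.symm).symm
  · have h1 := heq k hk
    rw [← rd_corOf_emod, ← rd_corOf_emod r u (e j'), ← hz, ← hz'] at h1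
    exact h1

theorem sepAt_of_not_coincident {M : ℕ} {a : Fin m → FreeGroup (Fin n)} {δ : ℝ}
    {r : Fin M → FreeGroup (Fin n)} (hr : r ∈ relTuples n ℓ M) {u : Fin M → ℕ}
    (hu : ∀ i, IsCore (r i).toWord (u i)) {h : ℕ} (hh : 2 * (δ * ℓ) ≤ h)
    (hL : ∀ i, h ≤ lenOf r u i) (h1 : ¬ Coincident a δ ℓ 1 1 r) (h2 : ¬ Coincident a δ ℓ 2 1 r) :
    SepAt r u h := by
  intro i z s i' z' s' heq
  by_contra hne
  by_cases hi : i = i'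
  · subst hi
    exact h1 (coincident_of_rd hr hu hh hL (e := fun _ => i) (Function.injective_of_subsingleton _)
      (j := 0) (j' := 0) (fun _ => Or.inl (Subsingleton.elim _ _)) (by simpa using hne) heq)
  · refine h2 (coincident_of_rd hr hu hh hL (e := ![i, i']) ?_ (j := 0) (j' := 1) ?_
      (by simp) heq)
    · intro x y
      fin_cases x <;> fin_cases y <;> simp [hi, Ne.symm hi]
    · intro x
      fin_cases x <;> simp

end Separation

section Dense

theorem finite_inTr {α ι X A Φ : Type*} [Inhabited α] [DecidableEq α] [Finite X] [Finite A]
    [Finite Φ] (c : Cfg α ι X A Φ) (r : ι → FreeGroup α) (u : ι → ℕ) :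
    {P | c.InTr r u P}.Finite := by
  have hT : Finite (Trk X A Φ) := by
    refine Finite.of_surjective (α := (X ⊕ A) ⊕ (Φ ⊕ Φ))
      (Sum.elim (Sum.elim .var .const) (Sum.elim .cnj .face)) ?_
    rintro (v | s | f | f)
    exacts [⟨.inl (.inl v), rfl⟩, ⟨.inl (.inr s), rfl⟩, ⟨.inr (.inl f), rfl⟩, ⟨.inr (.inr f), rfl⟩]
  refine (Set.finite_iUnion fun τ : Trk X A Φ =>
    (Set.finite_Ico (0 : ℤ) (c.tlen r u τ)).image (Prod.mk τ)).subset ?_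
  rintro ⟨τ, p⟩ hP
  exact Set.mem_iUnion.2 ⟨τ, p, ⟨hP.1, hP.2⟩, rfl⟩

namespace Cfg

/-- A track carrying a constant or a face. -/
def Solid {X A Φ : Type*} (τ : Trk X A Φ) : Prop := (∃ s, τ = .const s) ∨ ∃ f, τ = .face f

/-- A position of a face lying over the position `q` of the relator `i`. -/
def Over {α ι X A Φ : Type*} [Inhabited α] [DecidableEq α] (c : Cfg α ι X A Φ)
    (r : ι → FreeGroup α) (u : ι → ℕ) (i : ι) (q : ℤ) (P : Trk X A Φ × ℤ) : Prop :=
  c.InTr r u P ∧ ∃ f, P.1 = .face f ∧ c.key r u f P.2 = (i, q)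

/-- After elimination of the variables and conjugators, each position of a relator is still
separated by some band. -/
theorem exists_separating {α ι X A Φ : Type*} [Inhabited α] [DecidableEq α] [DecidableEq ι]
    [Finite X] [Finite A] [Fintype Φ] (c : Cfg α ι X A Φ) {r : ι → FreeGroup α} {u : ι → ℕ}
    (hu : ∀ i, IsCore (r i).toWord (u i)) (hsurj : Function.Surjective c.ri)
    (bs : List (Band (Trk X A Φ))) (hv : ∀ b ∈ bs, b.Valid (c.lab r u) (c.InTr r u))
    (hflip : ∀ (U : Set (Trk X A Φ × ℤ)) (i : ι) (q : ℤ), 0 ≤ q → q < lenOf r u i →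
      (∀ f (t : ℤ), 0 ≤ t → t < lenOf r u (c.ri f) →
        ((Trk.face f, t) ∈ U ↔ c.key r u f t = (i, q))) →
      (∀ s t, c.InTr r u (.const s, t) → (Trk.const s, t) ∉ U) →
      (Finset.univ.filter fun f => c.ri f = i).card ≤
        (bs.map fun b => b.area (sepWt U)).sum) :
    ∃ bs' : List (Band (Trk X A Φ)), bs'.length ≤ bs.length ∧
      (∀ b ∈ bs', b.Valid (c.lab r u) (fun P => c.InTr r u P ∧ Solid P.1)) ∧
      ∀ i (q : ℤ), 0 ≤ q → q < lenOf r u i → ∃ b ∈ bs', ∃ k < b.L,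
        ¬ (c.Over r u i q (b.cp k) ↔ c.Over r u i q (b.cq k)) := by
  classical
  have hfin : {P | c.InTr r u P ∧ ¬ Solid P.1}.Finite :=
    (finite_inTr c r u).subset fun P hP => hP.1
  obtain ⟨bs', h1, h2, h3⟩ := exists_eliminate (V := c.InTr r u) (lab := c.lab r u)
    (fun P hP hP' => c.lab_succ_ne r u hu P hP hP') hfin.toFinset (by
      intro P hP Q hQ h
      simp only [Set.Finite.mem_toFinset, Set.mem_ofPred_eq] at hP ⊢
      exact ⟨hQ, by rw [h]; exact hP.2⟩) bs hv
  refine ⟨bs', h1, fun b hb k hk => ?_, fun i q hq0 hq => ?_⟩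
  · obtain ⟨⟨a1, a2⟩, ⟨a3, a4⟩, a5⟩ := h2 b hb k hk
    simp only [Set.Finite.mem_toFinset, Set.mem_ofPred_eq, not_and, not_not] at a2 a4
    exact ⟨⟨a1, a2 a1⟩, ⟨a3, a4 a3⟩, a5⟩
  by_contra! hno
  have hconn : ∀ P Q, Conn bs' P Q → (c.Over r u i q P ↔ c.Over r u i q Q) := by
    intro P Q h
    induction h with
    | rel P Q h =>
      obtain ⟨b, hb, k, hk, rfl, rfl⟩ := h
      have := hno b hb k hk
      tauto
    | refl P => rfl
    | symm P Q _ ih => exact ih.symm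
    | trans P Q R _ _ ih ih' => exact ih.trans ih'
  have hE : ∀ P, Solid P.1 → P ∉ hfin.toFinset := by
    intro P hP h
    simp only [Set.Finite.mem_toFinset, Set.mem_ofPred_eq] at h
    exact h.2 hP
  have hOS : ∀ P, c.Over r u i q P → Solid P.1 := fun P ⟨_, f, hf, _⟩ => Or.inr ⟨f, hf⟩
  let U : Set (Trk X A Φ × ℤ) := {P | ∃ P0, c.Over r u i q P0 ∧ Conn bs P0 P}
  have hU : ∀ P, Solid P.1 → P ∈ U → c.Over r u i q P := by
    rintro P hP ⟨P0, h0, hc⟩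
    exact (hconn _ _ (h3 _ _ (hE _ (hOS _ h0)) (hE _ hP) hc)).1 h0
  have := hflip U i q hq0 hq (fun f t ht0 ht => ⟨fun h => ?_, fun h => ?_⟩) (fun s t hst h => ?_)
  · have h0 : (bs.map fun b => b.area (sepWt U)).sum = 0 := by
      apply List.sum_eq_zero
      intro x hx
      obtain ⟨b, hb, rfl⟩ := List.mem_map.1 hx
      refine Finset.sum_eq_zero fun k hk => ?_
      have hk := Conn.of_mem hb (Finset.mem_range.1 hk)
      refine if_pos ⟨?_, ?_⟩
      · rintro ⟨P0, a1, a2⟩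
        exact ⟨P0, a1, a2.trans hk⟩
      · rintro ⟨P0, a1, a2⟩
        exact ⟨P0, a1, a2.trans hk.symm⟩
    rw [h0, Nat.le_zero, Finset.card_eq_zero] at this
    obtain ⟨f, hf⟩ := hsurj i
    have hm : f ∈ Finset.univ.filter fun f => c.ri f = i := by simp [hf]
    rw [this] at hm
    simp at hm
  · obtain ⟨-, f', hf', hkey⟩ := hU _ (Or.inr ⟨f, rfl⟩) h
    obtain rfl : f = f' := by simpa using hf'
    exact hkey
  · exact ⟨_, ⟨⟨ht0, ht⟩, f, rfl, h⟩, .refl _⟩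
  · obtain ⟨-, f', hf', -⟩ := hU _ (Or.inl ⟨s, rfl⟩) h
    simp at hf'

/-- The side of a pattern corresponding to a position. -/
def side {α ι X A Φ : Type*} (c : Cfg α ι X A Φ) (ℓ : ℕ) (u : ι → ℕ) (i : ι) :
    Trk X A Φ × ℤ → Bool → (A ⊕ ι) × ℤ × Bool
  | (.const s, p), D => (.inl s, p, D)
  | (.face f, p), D =>
    (.inr (c.ri f), mz (c.rz f) (c.rs f) p % ((ℓ - 2 * u (c.ri f) : ℕ) : ℤ), c.rs f == D)
  | (.var _, _), D => (.inr i, 0, D)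
  | (.cnj _, _), D => (.inr i, 0, D)

variable {n m N B ℓ : ℕ} [NeZero n] {X Φ : Type*}

theorem lenOf_eq {r : Fin N → FreeGroup (Fin n)} (hr : r ∈ relTuples n ℓ N) (u : Fin N → ℕ)
    (i : Fin N) : lenOf r u i = ℓ - 2 * u i := by
  rw [lenOf, hr i]

theorem rd_trackLet_side (c : Cfg (Fin n) (Fin N) X (Fin m) Φ) {r : Fin N → FreeGroup (Fin n)}
    (hr : r ∈ relTuples n ℓ N) (u : Fin N → ℕ) (i : Fin N) {P : Trk X (Fin m) Φ × ℤ}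
    (hP : Solid P.1) (D : Bool) (k : ℤ) :
    rd (trackLet c.as r u (c.side ℓ u i P D).1) (c.side ℓ u i P D).2.1 (c.side ℓ u i P D).2.2 k =
      sgn (c.lab r u (mv P D k)) D := by
  obtain ⟨τ, p⟩ := P
  rcases hP with ⟨s, rfl⟩ | ⟨f, rfl⟩
  · rfl
  · simp only [side]
    rw [← lenOf_eq hr]
    exact (rd_corOf_emod r u (c.ri f) _ _ _).trans (sgn_rd_mz _ _ _ _ _ _).symm

theorem side_bounds (c : Cfg (Fin n) (Fin N) X (Fin m) Φ) {r : Fin N → FreeGroup (Fin n)}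
    {u : Fin N → ℕ} (hu : ∀ i, 2 * u i < ℓ)
    (ha : ∀ s, (c.as s).toWord.length ≤ ℓ) (i : Fin N) {P : Trk X (Fin m) Φ × ℤ}
    (hP : c.InTr r u P) (D : Bool) : 0 ≤ (c.side ℓ u i P D).2.1 ∧ (c.side ℓ u i P D).2.1 ≤ ℓ := by
  obtain ⟨τ, p⟩ := P
  rcases τ with v | s | f | f
  · simp [side]
  · have := ha s
    simp only [InTr, tlen] at hP
    simp only [side]
    omega
  · simp [side]
  · simp only [side]
    have h := hu (c.ri f)
    have h1 := Int.emod_nonneg (mz (c.rz f) (c.rs f) p)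
      (show ((ℓ - 2 * u (c.ri f) : ℕ) : ℤ) ≠ 0 by omega)
    have h2 := Int.emod_lt_of_pos (mz (c.rz f) (c.rs f) p)
      (show (0 : ℤ) < ((ℓ - 2 * u (c.ri f) : ℕ) : ℤ) by omega)
    omega

theorem band_length_le (c : Cfg (Fin n) (Fin N) X (Fin m) Φ) {r : Fin N → FreeGroup (Fin n)}
    (hr : r ∈ relTuples n ℓ N) {u : Fin N → ℕ} (ha : ∀ s, (c.as s).toWord.length ≤ ℓ)
    {b : Band (Trk X (Fin m) Φ)}
    (hb : b.Valid (c.lab r u) (fun P => c.InTr r u P ∧ Solid P.1)) : b.L ≤ ℓ := by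
  rcases Nat.eq_zero_or_pos b.L with h | h
  · omega
  obtain ⟨⟨a1, a2⟩, -, -⟩ := hb 0 h
  obtain ⟨⟨a3, -⟩, -, -⟩ := hb (b.L - 1) (by omega)
  have hlen : c.tlen r u b.P.1 ≤ ℓ := by
    have a2 : Solid b.P.1 := a2
    rcases a2 with ⟨s, hs⟩ | ⟨f, hf⟩
    · rw [hs]; exact ha s
    · rw [hf]; exact (lenOf_eq hr u _).le.trans (Nat.sub_le _ _)
  simp only [InTr, Band.cp, mv] at a1 a3
  cases hD : b.D <;> simp [mz, hD] at a1 a3 <;> omega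

/-- The pattern of a list of bands. -/
def pattern (c : Cfg (Fin n) (Fin N) X (Fin m) Φ) {u : Fin N → ℕ} (hu : ∀ i, 2 * u i < ℓ)
    (i : Fin N) (bs : List (Band (Trk X (Fin m) Φ))) : Pattern m N bs.length ℓ :=
  (fun i => ⟨u i, by have := hu i; omega⟩, fun j =>
    let s := c.side ℓ u i (bs.get j).P (bs.get j).D
    let s' := c.side ℓ u i (bs.get j).Q (bs.get j).E
    (((s.1, ⟨min s.2.1.toNat ℓ, by omega⟩, s.2.2), (s'.1, ⟨min s'.2.1.toNat ℓ, by omega⟩, s'.2.2)),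
      ⟨min (bs.get j).L ℓ, by omega⟩))

theorem pattern_rd (c : Cfg (Fin n) (Fin N) X (Fin m) Φ) {r ρ : Fin N → FreeGroup (Fin n)}
    (hρ : ρ ∈ relTuples n ℓ N) {u : Fin N → ℕ} (hu : ∀ i, 2 * u i < ℓ)
    (ha : ∀ s, (c.as s).toWord.length ≤ ℓ) (i : Fin N) {bs : List (Band (Trk X (Fin m) Φ))}
    (hb : ∀ b ∈ bs, b.Valid (c.lab r u) (fun P => c.InTr r u P ∧ Solid P.1))
    (j : Fin bs.length) {k : ℕ} (hk : k < (bs.get j).L) :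
    rd (trackLet c.as ρ u ((c.pattern hu i bs).2 j).1.1.1) ((c.pattern hu i bs).2 j).1.1.2.1
        ((c.pattern hu i bs).2 j).1.1.2.2 k =
      sgn (c.lab ρ u ((bs.get j).cp k)) (bs.get j).D ∧
    rd (trackLet c.as ρ u ((c.pattern hu i bs).2 j).1.2.1) ((c.pattern hu i bs).2 j).1.2.2.1
        ((c.pattern hu i bs).2 j).1.2.2.2 k =
      sgn (c.lab ρ u ((bs.get j).cq k)) (bs.get j).E := by
  obtain ⟨⟨a1, a2⟩, ⟨a3, a4⟩, -⟩ := hb _ (List.get_mem bs j) 0 (by omega)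
  have e1 : (bs.get j).cp 0 = (bs.get j).P := by simp [Band.cp, mv]
  have e2 : (bs.get j).cq 0 = (bs.get j).Q := by simp [Band.cq, mv]
  rw [e1] at a1 a2
  rw [e2] at a3 a4
  obtain ⟨b1, b2⟩ := c.side_bounds (r := r) hu ha i a1 (bs.get j).D
  obtain ⟨b3, b4⟩ := c.side_bounds (r := r) hu ha i a3 (bs.get j).E
  rw [Band.cp, Band.cq, ← c.rd_trackLet_side hρ u i a2, ← c.rd_trackLet_side hρ u i a4]
  simp only [pattern]
  constructor
  · congr 1
    omega
  · congr 1
    omega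

theorem lab_face (c : Cfg (Fin n) (Fin N) X (Fin m) Φ) {ρ : Fin N → FreeGroup (Fin n)}
    (hρ : ρ ∈ relTuples n ℓ N) {u : Fin N → ℕ} (hu : ∀ i, 2 * u i < ℓ) (f : Φ) (t : ℤ) :
    c.lab ρ u (.face f, t) =
      sgn (letters ℓ ρ (corePlace u hu (c.ri f) (mz (c.rz f) (c.rs f) t))) (c.rs f) :=
  rd_trackLet c.as hρ hu _ _ _ _

/-- An identification of a position over a place with a position not over this place ties the
place. -/
theorem tied_of_lab_eq (c : Cfg (Fin n) (Fin N) X (Fin m) Φ) {r : Fin N → FreeGroup (Fin n)}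
    (hr : r ∈ relTuples n ℓ N) {u : Fin N → ℕ} (hu : ∀ i, 2 * u i < ℓ)
    {W : Set (Fin N → FreeGroup (Fin n))} (hW : W ⊆ relTuples n ℓ N) {P Q : Trk X (Fin m) Φ × ℤ}
    {D E : Bool} (h : ∀ ρ ∈ W, sgn (c.lab ρ u P) D = sgn (c.lab ρ u Q) E) {i : Fin N} {q : ℤ}
    (hP : c.Over r u i q P) (hQ : c.InTr r u Q) (hQS : Solid Q.1) (hnQ : ¬ c.Over r u i q Q) :
    Tied (letters ℓ '' W) (corePlace u hu i q) := by
  obtain ⟨τ, p⟩ := P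
  obtain ⟨τ', p'⟩ := Q
  obtain ⟨-, f, hf, hkey⟩ := hP
  simp only at hf hkey
  subst hf
  simp only [key, Prod.mk.injEq, lenOf_eq hr] at hkey
  obtain ⟨rfl, rfl⟩ := hkey
  have hplace : corePlace u hu (c.ri f)
      (mz (c.rz f) (c.rs f) p % ((ℓ - 2 * u (c.ri f) : ℕ) : ℤ)) =
      corePlace u hu (c.ri f) (mz (c.rz f) (c.rs f) p) := by
    simp only [corePlace, Int.emod_emod]
  rw [hplace]
  rcases hQS with ⟨s, hs⟩ | ⟨f', hf'⟩
  · simp only at hs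
    subst hs
    refine tied_of_sgn_eq (s := c.rs f == D)
      (c := sgn ((c.as s).toWord.getD p'.toNat default) E) ?_
    rintro _ ⟨ρ, hρ, rfl⟩
    have := h ρ hρ
    rwa [lab_face c (hW hρ) hu, sgn_sgn] at this
  · simp only at hf'
    subst hf'
    refine tied_of_sgn (s := c.rs f == D) (s' := c.rs f' == E)
      (y := corePlace u hu (c.ri f') (mz (c.rz f') (c.rs f') p')) ?_ fun heq => ?_
    · rintro _ ⟨ρ, hρ, rfl⟩
      have := h ρ hρ
      rwa [lab_face c (hW hρ) hu, lab_face c (hW hρ) hu, sgn_sgn, sgn_sgn] at this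
    · obtain ⟨h1, h2⟩ := corePlace_inj heq
      refine absurd ⟨hQ, f', rfl, ?_⟩ hnQ
      simp only [key, lenOf_eq hr]
      rw [h2, h1]

theorem exists_dense [Finite X] [Fintype Φ] [Nonempty Φ] (c : Cfg (Fin n) (Fin N) X (Fin m) Φ)
    {r : Fin N → FreeGroup (Fin n)} (hr : r ∈ relTuples n ℓ N) {u : Fin N → ℕ}
    (hu : ∀ i, IsCore (r i).toWord (u i)) (hsurj : Function.Surjective c.ri)
    (ha : ∀ s, (c.as s).toWord.length ≤ ℓ) {δ : ℝ} (hδ : 2 * δ ≤ 1)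
    (bs : List (Band (Trk X (Fin m) Φ))) (hv : ∀ b ∈ bs, b.Valid (c.lab r u) (c.InTr r u))
    (hflip : ∀ (U : Set (Trk X (Fin m) Φ × ℤ)) (i : Fin N) (q : ℤ), 0 ≤ q → q < lenOf r u i →
      (∀ f (t : ℤ), 0 ≤ t → t < lenOf r u (c.ri f) →
        ((Trk.face f, t) ∈ U ↔ c.key r u f t = (i, q))) →
      (∀ s t, c.InTr r u (.const s, t) → (Trk.const s, t) ∉ U) →
      (Finset.univ.filter fun f => c.ri f = i).card ≤
        (bs.map fun b => b.area (sepWt U)).sum) :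
    ∃ B ≤ bs.length, ∃ D : Pattern m N B ℓ, D.IsDense c.as δ ∧ r ∈ D.sol c.as := by
  obtain ⟨bs', h1, h2, h3⟩ := c.exists_separating hu hsurj bs hv hflip
  have hlt : ∀ i, 2 * u i < ℓ := fun i => by have := (hu i).lt; rwa [hr i] at this
  obtain ⟨f0⟩ := ‹Nonempty Φ›
  set D := c.pattern hlt (c.ri f0) bs' with hD
  have hk : ∀ j, ((D.2 j).2 : ℕ) ≤ (bs'.get j).L := fun j => min_le_left _ _
  have hk' : ∀ j, ((D.2 j).2 : ℕ) = (bs'.get j).L := fun j =>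
    min_eq_left (c.band_length_le hr ha (h2 _ (List.get_mem bs' j)))
  refine ⟨_, h1, D, ⟨Finset.univ, ?_, ?_⟩,
    comp_mem_sol hr hu id D (fun _ => rfl) fun j k hkj => ?_⟩
  · simp only [Finset.card_univ, Fintype.card_prod, Fintype.card_fin, Nat.cast_mul]
    have : (0 : ℝ) ≤ (N : ℝ) * ℓ := by positivity
    nlinarith
  · rintro ⟨i, t⟩ -
    by_cases hx : (t : ℕ) < D.1 i ∨ ℓ ≤ t + D.1 i
    · exact D.tied_strip hlt _ hx
    have hx : ¬ ((t : ℕ) < u i ∨ ℓ ≤ t + u i) := hx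
    push Not at hx
    have hq : ((t - u i : ℕ) : ℤ) < lenOf r u i := by rw [lenOf_eq hr]; omega
    have hplace : ((i, t) : Fin N × Fin ℓ) = corePlace u hlt i ((t - u i : ℕ) : ℤ) := by
      rw [lenOf_eq hr] at hq
      refine Prod.ext rfl (Fin.ext ?_)
      simp only [corePlace]
      rw [Int.emod_eq_of_lt (by omega) hq]
      omega
    rw [hplace]
    obtain ⟨b, hb, k, hkb, hsep⟩ := h3 i _ (by omega) hq
    obtain ⟨j, rfl⟩ := List.get_of_mem hb
    obtain ⟨⟨a1, a2⟩, ⟨a3, a4⟩, -⟩ := h2 _ hb k hkb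
    have hW : D.sol c.as ⊆ relTuples n ℓ N := fun ρ hρ => hρ.1
    have hlab : ∀ ρ ∈ D.sol c.as, sgn (c.lab ρ u ((bs'.get j).cp k)) (bs'.get j).D =
        sgn (c.lab ρ u ((bs'.get j).cq k)) (bs'.get j).E := by
      intro ρ hρ
      obtain ⟨e1, e2⟩ := c.pattern_rd (r := r) (hW hρ) hlt ha (c.ri f0) h2 j hkb
      rw [← e1, ← e2]
      exact hρ.2.2 j k (by rw [hk']; exact hkb)
    by_cases hO : c.Over r u i ((t - u i : ℕ) : ℤ) ((bs'.get j).cp k)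
    · exact c.tied_of_lab_eq hr hlt hW hlab hO a3 a4 (by tauto)
    · exact c.tied_of_lab_eq hr hlt hW (fun ρ hρ => (hlab ρ hρ).symm) (by tauto) a1 a2 hO
  · obtain ⟨e1, e2⟩ := c.pattern_rd (r := r) hr hlt ha (c.ri f0) h2 j (hkj.trans_le (hk j))
    have := (h2 _ (List.get_mem bs' j) k (hkj.trans_le (hk j))).2.2
    exact e1.trans (this.trans e2.symm)

end Cfg
end Dense

section Lifting

namespace Cfg

variable {n m N ℓ : ℕ} [NeZero n] {X Φ : Type*}

theorem coincident_of_bands [Finite X] [Fintype Φ] [Nonempty Φ] {M : ℕ}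
    (c : Cfg (Fin n) (Fin M) X (Fin m) Φ) {r : Fin M → FreeGroup (Fin n)}
    (hr : r ∈ relTuples n ℓ M) {u : Fin M → ℕ} (hu : ∀ i, IsCore (r i).toWord (u i))
    (ha : ∀ s, (c.as s).toWord.length ≤ ℓ) {δ : ℝ} (hδ : 2 * δ ≤ 1)
    (bs : List (Band (Trk X (Fin m) Φ))) (hv : ∀ b ∈ bs, b.Valid (c.lab r u) (c.InTr r u))
    (hflip : ∀ (U : Set (Trk X (Fin m) Φ × ℤ)) (i : Fin M) (q : ℤ), 0 ≤ q → q < lenOf r u i →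
      (∀ f (t : ℤ), 0 ≤ t → t < lenOf r u (c.ri f) →
        ((Trk.face f, t) ∈ U ↔ c.key r u f t = (i, q))) →
      (∀ s t, c.InTr r u (.const s, t) → (Trk.const s, t) ∉ U) →
      (Finset.univ.filter fun f => c.ri f = i).card ≤
        (bs.map fun b => b.area (sepWt U)).sum) :
    ∃ B ≤ bs.length, Coincident c.as δ ℓ (Finset.univ.image c.ri).card B r := by
  obtain ⟨xs, as, gs, ri, rz, rs⟩ := c
  simp only at ha ⊢
  set S := Finset.univ.image ri with hS
  let ε := S.equivFin
  let e : Fin S.card → Fin M := fun j => (ε.symm j).1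
  have he : Function.Injective e := Subtype.val_injective.comp ε.symm.injective
  let idx : Φ → Fin S.card := fun f => ε ⟨ri f, Finset.mem_image_of_mem _ (Finset.mem_univ f)⟩
  have hidx : e ∘ idx = ri := by
    funext f
    simp [e, idx]
  have hsurj : Function.Surjective idx := by
    intro j
    obtain ⟨f, -, hf⟩ := Finset.mem_image.1 (ε.symm j).2
    refine ⟨f, ε.symm.injective (Subtype.ext ?_)⟩
    simp [idx, hf]
  clear_value S ε e idx
  subst hidx
  have hlab : ∀ P, (⟨xs, as, gs, e ∘ idx, rz, rs⟩ : Cfg (Fin n) (Fin M) X (Fin m) Φ).lab r u P =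
      (⟨xs, as, gs, idx, rz, rs⟩ : Cfg (Fin n) (Fin S.card) X (Fin m) Φ).lab (r ∘ e) (u ∘ e) P := by
    rintro ⟨_ | _ | _ | _, p⟩ <;> rfl
  have htr : ∀ P, (⟨xs, as, gs, e ∘ idx, rz, rs⟩ : Cfg (Fin n) (Fin M) X (Fin m) Φ).InTr r u P ↔
      (⟨xs, as, gs, idx, rz, rs⟩ : Cfg (Fin n) (Fin S.card) X (Fin m) Φ).InTr
        (r ∘ e) (u ∘ e) P := by
    rintro ⟨_ | _ | _ | _, p⟩ <;> rfl
  obtain ⟨B, hB, D, hD, hrD⟩ := exists_dense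
    (⟨xs, as, gs, idx, rz, rs⟩ : Cfg (Fin n) (Fin S.card) X (Fin m) Φ) (r := r ∘ e) (u := u ∘ e)
    (fun i => hr (e i)) (fun i => hu (e i)) hsurj ha hδ bs
    (fun b hb k hk => by
      obtain ⟨a1, a2, a3⟩ := hv b hb k hk
      rw [hlab, hlab] at a3
      exact ⟨(htr _).1 a1, (htr _).1 a2, a3⟩)
    (fun U i q hq0 hq hU hc => by
      have := hflip U (e i) q hq0 hq (fun f t ht0 ht => (hU f t ht0 ht).trans ?_)
        (fun s t hst => hc s t ((htr _).1 hst))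
      · simpa only [Function.comp, he.eq_iff] using this
      · simp only [key, Prod.mk.injEq, Function.comp, he.eq_iff]
        rfl)
  exact ⟨B, hB, e, he, ⟨D, hD⟩, hrD⟩

end Cfg
end Lifting

section Main

/-- The numbers of relators and of bands whose coincidences obstruct lifting solutions. -/
noncomputable def obstructions (δ : ℝ) (C : ℕ) : Finset (ℕ × ℕ) :=
  {(1, 0), (1, 1), (2, 1)} ∪ Finset.Icc 1 ⌊6 * C / (1 - 16 * δ)⌋₊ ×ˢ
    Finset.range (3 * C + 7 * ⌊6 * C / (1 - 16 * δ)⌋₊ + 1)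

variable {n m k ℓ : ℕ} [NeZero n]

theorem card_le_of_sum_le {δ ℓ K C h : ℝ} (hδ : 16 * δ < 1) (hℓ0 : 0 < ℓ)
    (hℓ : 14 ≤ (1 - 16 * δ) * ℓ) (hK : 0 ≤ K) (hC : 0 ≤ C) (hh : h ≤ 2 * (δ * ℓ) + 1)
    (hh' : h ≤ ℓ) (hs : K * ((1 - 2 * δ) * ℓ) ≤ (3 * C + 7 * K) * h) :
    K ≤ 6 * C / (1 - 16 * δ) := by
  rw [le_div_iff₀ (by linarith)]
  have h1 : K * h ≤ K * (2 * (δ * ℓ) + 1) := mul_le_mul_of_nonneg_left hh hK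
  have h2 : C * h ≤ C * ℓ := mul_le_mul_of_nonneg_left hh' hC
  have h3 : K * 14 ≤ K * ((1 - 16 * δ) * ℓ) := mul_le_mul_of_nonneg_left hℓ hK
  refine le_of_mul_le_mul_right ?_ hℓ0
  nlinarith

/-- Absence of coincidences implies that solutions of short systems lift. -/
theorem exists_lift {M : ℕ} {a : Fin m → FreeGroup (Fin n)} {r : Fin M → FreeGroup (Fin n)}
    (hr : r ∈ relTuples n ℓ M) {δ : ℝ} (hδ0 : 0 ≤ δ) (hδ : 16 * δ < 1) {C : ℕ}
    (hℓ : 14 ≤ (1 - 16 * δ) * ℓ) (ha : ∀ s, ((a s).toWord.length : ℝ) ≤ 2 * (δ * ℓ))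
    (hno : ∀ p ∈ obstructions δ C, ¬ Coincident a δ ℓ p.1 p.2 r) {J : Type} [Fintype J]
    (w : J → FreeGroup (Fin k ⊕ Fin m)) (hw : ∑ j, (w j).toWord.length ≤ C)
    (x : Fin k → RandGroup r)
    (hx : ∀ j, FreeGroup.lift (Sum.elim x (fun s => randProj r (a s))) (w j) = 1) :
    ∃ y : Fin k → FreeGroup (Fin n), (∀ v, randProj r (y v) = x v) ∧
      ∀ j, FreeGroup.lift (Sum.elim y a) (w j) = 1 := by
  classical
  by_contra hnl
  have hℓ1 : (14 : ℝ) ≤ ℓ := by nlinarith [Nat.cast_nonneg (α := ℝ) ℓ]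
  have hℓ2 : 14 ≤ ℓ := by exact_mod_cast hℓ1
  have hcore : ∀ i, ∃ u, IsCore (r i).toWord u := fun i =>
    exists_isCore FreeGroup.isReduced_toWord fun h => by
      have := hr i
      rw [h, List.length_nil] at this
      omega
  choose u hu using hcore
  obtain ⟨Φ, _, c, rfl, _, hc⟩ := exists_cfg hu (randProj r) (QuotientGroup.mk'_surjective _)
    (QuotientGroup.ker_mk' _) w a x hx hnl
  have hu1 : ∀ i, (u i : ℝ) ≤ δ * ℓ :=
    core_le_of_not_coincident hr hu (hno (1, 0) (by simp [obstructions]))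
  have hlen : ∀ i, (1 - 2 * δ) * ℓ ≤ (lenOf r u i : ℝ) := by
    intro i
    have h1 := (hu i).lt
    rw [hr i] at h1
    rw [Cfg.lenOf_eq hr, Nat.cast_sub h1.le]
    push_cast
    linarith [hu1 i]
  set h := ⌈2 * (δ * ℓ)⌉₊ with hh
  have hh1 : 2 * (δ * ℓ) ≤ h := Nat.le_ceil _
  have hh2 : (h : ℝ) ≤ 2 * (δ * ℓ) + 1 := (Nat.ceil_lt_add_one (by positivity)).le
  have hδℓ : 16 * (δ * ℓ) ≤ ℓ := by nlinarith
  have hS : SepAt r u h := by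
    refine sepAt_of_not_coincident hr hu hh1 (fun i => ?_) (hno (1, 1) (by simp [obstructions]))
      (hno (2, 1) (by simp [obstructions]))
    have := hlen i
    have : (h : ℝ) ≤ lenOf r u i := by linarith
    exact_mod_cast this
  obtain ⟨bs, hbs, hsum, hflip⟩ := hc _ h fun τ hτ => c.endUnl_mark τ hτ
  have hlenle := c.sum_lenOf_le hS (fun s => by
    have : ((c.as s).toWord.length : ℝ) ≤ 2 * h := by linarith [ha s, Nat.cast_nonneg (α := ℝ) h]
    exact_mod_cast this) bs hbs hflip
  have hK : (Fintype.card Φ : ℝ) ≤ 6 * C / (1 - 16 * δ) := by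
    refine card_le_of_sum_le (h := h) hδ (by linarith) hℓ (Nat.cast_nonneg _) (Nat.cast_nonneg _)
      hh2 (by linarith) ?_
    have h1 : (Fintype.card Φ : ℝ) * ((1 - 2 * δ) * ℓ) ≤ ∑ f, (lenOf r u (c.ri f) : ℝ) := by
      rw [← nsmul_eq_mul, ← Finset.card_univ, ← Finset.sum_const]
      exact Finset.sum_le_sum fun f _ => hlen _
    have h2 : ∑ f, lenOf r u (c.ri f) ≤ (3 * C + 7 * Fintype.card Φ) * h :=
      hlenle.trans (Nat.mul_le_mul_right _ (hsum.trans (by omega)))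
    exact h1.trans (by exact_mod_cast h2)
  have hK' : Fintype.card Φ ≤ ⌊6 * C / (1 - 16 * δ)⌋₊ := Nat.le_floor hK
  have hbl : bs.length ≤ 3 * C + 7 * Fintype.card Φ := by
    have : bs.length ≤ (bs.map Prod.snd).sum := by
      have := List.length_le_sum_of_one_le (bs.map Prod.snd) (by
        intro x hx
        obtain ⟨b, hb, rfl⟩ := List.mem_map.1 hx
        rcases (hbs b hb).2 with h | h <;> omega)
      simpa using this
    omega
  obtain ⟨B, hB, hcoin⟩ := c.coincident_of_bands (δ := δ) hr hu (fun s => by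
    have : ((c.as s).toWord.length : ℝ) ≤ ℓ := by linarith [ha s]
    exact_mod_cast this) (by linarith) (bs.map Prod.fst) (by
      intro b' hb'
      obtain ⟨b, hb, rfl⟩ := List.mem_map.1 hb'
      exact (hbs b hb).1) (by simpa only [List.map_map, Function.comp_def] using hflip)
  rw [List.length_map] at hB
  refine hno ((Finset.univ.image c.ri).card, B) ?_ hcoin
  refine Finset.mem_union_right _ (Finset.mem_product.2 ⟨Finset.mem_Icc.2 ⟨?_, ?_⟩,
    Finset.mem_range.2 (by simp only; omega)⟩)
  · exact Finset.card_pos.2 (Finset.univ_nonempty.image _)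
  · exact Finset.card_image_le.trans hK'

end Main

/-- Suppose that in `F_n` a finite disjunction of finite conjunctions of equations
`Σᵢⱼ(x̄,ā) = 1` (words in variables `x̄ = (x₁,…,x_k)` and constants `ā = (a₁,…,a_m)`
from `F_n`) is equivalent, for every assignment of `x̄`, to the single equation
`σ(x̄,ā) = 1`. Then, with overwhelming probability, the same equivalence holds in the
random group `Γ_ℓ` of density `d < 1/16`, the constants being interpreted as
`π_ℓ(ā)`. -/
theorem disjunction_of_conjunctions_eq_one_equation_randomGroup
    (n : ℕ) (hn : 2 ≤ n) (d : ℝ) (hd0 : 0 ≤ d) (hd : d < 1/16)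
    (k m : ℕ) (M : ℕ) (mi : Fin M → ℕ)
    (W : ∀ i : Fin M, Fin (mi i) → FreeGroup (Fin k ⊕ Fin m))
    (σ : FreeGroup (Fin k ⊕ Fin m))
    (a : Fin m → FreeGroup (Fin n))
    (hF : ∀ x : Fin k → FreeGroup (Fin n),
      (∃ i, ∀ j, FreeGroup.lift (Sum.elim x a) (W i j) = 1) ↔
        FreeGroup.lift (Sum.elim x a) σ = 1) :
    wop n d (fun _ r =>
      ∀ x : Fin k → RandGroup r,
        (∃ i, ∀ j, FreeGroup.lift (Sum.elim x (fun s => randProj r (a s))) (W i j) = 1) ↔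
          FreeGroup.lift (Sum.elim x (fun s => randProj r (a s))) σ = 1) := by
  have : NeZero n := ⟨by omega⟩
  obtain ⟨δ, hdδ, hδ⟩ := exists_between hd
  have hδ0 : 0 < δ := hd0.trans_lt hdδ
  let C : ℕ := ∑ i, ∑ j, (W i j).toWord.length + σ.toWord.length
  refine wop_of_not_coincident hn hdδ a (obstructions δ C) ?_ _ ?_
  · rintro ⟨N, B⟩ hp
    simp only [obstructions, Finset.mem_union, Finset.mem_insert, Finset.mem_singleton,
      Prod.mk.injEq, Finset.mem_product, Finset.mem_Icc] at hp
    simp only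
    omega
  have hlarge : ∀ᶠ ℓ : ℕ in atTop, 14 ≤ (1 - 16 * δ) * ℓ :=
    (tendsto_natCast_atTop_atTop.const_mul_atTop (by linarith)).eventually_ge_atTop 14
  have hlarge' : ∀ᶠ ℓ : ℕ in atTop, ∀ s, ((a s).toWord.length : ℝ) ≤ 2 * (δ * ℓ) :=
    eventually_all.2 fun s => ((tendsto_natCast_atTop_atTop.const_mul_atTop hδ0).const_mul_atTop
      two_pos).eventually_ge_atTop _
  filter_upwards [hlarge, hlarge'] with ℓ hℓ ha r hr hno x
  have hproj : ∀ y : Fin k → FreeGroup (Fin n), (∀ v, randProj r (y v) = x v) → ∀ g,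
      randProj r (FreeGroup.lift (Sum.elim y a) g) =
        FreeGroup.lift (Sum.elim x (fun s => randProj r (a s))) g := by
    intro y hy g
    have : (randProj r).comp (FreeGroup.lift (Sum.elim y a)) =
        FreeGroup.lift (Sum.elim x (fun s => randProj r (a s))) := by
      ext t
      rcases t with v | s <;> simp [hy]
    exact DFunLike.congr_fun this g
  constructor
  · rintro ⟨i, hi⟩
    obtain ⟨y, hy, hyi⟩ := exists_lift hr hδ0.le (by linarith) hℓ ha hno (W i)
      ((Finset.single_le_sum (f := fun i => ∑ j, (W i j).toWord.length)
        (fun _ _ => Nat.zero_le _) (Finset.mem_univ i)).trans (Nat.le_add_right _ _)) x hi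
    rw [← hproj y hy, (hF y).1 ⟨i, hyi⟩, map_one]
  · intro hσ
    obtain ⟨y, hy, hyσ⟩ := exists_lift hr hδ0.le (by linarith) hℓ ha hno (fun _ : Unit => σ)
      (by simp [C]) x (fun _ => hσ)
    obtain ⟨i, hi⟩ := (hF y).2 (hyσ ())
    exact ⟨i, fun j => by rw [← hproj y hy, hi j, map_one]⟩
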